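/- Let α₁ be the unique real root in the interval (2,3) of the polynomial q³ − 9q² + 29q − 32 (α₁ ≈ 2.546602). Then every bridgeless cubic finite multigraph G satisfies F(G,q) ≠ 0 for all real q with 2 < q < α₁. -/

import Mathlib

/-- A finite multigraph on vertex type `V` with edge type `E`: each edge `e` has two
(possibly equal) endpoints `fst e` and `snd e`. -/
structure Multigraph (V E : Type) where
  fst : E → V
  snd : E → V

namespace Multigraph

variable {V E : Type}

/-- `a` and `b` are joined by some edge belonging to the edge set `F`. -/
def edgeRelOn (G : Multigraph V E) (F : Set E) (a b : V) : Prop :=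
  ∃ e ∈ F, (G.fst e = a ∧ G.snd e = b) ∨ (G.fst e = b ∧ G.snd e = a)

/-- Reachability in the spanning subgraph `(V, F)`. -/
def Reach (G : Multigraph V E) (F : Set E) : V → V → Prop :=
  Relation.EqvGen (G.edgeRelOn F)

/-- The setoid on `V` whose classes are the connected components of the
spanning subgraph `(V, F)`. -/
def reachSetoid (G : Multigraph V E) (F : Set E) : Setoid V :=
  Relation.EqvGen.setoid (G.edgeRelOn F)

/-- The number of connected components of the spanning subgraph `(V, F)`. -/
noncomputable def ncomp (G : Multigraph V E) (F : Set E) : ℕ :=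
  Nat.card (Quotient (G.reachSetoid F))

/-- The number of connected components of `G`. -/
noncomputable def numComponents (G : Multigraph V E) : ℕ :=
  G.ncomp Set.univ

/-- `G` is connected. -/
def Connected (G : Multigraph V E) : Prop :=
  G.numComponents = 1

/-- An edge is a bridge if deleting it increases the number of connected components. -/
def IsBridge (G : Multigraph V E) (e : E) : Prop :=
  G.numComponents < G.ncomp {e' | e' ≠ e}

/-- `G` has no bridge. -/
def Bridgeless (G : Multigraph V E) : Prop :=
  ∀ e, ¬ G.IsBridge e

/-- `G` has no loops. -/
def Loopless (G : Multigraph V E) : Prop :=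
  ∀ e, G.fst e ≠ G.snd e

/-- Deleting a set `S` of vertices (and all edges meeting `S`). -/
def deleteVerts (G : Multigraph V E) (S : Set V) :
    Multigraph {v // v ∉ S} {e // G.fst e ∉ S ∧ G.snd e ∉ S} where
  fst := fun e => ⟨G.fst e.1, e.2.1⟩
  snd := fun e => ⟨G.snd e.1, e.2.2⟩

/-- A cut-vertex: a vertex whose deletion increases the number of components. -/
def IsCutVertex (G : Multigraph V E) (x : V) : Prop :=
  G.numComponents < (G.deleteVerts {x}).numComponents

/-- A graph is non-separable if it has at most one vertex and at most one edge, or it is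
connected, loopless and has no cut-vertex. -/
def NonSeparable (G : Multigraph V E) : Prop :=
  (Nat.card V ≤ 1 ∧ Nat.card E ≤ 1) ∨
    (G.Connected ∧ G.Loopless ∧ ∀ x, ¬ G.IsCutVertex x)

/-- The degree of a vertex, counted with edge multiplicity; a loop contributes `2`. -/
noncomputable def degree (G : Multigraph V E) (v : V) : ℕ :=
  Nat.card {e | G.fst e = v} + Nat.card {e | G.snd e = v}

/-- The flow polynomial `F(G,q) = ∑_{E'⊆E} (−1)^{|E|−|E'|} q^{|E'|+c(E')−|V|}`,
where `c(E')` is the number of connected components of the spanning subgraph `(V,E')`. -/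
noncomputable def flowPoly (G : Multigraph V E) [Finite V] [Finite E] : Polynomial ℝ :=
  letI : Fintype E := Fintype.ofFinite E
  ∑ E' : Finset E, (-1 : Polynomial ℝ) ^ (Nat.card E - E'.card) *
    Polynomial.X ^ (E'.card + G.ncomp ↑E' - Nat.card V)

/-- A subgraph of a multigraph: a set of vertices and a set of edges with both
endpoints among those vertices. -/
structure Subgraph (G : Multigraph V E) where
  verts : Set V
  edges : Set E
  fst_mem : ∀ ⦃e⦄, e ∈ edges → G.fst e ∈ verts
  snd_mem : ∀ ⦃e⦄, e ∈ edges → G.snd e ∈ verts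

/-- A subgraph, viewed as a multigraph in its own right. -/
def Subgraph.toMultigraph {G : Multigraph V E} (H : G.Subgraph) :
    Multigraph H.verts H.edges where
  fst := fun e => ⟨G.fst e.1, H.fst_mem e.2⟩
  snd := fun e => ⟨G.snd e.1, H.snd_mem e.2⟩

/-- `H` is a connected component of `G`: its vertex set is the set of vertices reachable
from some vertex, and its edges are all the edges of `G` joining its vertices. -/
def IsComponent {G : Multigraph V E} (H : G.Subgraph) : Prop :=
  (∃ v ∈ H.verts, ∀ u, u ∈ H.verts ↔ G.Reach Set.univ v u) ∧
    ∀ e, e ∈ H.edges ↔ (G.fst e ∈ H.verts ∧ G.snd e ∈ H.verts)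

/-- `H` is a block of `G`: a maximal non-separable subgraph. -/
def IsBlock {G : Multigraph V E} (H : G.Subgraph) : Prop :=
  H.toMultigraph.NonSeparable ∧
    ∀ H' : G.Subgraph, H'.toMultigraph.NonSeparable →
      H.verts ⊆ H'.verts → H.edges ⊆ H'.edges → H' = H

/-- A trivial block: a single vertex and no edges. -/
def Subgraph.IsTrivial {G : Multigraph V E} (H : G.Subgraph) : Prop :=
  (∃ v, H.verts = {v}) ∧ H.edges = ∅

/-- An orientation of a multigraph: each edge is given a tail and a head,
consistent with its two endpoints. -/
structure Orientation (G : Multigraph V E) where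
  tail : E → V
  head : E → V
  consistent : ∀ e, (tail e = G.fst e ∧ head e = G.snd e) ∨
    (tail e = G.snd e ∧ head e = G.fst e)

open Classical in
/-- A `Γ`-flow on an orientation `D`: at every vertex, the sum of the values on
the arcs with that tail equals the sum of the values on the arcs with that head. -/
noncomputable def Orientation.IsFlow {G : Multigraph V E} [Fintype E]
    (D : G.Orientation) {Γ : Type} [AddCommGroup Γ] (φ : E → Γ) : Prop :=
  ∀ v : V, ∑ e ∈ Finset.univ.filter (fun e => D.tail e = v), φ e =
    ∑ e ∈ Finset.univ.filter (fun e => D.head e = v), φ e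

/-- Deleting an edge. -/
def deleteEdge (G : Multigraph V E) (e₀ : E) : Multigraph V {e // e ≠ e₀} where
  fst := fun e => G.fst e.1
  snd := fun e => G.snd e.1

/-- Adding a new edge joining `x` and `y`. -/
def addEdge (G : Multigraph V E) (x y : V) : Multigraph V (E ⊕ Unit) where
  fst := Sum.elim G.fst fun _ => x
  snd := Sum.elim G.snd fun _ => y

/-- Contracting a set `F` of edges: vertices joined through `F` are identified,
and the edges of `F` are removed. -/
def contract (G : Multigraph V E) (F : Set E) :
    Multigraph (Quotient (G.reachSetoid F)) {e // e ∉ F} where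
  fst := fun e => Quotient.mk _ (G.fst e.1)
  snd := fun e => Quotient.mk _ (G.snd e.1)

/-- The number of proper colourings of the vertices of `G` with `n` colours. -/
noncomputable def properColorings (G : Multigraph V E) (n : ℕ) : ℕ :=
  Nat.card {f : V → Fin n // ∀ e, f (G.fst e) ≠ f (G.snd e)}

/-- An isomorphism of multigraphs. -/
structure Iso {V' E' : Type} (G : Multigraph V E) (G' : Multigraph V' E') where
  vmap : V ≃ V'
  emap : E ≃ E'
  ends : ∀ e, (G'.fst (emap e) = vmap (G.fst e) ∧ G'.snd (emap e) = vmap (G.snd e)) ∨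
    (G'.fst (emap e) = vmap (G.snd e) ∧ G'.snd (emap e) = vmap (G.fst e))

open Classical in
/-- Subdividing the edge `e₀`: it is replaced by a path of length two through a new vertex. -/
noncomputable def subdivide (G : Multigraph V E) (e₀ : E) :
    Multigraph (V ⊕ Unit) (E ⊕ Unit) where
  fst := Sum.elim (fun e => Sum.inl (G.fst e)) fun _ => Sum.inr ()
  snd := Sum.elim (fun e => if e = e₀ then Sum.inr () else Sum.inl (G.snd e))
    fun _ => Sum.inl (G.snd e₀)

/-- `G` is a subdivision of `H`. -/
inductive IsSubdivisionOf :
    {V E V' E' : Type} → Multigraph V E → Multigraph V' E' → Prop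
  | of_iso {V E V' E'} {G : Multigraph V E} {H : Multigraph V' E'} :
      Iso G H → IsSubdivisionOf G H
  | step {V E V' E'} {G : Multigraph V E} {H : Multigraph V' E'} (e : E) :
      IsSubdivisionOf G H → IsSubdivisionOf (G.subdivide e) H
  | iso_left {V₁ E₁ V₂ E₂ V' E'} {G₁ : Multigraph V₁ E₁} {G₂ : Multigraph V₂ E₂}
      {H : Multigraph V' E'} :
      Iso G₁ G₂ → IsSubdivisionOf G₂ H → IsSubdivisionOf G₁ H

/-- A multigraph is 3-connected if it has at least 4 vertices and remains connected
after deleting any set of fewer than 3 vertices. -/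
def ThreeConnected (G : Multigraph V E) : Prop :=
  4 ≤ Nat.card V ∧ ∀ S : Set V, S.ncard < 3 → (G.deleteVerts S).Connected

/-- `G` is (isomorphic to) the multigraph `Z_k` with two vertices joined by `k`
parallel edges. -/
def IsZk (G : Multigraph V E) (k : ℕ) : Prop :=
  Nat.card V = 2 ∧ Nat.card E = k ∧ G.Loopless

/-- `G` is essentially 3-connected: a subdivision of a 3-connected graph,
or `Z_k` for some `k ≥ 3`. -/
def EssentiallyThreeConnected (G : Multigraph V E) : Prop :=
  (∃ (V' E' : Type) (H : Multigraph V' E'), H.ThreeConnected ∧ G.IsSubdivisionOf H) ∨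
    ∃ k, 3 ≤ k ∧ G.IsZk k

end Multigraph

section Development

set_option maxHeartbeats 1000000

set_option linter.unusedSectionVars false
set_option linter.unusedSimpArgs false
set_option linter.unusedVariables false
set_option linter.unreachableTactic false
set_option linter.unusedTactic false
set_option linter.unnecessarySeqFocus false
set_option linter.unusedDecidableInType false
set_option linter.unusedFintypeInType false

open Finset Polynomial

namespace CubicFlow

section Basic

variable {V E : Type} [Fintype V] [DecidableEq V] [DecidableEq E]

/-- Functions constant along the edges of `X` correspond to functions on components. -/
noncomputable def constEquiv (G : Multigraph V E) (X : Set E) (A : Type) :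
    {σ : V → A // ∀ e ∈ X, σ (G.fst e) = σ (G.snd e)} ≃ (Quotient (G.reachSetoid X) → A) where
  toFun σ := Quotient.lift σ.1 (by
    intro a b h
    change Relation.EqvGen (G.edgeRelOn X) a b at h
    induction h with
    | rel a b h =>
      obtain ⟨e, he, h | h⟩ := h
      · rw [← h.1, ← h.2]; exact σ.2 e he
      · rw [← h.1, ← h.2]; exact (σ.2 e he).symm
    | refl => rfl
    | symm _ _ _ ih => exact ih.symm
    | trans _ _ _ _ _ h1 h2 => exact h1.trans h2)
  invFun f := ⟨fun v => f (Quotient.mk _ v), by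
    intro e he
    refine congrArg f (Quotient.sound ?_)
    exact Relation.EqvGen.rel _ _ ⟨e, he, Or.inl ⟨rfl, rfl⟩⟩⟩
  left_inv σ := by ext; rfl
  right_inv f := by
    funext x
    induction x using Quotient.inductionOn
    rfl

lemma card_const (G : Multigraph V E) (X : Set E) (n : ℕ) :
    Nat.card {σ : V → Fin n // ∀ e ∈ X, σ (G.fst e) = σ (G.snd e)} = n ^ G.ncomp X := by
  classical
  rw [Nat.card_congr (constEquiv G X (Fin n))]
  rw [Nat.card_fun]
  simp [Multigraph.ncomp]

lemma card_le_ncomp (G : Multigraph V E) (X : Finset E) :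
    Nat.card V ≤ #X + G.ncomp ↑X := by
  classical
  let f : (V → ZMod 2) →+ (X → ZMod 2) :=
    { toFun := fun σ e => σ (G.fst e) - σ (G.snd e)
      map_zero' := by ext; simp
      map_add' := by intro a b; ext e; simp; ring }
  have h1 := AddSubgroup.card_mul_index f.ker
  rw [AddSubgroup.index_ker] at h1
  have h2 : Nat.card f.ker = 2 ^ G.ncomp (X : Set E) := by
    have := card_const G (X : Set E) 2
    rw [← this]
    apply Nat.card_congr
    apply Equiv.subtypeEquivRight
    intro σ
    rw [AddMonoidHom.mem_ker]
    constructor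
    · intro h e he
      have := congrFun h ⟨e, he⟩
      exact sub_eq_zero.1 this
    · intro h
      ext e
      simp only [f, AddMonoidHom.coe_mk, ZeroHom.coe_mk, Pi.zero_apply]
      exact sub_eq_zero.2 (h e.1 e.2)
  have h3 : Nat.card f.range ≤ 2 ^ #X := by
    have : Nat.card (X → ZMod 2) = 2 ^ #X := by simp [Nat.card_fun]
    rw [← this]
    exact Nat.card_le_card_of_injective _ Subtype.val_injective
  have h4 : Nat.card (V → ZMod 2) = 2 ^ Nat.card V := by simp [Nat.card_fun]
  rw [h2, h4] at h1
  have h5 : 2 ^ Nat.card V ≤ 2 ^ (#X + G.ncomp (X : Set E)) := by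
    rw [← h1, pow_add, mul_comm]
    gcongr
  exact (Nat.pow_le_pow_iff_right (by norm_num)).1 h5

/-- the flow polynomial of the graph with edge set `F`. -/
noncomputable def fp (s t : E → V) (F : Finset E) : ℝ[X] :=
  ∑ X ∈ F.powerset, (-1 : ℝ[X]) ^ (#F - #X) *
    Polynomial.X ^ (#X + Multigraph.ncomp (⟨s, t⟩ : Multigraph V E) ↑X - Nat.card V)

/-- state sum. -/
noncomputable def stateSum (n : ℕ) (s t : E → V) (F : Finset E) : ℝ :=
  ∑ σ : V → Fin n, ∏ e ∈ F, ((if σ (s e) = σ (t e) then (n : ℝ) else 0) + (-1))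

lemma fp_eval (n : ℕ) (s t : E → V) (F : Finset E) :
    (n : ℝ) ^ Nat.card V * (fp s t F).eval (n : ℝ) = stateSum n s t F := by
  classical
  unfold fp stateSum
  simp_rw [Finset.prod_add]
  rw [Finset.sum_comm, Polynomial.eval_finsetSum, Finset.mul_sum]
  refine Finset.sum_congr rfl ?_
  intro X hX
  have hX' := Finset.mem_powerset.1 hX
  rw [← Finset.sum_mul]
  have h1 : ∑ σ : V → Fin n, ∏ e ∈ X, (if σ (s e) = σ (t e) then (n : ℝ) else 0)
      = (n : ℝ) ^ #X * (n : ℝ) ^ Multigraph.ncomp (⟨s, t⟩ : Multigraph V E) (X : Set E) := by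
    have h2 : ∀ σ : V → Fin n, ∏ e ∈ X, (if σ (s e) = σ (t e) then (n : ℝ) else 0)
       = if ∀ e ∈ (X : Set E), σ (s e) = σ (t e) then (n : ℝ) ^ #X else 0 := by
      intro σ
      split_ifs with h
      · rw [Finset.prod_congr rfl (fun e he => if_pos (h e he))]
        simp
      · push Not at h
        obtain ⟨e, he, hne⟩ := h
        exact Finset.prod_eq_zero (i := e) he (if_neg hne)
    simp_rw [h2]
    rw [← Finset.sum_filter, Finset.sum_const, nsmul_eq_mul, mul_comm]
    congr 1
    rw [← Nat.cast_pow, ← card_const]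
    simp [Fintype.card_subtype]
  rw [h1, Finset.prod_const, Finset.card_sdiff_of_subset hX']
  simp only [eval_mul, eval_pow, eval_neg, eval_one, eval_X]
  have h3 := card_le_ncomp (⟨s, t⟩ : Multigraph V E) X
  have h4 : (n : ℝ) ^ Nat.card V * (n : ℝ) ^ (#X + Multigraph.ncomp (⟨s, t⟩ : Multigraph V E) (X : Set E) - Nat.card V) =
     (n : ℝ) ^ #X * (n : ℝ) ^ Multigraph.ncomp (⟨s, t⟩ : Multigraph V E) (X : Set E) := by
    rw [← pow_add, ← pow_add]; congr 1; omega
  rw [← h4]; ring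

lemma poly_ext {p q : ℝ[X]} (h : ∀ n : ℕ, 1 ≤ n → p.eval (n : ℝ) = q.eval (n : ℝ)) : p = q := by
  apply Polynomial.eq_of_infinite_eval_eq
  refine Set.Infinite.mono (s := (fun n : ℕ => (n : ℝ)) '' Set.Ici 1) ?_ ?_
  · rintro _ ⟨n, hn, rfl⟩; exact h n hn
  · exact (Set.Ici_infinite 1).image (Nat.cast_injective.injOn)

lemma fp_empty (s t : E → V) : fp s t ∅ = 1 := by
  apply poly_ext
  intro n hn
  have hn' : (n : ℝ) ^ Nat.card V ≠ 0 := by positivity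
  apply mul_left_cancel₀ hn'
  rw [fp_eval]
  simp [stateSum]

lemma fp_loop (s t : E → V) (F : Finset E) (e : E) (he : e ∈ F) (hl : s e = t e) :
    fp s t F = (X - 1) * fp s t (F.erase e) := by
  apply poly_ext
  intro n hn
  have hn' : (n : ℝ) ^ Nat.card V ≠ 0 := by positivity
  apply mul_left_cancel₀ hn'
  rw [eval_mul, mul_left_comm, fp_eval, fp_eval]
  unfold stateSum
  rw [Finset.mul_sum]
  refine Finset.sum_congr rfl fun σ _ => ?_
  rw [← Finset.mul_prod_erase F _ he, hl]
  simp [sub_eq_add_neg]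

lemma fp_congr {s t s' t' : E → V} {F : Finset E}
    (h : ∀ e ∈ F, (s' e = s e ∧ t' e = t e) ∨ (s' e = t e ∧ t' e = s e)) :
    fp s' t' F = fp s t F := by
  apply poly_ext
  intro n hn
  have hn' : (n : ℝ) ^ Nat.card V ≠ 0 := by positivity
  apply mul_left_cancel₀ hn'
  rw [fp_eval, fp_eval]
  unfold stateSum
  refine Finset.sum_congr rfl fun σ _ => ?_
  refine Finset.prod_congr rfl fun e he => ?_
  rcases h e he with ⟨h1, h2⟩ | ⟨h1, h2⟩
  · rw [h1, h2]
  · rw [h1, h2]; simp only [eq_comm]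

lemma fp_perm (π : Equiv.Perm V) (s t : E → V) (F : Finset E) :
    fp (π ∘ s) (π ∘ t) F = fp s t F := by
  apply poly_ext
  intro n hn
  have hn' : (n : ℝ) ^ Nat.card V ≠ 0 := by positivity
  apply mul_left_cancel₀ hn'
  rw [fp_eval, fp_eval]
  unfold stateSum
  refine Fintype.sum_equiv (Equiv.arrowCongr π.symm (Equiv.refl _)) _ _ ?_
  intro σ
  refine Finset.prod_congr rfl fun e he => ?_
  simp [Equiv.arrowCongr]

/-- replacing `v` by `w` -/
def mv (v w : V) : V → V := fun x => if x = v then w else x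

lemma fp_contract (s t : E → V) (F : Finset E) (e : E) (he : e ∈ F) (hl : s e ≠ t e) :
    fp s t F = fp (mv (s e) (t e) ∘ s) (mv (s e) (t e) ∘ t) (F.erase e) - fp s t (F.erase e) := by
  classical
  apply poly_ext
  intro n hn
  have hn' : (n : ℝ) ^ Nat.card V ≠ 0 := by positivity
  apply mul_left_cancel₀ hn'
  rw [eval_sub, mul_sub, fp_eval, fp_eval, fp_eval]
  unfold stateSum
  set P : (V → Fin n) → ℝ := fun σ =>
    ∏ f ∈ F.erase e, ((if σ (s f) = σ (t f) then (n : ℝ) else 0) + (-1)) with hP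
  have h1 : ∀ σ : V → Fin n, ∏ f ∈ F, ((if σ (s f) = σ (t f) then (n : ℝ) else 0) + (-1))
      = n * (if σ (s e) = σ (t e) then P σ else 0) - P σ := by
    intro σ
    rw [← Finset.mul_prod_erase F _ he]
    simp only [hP]
    split_ifs <;> ring
  have h2 : ∀ σ : V → Fin n, ∏ f ∈ F.erase e, ((if σ ((mv (s e) (t e) ∘ s) f) = σ ((mv (s e) (t e) ∘ t) f) then (n : ℝ) else 0) + (-1))
      = P (Function.update σ (s e) (σ (t e))) := by
    intro σ
    simp only [hP]
    refine Finset.prod_congr rfl fun f _ => ?_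
    have : ∀ x, σ (mv (s e) (t e) x) = Function.update σ (s e) (σ (t e)) x := by
      intro x
      unfold mv
      split_ifs with hx
      · subst hx; simp
      · simp [hx]
    simp only [Function.comp, this]
  rw [Finset.sum_congr rfl fun σ _ => h1 σ, Finset.sum_congr rfl fun σ _ => h2 σ]
  rw [Finset.sum_sub_distrib, ← Finset.mul_sum]
  congr 1
  rw [← Finset.sum_filter, Finset.mul_sum]
  rw [← Finset.sum_fiberwise_of_maps_to (s := univ)
    (t := univ.filter (fun σ : V → Fin n => σ (s e) = σ (t e)))
    (g := fun σ => Function.update σ (s e) (σ (t e)))]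
  · refine Finset.sum_congr rfl fun τ hτ => ?_
    have hτ' := (Finset.mem_filter.1 hτ).2
    rw [Finset.sum_congr rfl (g := fun _ => P τ)]
    · rw [Finset.sum_const, nsmul_eq_mul]
      congr 1
      have : (univ.filter fun σ : V → Fin n => Function.update σ (s e) (σ (t e)) = τ)
          = univ.image (fun i : Fin n => Function.update τ (s e) i) := by
        ext σ
        simp only [mem_filter, mem_univ, true_and, mem_image]
        constructor
        · intro h
          refine ⟨σ (s e), ?_⟩
          rw [← h]; simp
        · rintro ⟨i, rfl⟩
          rw [Function.update_of_ne (Ne.symm hl), ← hτ']; simp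
      rw [this, Finset.card_image_of_injective _ (Function.update_injective τ (s e))]
      simp
    · intro σ hσ
      rw [(Finset.mem_filter.1 hσ).2]
  · intro σ _
    simp [Function.update_of_ne (Ne.symm hl)]

/-- evaluation of the flow polynomial -/
noncomputable def phi (q : ℝ) (s t : E → V) (F : Finset E) : ℝ := (fp s t F).eval q

lemma phi_empty (q : ℝ) (s t : E → V) : phi q s t ∅ = 1 := by simp [phi, fp_empty]

lemma phi_loop (q : ℝ) (s t : E → V) {F : Finset E} {e : E} (he : e ∈ F) (hl : s e = t e) :
    phi q s t F = (q - 1) * phi q s t (F.erase e) := by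
  simp [phi, fp_loop s t F e he hl]

lemma phi_congr {q : ℝ} {s t s' t' : E → V} {F : Finset E}
    (h : ∀ e ∈ F, (s' e = s e ∧ t' e = t e) ∨ (s' e = t e ∧ t' e = s e)) :
    phi q s' t' F = phi q s t F := by
  simp [phi, fp_congr h]

lemma phi_congr' {q : ℝ} {s t s' t' : E → V} {F : Finset E}
    (h : ∀ e ∈ F, s' e = s e ∧ t' e = t e) :
    phi q s' t' F = phi q s t F := phi_congr fun e he => Or.inl (h e he)

lemma phi_perm (q : ℝ) (π : Equiv.Perm V) (s t : E → V) (F : Finset E) :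
    phi q (π ∘ s) (π ∘ t) F = phi q s t F := by
  simp [phi, fp_perm π s t F]

lemma phi_contract (q : ℝ) (s t : E → V) {F : Finset E} {e : E} (he : e ∈ F) (hl : s e ≠ t e) :
    phi q s t F = phi q (mv (s e) (t e) ∘ s) (mv (s e) (t e) ∘ t) (F.erase e)
      - phi q s t (F.erase e) := by
  simp [phi, fp_contract s t F e he hl]

lemma phi_contract' (q : ℝ) (s t : E → V) {F : Finset E} {e : E} (he : e ∈ F) (hl : s e ≠ t e) :
    phi q s t F = phi q (mv (t e) (s e) ∘ s) (mv (t e) (s e) ∘ t) (F.erase e)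
      - phi q s t (F.erase e) := by
  have h1 := phi_contract q t s he (Ne.symm hl)
  rw [phi_congr (s := s) (t := t) (s' := t) (t' := s) fun _ _ => Or.inr ⟨rfl, rfl⟩,
    phi_congr (s := s) (t := t) (s' := t) (t' := s) fun _ _ => Or.inr ⟨rfl, rfl⟩] at h1
  rw [h1]
  congr 1
  exact phi_congr fun _ _ => Or.inr ⟨rfl, rfl⟩

lemma flowPoly_eval [Fintype E] (G : Multigraph V E) (q : ℝ) :
    G.flowPoly.eval q = phi q G.fst G.snd Finset.univ := by
  unfold phi fp Multigraph.flowPoly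
  congr 1
  rw [Finset.powerset_univ]
  have : Fintype.ofFinite E = ‹Fintype E› := Subsingleton.elim _ _
  rw [this]
  simp

end Basic

end CubicFlow

namespace CubicFlow

section Reduce

variable {V E : Type} [Fintype V] [DecidableEq V] [DecidableEq E]

/-- collapse of the set `T` onto `w` -/
def col (T : Finset V) (w : V) : V → V := fun x => if x ∈ T then w else x

lemma col_mem {T : Finset V} {w x : V} (h : x ∈ T) : col T w x = w := if_pos h
lemma col_not {T : Finset V} {w x : V} (h : x ∉ T) : col T w x = x := if_neg h
lemma mv_self (v w : V) : mv v w v = w := if_pos rfl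
lemma mv_ne {v w x : V} (h : x ≠ v) : mv v w x = x := if_neg h

lemma phi_pendant (q : ℝ) (s t : E → V) {F : Finset E} {e : E} (he : e ∈ F) (p : V)
    (h1 : (s e = p ∧ t e ≠ p) ∨ (t e = p ∧ s e ≠ p))
    (h2 : ∀ e' ∈ F, e' ≠ e → s e' ≠ p ∧ t e' ≠ p) : phi q s t F = 0 := by
  rcases h1 with ⟨rfl, h⟩ | ⟨rfl, h⟩
  · rw [phi_contract q s t he (Ne.symm h), sub_eq_zero]
    refine phi_congr' fun e' he' => ?_
    obtain ⟨h3, h4⟩ := h2 e' (mem_of_mem_erase he') (ne_of_mem_erase he')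
    exact ⟨mv_ne h3, mv_ne h4⟩
  · rw [phi_contract' q s t he h, sub_eq_zero]
    refine phi_congr' fun e' he' => ?_
    obtain ⟨h3, h4⟩ := h2 e' (mem_of_mem_erase he') (ne_of_mem_erase he')
    exact ⟨mv_ne h3, mv_ne h4⟩

lemma phi_loops (q : ℝ) (s t : E → V) (F : Finset E) (h : ∀ e ∈ F, s e = t e) :
    phi q s t F = (q - 1) ^ #F := by
  induction F using Finset.induction_on with
  | empty => simp [phi_empty]
  | insert e F he ih =>
    rw [phi_loop q s t (mem_insert_self e F) (h e (mem_insert_self e F)),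
      erase_insert he, ih fun e' he' => h e' (mem_insert_of_mem he'), card_insert_of_notMem he]
    ring

/-- value of the flow polynomial on `n` parallel edges -/
noncomputable def bond (q : ℝ) : ℕ → ℝ
  | 0 => 1
  | n + 1 => (q - 1) ^ n - bond q n

lemma phi_bond (q : ℝ) (s t : E → V) (F : Finset E) (a b : V) (hab : a ≠ b)
    (h : ∀ e ∈ F, (s e = a ∧ t e = b) ∨ (s e = b ∧ t e = a)) :
    phi q s t F = bond q #F := by
  induction F using Finset.induction_on with
  | empty => simp [phi_empty, bond]
  | insert e F he ih =>
    have hne : s e ≠ t e := by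
      rcases h e (mem_insert_self e F) with ⟨h1, h2⟩ | ⟨h1, h2⟩ <;> rw [h1, h2]
      · exact hab
      · exact hab.symm
    rw [phi_contract q s t (mem_insert_self e F) hne,
      erase_insert he, ih fun e' he' => h e' (mem_insert_of_mem he'), card_insert_of_notMem he, bond,
      phi_loops]
    intro e' he'
    have h1 := h e (mem_insert_self e F)
    have h2 := h e' (mem_insert_of_mem he')
    have hba := hab.symm
    rcases h1 with ⟨h1, h1'⟩ | ⟨h1, h1'⟩ <;> rcases h2 with ⟨h2, h2'⟩ | ⟨h2, h2'⟩ <;>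
      simp [mv, h1, h1', h2, h2', hab, hba]

lemma bond_zero (q : ℝ) : bond q 0 = 1 := rfl
lemma bond_one (q : ℝ) : bond q 1 = 0 := by simp [bond]
lemma bond_two (q : ℝ) : bond q 2 = q - 1 := by simp [bond]
lemma bond_three (q : ℝ) : bond q 3 = (q - 1) * (q - 2) := by simp [bond]; ring

lemma reduce (q : ℝ) (T W : Finset V) (hW : #W ≤ 1) (FT : Finset E) :
    ∀ (s t : E → V), (∀ e ∈ FT, s e ∈ T ∪ W ∧ t e ∈ T ∪ W) →
    ∃ l : List (ℝ × (V → V)),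
      (∀ p ∈ l, (∀ x, x ∉ T → p.2 x = x) ∧ (∀ x ∈ T, p.2 x ∈ T ∪ W)) ∧
      ∀ s' t' : E → V, (∀ e ∈ FT, s' e = s e ∧ t' e = t e) → ∀ FR : Finset E, Disjoint FR FT →
        phi q s' t' (FR ∪ FT) =
          (l.map fun p => p.1 * phi q (p.2 ∘ s') (p.2 ∘ t') FR).sum := by
  induction FT using Finset.induction_on with
  | empty =>
    intro s t _
    refine ⟨[(1, id)], ?_, ?_⟩
    · intro p hp
      simp only [List.mem_singleton] at hp
      subst hp
      exact ⟨fun _ _ => rfl, fun x hx => mem_union_left _ hx⟩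
    · intro s' t' _ FR _
      simp
  | insert e FT he ih =>
    intro s t hst
    have hst' : ∀ e ∈ FT, s e ∈ T ∪ W ∧ t e ∈ T ∪ W := fun e' he' => hst e' (mem_insert_of_mem he')
    obtain ⟨l2, hl2, hl2'⟩ := ih s t hst'
    have hse := hst e (mem_insert_self e FT)
    have key : ∀ (s' t' : E → V), (∀ e' ∈ insert e FT, s' e' = s e' ∧ t' e' = t e') →
      (∀ e' ∈ FT, s' e' = s e' ∧ t' e' = t e') := fun s' t' h e' he' => h e' (mem_insert_of_mem he')
    have key2 : ∀ FR : Finset E, Disjoint FR (insert e FT) →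
        (FR ∪ insert e FT).erase e = FR ∪ FT ∧ Disjoint FR FT := by
      intro FR hd
      have h1 : e ∉ FR := fun h => disjoint_left.1 hd h (mem_insert_self e FT)
      constructor
      · rw [union_insert, erase_insert]
        simp [h1, he]
      · exact hd.mono_right (subset_insert _ _)
    by_cases hl : s e = t e
    · refine ⟨l2.map fun p => ((q - 1) * p.1, p.2), ?_, ?_⟩
      · intro p hp
        obtain ⟨p', hp', rfl⟩ := List.mem_map.1 hp
        exact hl2 p' hp'
      · intro s' t' h FR hd
        obtain ⟨k1, k2⟩ := key2 FR hd
        have h0 := h e (mem_insert_self e FT)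
        rw [phi_loop q s' t' (e := e) (by simp) (by rw [h0.1, h0.2, hl]), k1,
          hl2' s' t' (key s' t' h) FR k2, List.map_map, ← List.sum_map_mul_left]
        congr 1
        refine List.map_congr_left fun p _ => ?_
        simp [mul_assoc]
    · -- one end in T
      have main : ∀ u u' : V, u ∈ T → u' ∈ T ∪ W → (∀ (s' t' : E → V),
          (∀ e' ∈ insert e FT, s' e' = s e' ∧ t' e' = t e') → ∀ F : Finset E, e ∈ F →
          phi q s' t' F = phi q (mv u u' ∘ s') (mv u u' ∘ t') (F.erase e) - phi q s' t' (F.erase e)) →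
          ∃ l : List (ℝ × (V → V)),
      (∀ p ∈ l, (∀ x, x ∉ T → p.2 x = x) ∧ (∀ x ∈ T, p.2 x ∈ T ∪ W)) ∧
      ∀ s' t' : E → V, (∀ e' ∈ insert e FT, s' e' = s e' ∧ t' e' = t e') → ∀ FR : Finset E, Disjoint FR (insert e FT) →
        phi q s' t' (FR ∪ insert e FT) =
          (l.map fun p => p.1 * phi q (p.2 ∘ s') (p.2 ∘ t') FR).sum := by
        intro u u' hu hu' hphi
        have hm : ∀ x ∈ T ∪ W, mv u u' x ∈ T ∪ W := by
          intro x hx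
          unfold mv
          split_ifs
          · exact hu'
          · exact hx
        obtain ⟨l1, hl1, hl1'⟩ := ih (mv u u' ∘ s) (mv u u' ∘ t) (fun e' he' =>
          ⟨hm _ (hst' e' he').1, hm _ (hst' e' he').2⟩)
        refine ⟨(l1.map fun p => (p.1, p.2 ∘ mv u u')) ++ (l2.map fun p => (-p.1, p.2)), ?_, ?_⟩
        · intro p hp
          rcases List.mem_append.1 hp with hp | hp
          · obtain ⟨p', hp', rfl⟩ := List.mem_map.1 hp
            obtain ⟨a1, a2⟩ := hl1 p' hp'
            constructor
            · intro x hx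
              have : x ≠ u := fun h => hx (h ▸ hu)
              simp only [Function.comp]
              rw [mv_ne this, a1 x hx]
            · intro x hx
              have := hm x (mem_union_left _ hx)
              simp only [Function.comp]
              by_cases hx2 : mv u u' x ∈ T
              · exact a2 _ hx2
              · rw [a1 _ hx2]; exact this
          · obtain ⟨p', hp', rfl⟩ := List.mem_map.1 hp
            exact hl2 p' hp'
        · intro s' t' h FR hd
          obtain ⟨k1, k2⟩ := key2 FR hd
          rw [hphi s' t' h (FR ∪ insert e FT) (by simp), k1, hl2' s' t' (key s' t' h) FR k2,
            hl1' (mv u u' ∘ s') (mv u u' ∘ t') (fun e' he' => by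
              simp only [Function.comp]; rw [(key s' t' h e' he').1, (key s' t' h e' he').2]; exact ⟨rfl, rfl⟩) FR k2]
          rw [List.map_append, List.sum_append, List.map_map, List.map_map, sub_eq_add_neg]
          congr 1
          rw [neg_eq_neg_one_mul, ← List.sum_map_mul_left]
          congr 1
          refine List.map_congr_left fun p _ => ?_
          simp
      by_cases hsT : s e ∈ T
      · refine main (s e) (t e) hsT hse.2 ?_
        intro s' t' h F hF
        have h0 := h e (mem_insert_self e FT)
        have := phi_contract q s' t' hF (by rw [h0.1, h0.2]; exact hl)
        rw [h0.1, h0.2] at this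
        exact this
      · have htT : t e ∈ T := by
          by_contra htT
          have h1 : s e ∈ W := (mem_union.1 hse.1).resolve_left hsT
          have h2 : t e ∈ W := (mem_union.1 hse.2).resolve_left htT
          exact hl (card_le_one.1 hW _ h1 _ h2)
        refine main (t e) (s e) htT hse.1 ?_
        intro s' t' h F hF
        have h0 := h e (mem_insert_self e FT)
        have := phi_contract' q s' t' hF (by rw [h0.1, h0.2]; exact hl)
        rw [h0.1, h0.2] at this
        exact this

lemma sum_list_const {A : Type} (l : List A) (f : A → ℝ) (P : A → Prop) (hl : ∀ p ∈ l, P p)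
    {ι : Type} (Q : ι → Prop) (g : A → ι → ℝ) (r r' : ι → ℝ)
    (h : ∀ p, P p → ∃ k k' : ℝ, ∀ i, Q i → g p i = k * r i + k' * r' i) :
    ∃ k k' : ℝ, ∀ i, Q i → (l.map fun p => f p * g p i).sum = k * r i + k' * r' i := by
  induction l with
  | nil => exact ⟨0, 0, by simp⟩
  | cons a l ih =>
    obtain ⟨k, k', hk⟩ := ih fun p hp => hl p (List.mem_cons_of_mem _ hp)
    obtain ⟨j, j', hj⟩ := h a (hl a List.mem_cons_self)
    refine ⟨f a * j + k, f a * j' + k', fun i hi => ?_⟩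
    rw [List.map_cons, List.sum_cons, hk i hi, hj i hi]
    ring

/-- the `T`-end of an edge -/
def tend (s t : E → V) (T : Finset V) (e : E) : V := if s e ∈ T then s e else t e

/-- edge with exactly one end in `T` -/
def Leg (s t : E → V) (T : Finset V) (e : E) : Prop :=
  (s e ∈ T ∧ t e ∉ T) ∨ (s e ∉ T ∧ t e ∈ T)

/-- test pairs : `d` fixes `T` and preserves the complement, `FR` extends `L` by edges off `T`. -/
def TestPair (s t : E → V) (T W : Finset V) (L FT : Finset E) (i : (V → V) × Finset E) : Prop :=
  (∀ x ∈ T, i.1 x = x) ∧ (∀ x ∈ W, i.1 x = x) ∧ (∀ x, x ∉ T → i.1 x ∉ T) ∧ L ⊆ i.2 ∧ Disjoint i.2 FT ∧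
    ∀ e ∈ i.2, e ∉ L → s e ∉ T ∧ t e ∉ T

lemma comp_pendant (q : ℝ) (s t : E → V) (T W : Finset V) (L FT : Finset E)
    (hL : ∀ e ∈ L, Leg s t T e) (c : V → V) (hc : ∀ x, x ∉ T → c x = x)
    (e : E) (heL : e ∈ L) (hce : c (tend s t T e) ∈ T)
    (hne : ∀ e' ∈ L, e' ≠ e → c (tend s t T e') ≠ c (tend s t T e))
    (i : (V → V) × Finset E) (hi : TestPair s t T W L FT i) :
    phi q (c ∘ i.1 ∘ s) (c ∘ i.1 ∘ t) i.2 = 0 := by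
  obtain ⟨d1, dW, d2, hLF, _, hFR⟩ := hi
  have hout : ∀ x, x ∉ T → c (i.1 x) ∉ T := fun x hx => by rw [hc _ (d2 x hx)]; exact d2 x hx
  have hne' : ∀ x, x ∉ T → c (i.1 x) ≠ c (tend s t T e) := fun x hx h => hout x hx (h ▸ hce)
  refine phi_pendant q _ _ (e := e) (hLF heL) (c (tend s t T e)) ?_ ?_
  · rcases hL e heL with ⟨h1, h2⟩ | ⟨h1, h2⟩
    · left
      refine ⟨?_, hne' _ h2⟩
      simp [tend, h1, d1 _ h1]
    · right
      refine ⟨?_, hne' _ h1⟩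
      simp [tend, h1, d1 _ h2]
  · intro e' he' hee
    by_cases heL' : e' ∈ L
    · have h3 := hne e' heL' hee
      rcases hL e' heL' with ⟨h1, h2⟩ | ⟨h1, h2⟩
      · refine ⟨?_, hne' _ h2⟩
        simp only [Function.comp, d1 _ h1]
        simpa [tend, h1] using h3
      · refine ⟨hne' _ h1, ?_⟩
        simp only [Function.comp, d1 _ h2]
        simpa [tend, h1] using h3
    · obtain ⟨h1, h2⟩ := hFR e' he' heL'
      exact ⟨hne' _ h1, hne' _ h2⟩

/-- all legs are sent to the same vertex -/
lemma comp_same (q : ℝ) (s t : E → V) (T W : Finset V) (L FT : Finset E)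
    (hL : ∀ e ∈ L, Leg s t T e) (c c' : V → V) (hc : ∀ x, x ∉ T → c x = x)
    (hc' : ∀ x, x ∉ T → c' x = x)
    (p p' : V) (hpp : p = p' ∨ (p ∈ T ∧ p' ∈ T))
    (h1 : ∀ e ∈ L, c (tend s t T e) = p) (h2 : ∀ e ∈ L, c' (tend s t T e) = p')
    (i : (V → V) × Finset E) (hi : TestPair s t T W L FT i) :
    phi q (c ∘ i.1 ∘ s) (c ∘ i.1 ∘ t) i.2 = phi q (c' ∘ i.1 ∘ s) (c' ∘ i.1 ∘ t) i.2 := by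
  obtain ⟨d1, dW, d2, hLF, _, hFR⟩ := hi
  rw [← phi_perm q (Equiv.swap p p') (c ∘ i.1 ∘ s)]
  have hfix : ∀ x, x ∉ T → Equiv.swap p p' x = x := by
    intro x hx
    rcases hpp with rfl | ⟨h3, h4⟩
    · simp
    · exact Equiv.swap_apply_of_ne_of_ne (fun h => hx (h ▸ h3)) (fun h => hx (h ▸ h4))
  have hout : ∀ x, x ∉ T → Equiv.swap p p' (c (i.1 x)) = c' (i.1 x) := fun x hx => by
    rw [hc _ (d2 x hx), hc' _ (d2 x hx), hfix _ (d2 x hx)]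
  refine phi_congr' fun e he => ?_
  by_cases heL : e ∈ L
  · have h3 := h1 e heL
    have h4 := h2 e heL
    rcases hL e heL with ⟨h5, h6⟩ | ⟨h5, h6⟩
    · refine ⟨?_, hout _ h6⟩
      simp only [tend, h5, if_true] at h3 h4
      simp only [Function.comp, d1 _ h5, h3, h4, Equiv.swap_apply_left]
    · refine ⟨hout _ h5, ?_⟩
      simp only [tend, h5, if_false] at h3 h4
      simp only [Function.comp, d1 _ h6, h3, h4, Equiv.swap_apply_left]
  · obtain ⟨h5, h6⟩ := hFR e he heL
    exact ⟨hout _ h5, hout _ h6⟩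

lemma tend_mem {s t : E → V} {T : Finset V} {e : E} (h : Leg s t T e) : tend s t T e ∈ T := by
  rcases h with ⟨h1, h2⟩ | ⟨h1, h2⟩
  · simp [tend, h1]
  · simpa [tend, h1] using h2

lemma test_apply {s t : E → V} {T W : Finset V} {L FT : Finset E}
    (hFT : ∀ e ∈ FT, s e ∈ T ∪ W ∧ t e ∈ T ∪ W)
    {i : (V → V) × Finset E} (hi : TestPair s t T W L FT i) (e : E) (he : e ∈ FT) :
    (i.1 ∘ s) e = s e ∧ (i.1 ∘ t) e = t e := by
  obtain ⟨d1, dW, -⟩ := hi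
  obtain ⟨h1, h2⟩ := hFT e he
  constructor
  · rcases mem_union.1 h1 with h | h
    · exact d1 _ h
    · exact dW _ h
  · rcases mem_union.1 h2 with h | h
    · exact d1 _ h
    · exact dW _ h

lemma collapseA (q : ℝ) (s t : E → V) (T : Finset V) (t0 : V) (ht0 : t0 ∈ T) (L FT : Finset E)
    (hL : ∀ e ∈ L, Leg s t T e) (hLc : #L ≤ 3) (hFT : ∀ e ∈ FT, s e ∈ T ∧ t e ∈ T) :
    ∃ k : ℝ, ∀ i : (V → V) × Finset E, TestPair s t T ∅ L FT i →
      phi q (i.1 ∘ s) (i.1 ∘ t) (i.2 ∪ FT) =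
        k * phi q (col T t0 ∘ i.1 ∘ s) (col T t0 ∘ i.1 ∘ t) i.2 := by
  have hFT' : ∀ e ∈ FT, s e ∈ T ∪ ∅ ∧ t e ∈ T ∪ ∅ := by simpa using hFT
  obtain ⟨l, hl, hl'⟩ := reduce q T ∅ (by simp) FT s t hFT'
  obtain ⟨k, k', hk⟩ := sum_list_const l (fun p => p.1)
    (fun p => (∀ x, x ∉ T → p.2 x = x) ∧ (∀ x ∈ T, p.2 x ∈ T ∪ ∅)) hl (TestPair s t T ∅ L FT)
    (fun p i => phi q (p.2 ∘ i.1 ∘ s) (p.2 ∘ i.1 ∘ t) i.2)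
    (fun i => phi q (col T t0 ∘ i.1 ∘ s) (col T t0 ∘ i.1 ∘ t) i.2) (fun _ => 0) (by
      rintro ⟨kk, c⟩ ⟨hc1, hc2⟩
      simp only [union_empty] at hc1 hc2 ⊢
      by_cases hx : ∃ e ∈ L, ∀ e' ∈ L, e' ≠ e → c (tend s t T e') ≠ c (tend s t T e)
      · obtain ⟨e, he, hne⟩ := hx
        refine ⟨0, 0, fun i hi => ?_⟩
        rw [comp_pendant q s t T ∅ L FT hL c hc1 e he (hc2 _ (tend_mem (hL e he))) hne i hi]
        ring
      · refine ⟨1, 0, fun i hi => ?_⟩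
        push Not at hx
        have : ∃ p ∈ T, ∀ e ∈ L, c (tend s t T e) = p := by
          rcases L.eq_empty_or_nonempty with rfl | ⟨e0, he0⟩
          · exact ⟨t0, ht0, by simp⟩
          · refine ⟨c (tend s t T e0), hc2 _ (tend_mem (hL e0 he0)), fun e he => ?_⟩
            by_contra hne
            obtain ⟨e0', h1, h2, h3⟩ := hx e0 he0
            obtain ⟨e', h4, h5, h6⟩ := hx e he
            have hsub : ({e0, e0', e, e'} : Finset E) ⊆ L := by
              intro z hz
              simp only [mem_insert, mem_singleton] at hz
              rcases hz with rfl | rfl | rfl | rfl <;> assumption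
            have h7 : e0 ≠ e := by rintro rfl; exact hne rfl
            have h8 : e0 ≠ e' := by rintro rfl; exact hne h6.symm
            have h9 : e0' ≠ e := by rintro rfl; exact hne h3
            have h10 : e0' ≠ e' := by rintro rfl; exact hne (h6.symm.trans h3)
            have := card_le_card hsub
            rw [card_insert_of_notMem (by simp [h7, h8, h2.symm]),
              card_insert_of_notMem (by simp [h9, h10]), card_pair h5.symm] at this
            omega
        obtain ⟨p, hp, hp'⟩ := this
        rw [comp_same q s t T ∅ L FT hL c (col T t0) hc1 (fun x hx => col_not hx) p t0
          (Or.inr ⟨hp, ht0⟩) hp' (fun e he => col_mem (tend_mem (hL e he))) i hi]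
        ring)
  refine ⟨k, fun i hi => ?_⟩
  rw [hl' _ _ (fun e he => test_apply hFT' hi e he) i.2 hi.2.2.2.2.1, hk i hi]
  ring

lemma collapseB (q : ℝ) (s t : E → V) (T : Finset V) (t0 : V) (ht0 : t0 ∈ T) (w : V) (hw : w ∉ T)
    (f g : E) (FT : Finset E) (hfg : f ≠ g)
    (hL : ∀ e ∈ ({f, g} : Finset E), Leg s t T e)
    (hFT : ∀ e ∈ FT, s e ∈ T ∪ {w} ∧ t e ∈ T ∪ {w}) :
    ∃ k k' : ℝ, ∀ i : (V → V) × Finset E, TestPair s t T {w} {f, g} FT i →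
      phi q (i.1 ∘ s) (i.1 ∘ t) (i.2 ∪ FT) =
        k * phi q (col T t0 ∘ i.1 ∘ s) (col T t0 ∘ i.1 ∘ t) i.2 +
        k' * phi q (col T w ∘ i.1 ∘ s) (col T w ∘ i.1 ∘ t) i.2 := by
  obtain ⟨l, hl, hl'⟩ := reduce q T {w} (by simp) FT s t hFT
  obtain ⟨k, k', hk⟩ := sum_list_const l (fun p => p.1)
    (fun p => (∀ x, x ∉ T → p.2 x = x) ∧ (∀ x ∈ T, p.2 x ∈ T ∪ {w})) hl (TestPair s t T {w} {f, g} FT)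
    (fun p i => phi q (p.2 ∘ i.1 ∘ s) (p.2 ∘ i.1 ∘ t) i.2)
    (fun i => phi q (col T t0 ∘ i.1 ∘ s) (col T t0 ∘ i.1 ∘ t) i.2)
    (fun i => phi q (col T w ∘ i.1 ∘ s) (col T w ∘ i.1 ∘ t) i.2) (by
      rintro ⟨kk, c⟩ ⟨hc1, hc2⟩
      simp only at hc1 hc2 ⊢
      have hf := hL f (by simp)
      have hg := hL g (by simp)
      have mf := hc2 _ (tend_mem hf)
      have mg := hc2 _ (tend_mem hg)
      by_cases heq : c (tend s t T f) = c (tend s t T g)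
      · have hall : ∀ e ∈ ({f, g} : Finset E), c (tend s t T e) = c (tend s t T f) := by
          intro e he
          simp only [mem_insert, mem_singleton] at he
          rcases he with rfl | rfl
          · rfl
          · exact heq.symm
        by_cases hT : c (tend s t T f) ∈ T
        · refine ⟨1, 0, fun i hi => ?_⟩
          rw [comp_same q s t T _ _ FT hL c (col T t0) hc1 (fun x hx => col_not hx) _ t0
            (Or.inr ⟨hT, ht0⟩) hall (fun e he => col_mem (tend_mem (hL e he))) i hi]
          ring
        · have hw' : c (tend s t T f) = w := by
            rcases mem_union.1 mf with h | h
            · exact absurd h hT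
            · simpa using h
          refine ⟨0, 1, fun i hi => ?_⟩
          rw [comp_same q s t T _ _ FT hL c (col T w) hc1 (fun x hx => col_not hx) _ w
            (Or.inl hw') hall (fun e he => col_mem (tend_mem (hL e he))) i hi]
          ring
      · refine ⟨0, 0, fun i hi => ?_⟩
        by_cases hT : c (tend s t T f) ∈ T
        · rw [comp_pendant q s t T _ _ FT hL c hc1 f (by simp) hT (by
            intro e' he' hne
            simp only [mem_insert, mem_singleton] at he'
            rcases he' with rfl | rfl
            · exact absurd rfl hne
            · exact Ne.symm heq) i hi]
          ring
        · have hT' : c (tend s t T g) ∈ T := by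
            rcases mem_union.1 mf with h | h
            · exact absurd h hT
            · rcases mem_union.1 mg with h' | h'
              · exact h'
              · simp only [mem_singleton] at h h'
                exact absurd (h.trans h'.symm) heq
          rw [comp_pendant q s t T _ _ FT hL c hc1 g (by simp) hT' (by
            intro e' he' hne
            simp only [mem_insert, mem_singleton] at he'
            rcases he' with rfl | rfl
            · exact heq
            · exact absurd rfl hne) i hi]
          ring)
  refine ⟨k, k', fun i hi => ?_⟩
  rw [hl' _ _ (fun e he => test_apply hFT hi e he) i.2 hi.2.2.2.2.1, hk i hi]

end Reduce

end CubicFlow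

namespace CubicFlow

/-- A graph on `V` with edges from `F`. -/
structure Gr (V E : Type) where
  s : E → V
  t : E → V
  F : Finset E

section Bt

variable {V E : Type} [Fintype V] [DecidableEq V] [DecidableEq E]

/-- contribution of an edge -/
def ec (a b : V) (X Y : Finset V) : ℕ :=
  (if a ∈ X ∧ b ∈ Y then 1 else 0) + (if a ∈ Y ∧ b ∈ X then 1 else 0)

namespace Gr

/-- number of edges between `X` and `Y` -/
def bt (G : Gr V E) (X Y : Finset V) : ℕ := ∑ e ∈ G.F, ec (G.s e) (G.t e) X Y

/-- evaluation of flow polynomial -/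
noncomputable def ph (G : Gr V E) (q : ℝ) : ℝ := CubicFlow.phi q G.s G.t G.F

/-- change of the endpoints by `c` and of the edge set -/
def mp (G : Gr V E) (c : V → V) (F' : Finset E) : Gr V E := ⟨c ∘ G.s, c ∘ G.t, F'⟩

/-- cut of `X` within `P` -/
def h (G : Gr V E) (P X : Finset V) : ℕ := G.bt X (P \ X)

variable (G : Gr V E)

lemma bt_comm (X Y : Finset V) : G.bt X Y = G.bt Y X := by
  unfold bt ec
  exact Finset.sum_congr rfl fun e _ => add_comm _ _

lemma bt_union_left {A B : Finset V} (hd : Disjoint A B) (Y : Finset V) :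
    G.bt (A ∪ B) Y = G.bt A Y + G.bt B Y := by
  unfold bt
  rw [← Finset.sum_add_distrib]
  refine Finset.sum_congr rfl fun e _ => ?_
  have h1 : ¬ (G.s e ∈ A ∧ G.s e ∈ B) := fun h => disjoint_left.1 hd h.1 h.2
  have h2 : ¬ (G.t e ∈ A ∧ G.t e ∈ B) := fun h => disjoint_left.1 hd h.1 h.2
  unfold ec
  simp only [mem_union]
  by_cases a1 : G.s e ∈ A <;> by_cases a2 : G.s e ∈ B <;> by_cases a3 : G.t e ∈ A <;>
    by_cases a4 : G.t e ∈ B <;> simp_all [add_comm]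

lemma bt_union_right (X : Finset V) {A B : Finset V} (hd : Disjoint A B) :
    G.bt X (A ∪ B) = G.bt X A + G.bt X B := by
  rw [bt_comm, bt_union_left G hd, bt_comm G A, bt_comm G B]

@[simp] lemma bt_empty_right (X : Finset V) : G.bt X ∅ = 0 := by simp [bt, ec]
@[simp] lemma bt_empty_left (X : Finset V) : G.bt ∅ X = 0 := by simp [bt, ec]

lemma bt_mono_right (X : Finset V) {A B : Finset V} (hs : A ⊆ B) : G.bt X A ≤ G.bt X B := by
  rw [← union_sdiff_of_subset hs, bt_union_right G X disjoint_sdiff]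
  omega

lemma bt_mono_left {A B : Finset V} (hs : A ⊆ B) (X : Finset V) : G.bt A X ≤ G.bt B X := by
  rw [bt_comm, bt_comm G B]; exact bt_mono_right G X hs

lemma bt_mono {A B C D : Finset V} (hs : A ⊆ B) (hs' : C ⊆ D) : G.bt A C ≤ G.bt B D :=
  (bt_mono_left G hs C).trans (bt_mono_right G B hs')

lemma bt_self_even (X : Finset V) : Even (G.bt X X) := by
  unfold bt
  refine Finset.even_sum _ fun e _ => ?_
  unfold ec
  by_cases a1 : G.s e ∈ X <;> by_cases a2 : G.t e ∈ X <;> simp_all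

/-- edges between -/
def bte (X Y : Finset V) : Finset E :=
  G.F.filter fun e => (G.s e ∈ X ∧ G.t e ∈ Y) ∨ (G.s e ∈ Y ∧ G.t e ∈ X)

lemma bt_eq_card {X Y : Finset V} (hd : Disjoint X Y) : G.bt X Y = #(G.bte X Y) := by
  unfold bt bte
  rw [card_filter]
  refine Finset.sum_congr rfl fun e _ => ?_
  have h1 : ¬ (G.s e ∈ X ∧ G.s e ∈ Y) := fun h => disjoint_left.1 hd h.1 h.2
  unfold ec
  by_cases a1 : G.s e ∈ X <;> by_cases a2 : G.s e ∈ Y <;> by_cases a3 : G.t e ∈ X <;>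
    by_cases a4 : G.t e ∈ Y <;> simp_all

lemma mem_bte {X Y : Finset V} {e : E} : e ∈ G.bte X Y ↔ e ∈ G.F ∧
    ((G.s e ∈ X ∧ G.t e ∈ Y) ∨ (G.s e ∈ Y ∧ G.t e ∈ X)) := by simp [bte]

lemma bt_mp (c : V → V) (F' : Finset E) (hF : F' ⊆ G.F) (X Y : Finset V)
    (hr : ∀ e ∈ G.F, e ∉ F' → ¬ (c (G.s e) ∈ X ∧ c (G.t e) ∈ Y) ∧ ¬ (c (G.s e) ∈ Y ∧ c (G.t e) ∈ X)) :
    (G.mp c F').bt X Y = G.bt (univ.filter fun x => c x ∈ X) (univ.filter fun x => c x ∈ Y) := by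
  unfold bt mp
  rw [← Finset.sum_subset hF]
  · refine Finset.sum_congr rfl fun e _ => ?_
    simp [ec]
  · intro e he he'
    have := hr e he he'
    simp [ec, this.1, this.2]

lemma pre_mem {T X : Finset V} {t0 : V} (h : t0 ∈ X) (hX : ∀ x ∈ X, x ∈ T → x = t0) :
    (univ.filter fun x => col T t0 x ∈ X) = X ∪ T := by
  ext x
  rw [mem_filter]
  simp only [col, mem_univ, true_and, mem_union]
  by_cases hx : x ∈ T <;> simp [hx, h]

lemma pre_not {T X : Finset V} {t0 : V} (h : t0 ∉ X) (hX : ∀ x ∈ X, x ∉ T) :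
    (univ.filter fun x => col T t0 x ∈ X) = X := by
  ext x
  rw [mem_filter]
  simp only [col, mem_univ, true_and]
  by_cases hx : x ∈ T
  · have : x ∉ X := fun h' => hX x h' hx
    simp [hx, h, this]
  · simp [hx]

/-- the collapse -/
lemma bt_split (X : Finset V) {Y Z : Finset V} (hs : Z ⊆ Y) :
    G.bt X Y = G.bt X Z + G.bt X (Y \ Z) := by
  rw [← bt_union_right G X disjoint_sdiff, union_sdiff_of_subset hs]

lemma bt_split_left {X Z : Finset V} (Y : Finset V) (hs : Z ⊆ X) :
    G.bt X Y = G.bt Z Y + G.bt (X \ Z) Y := by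
  rw [← bt_union_left G disjoint_sdiff, union_sdiff_of_subset hs]

lemma sep4 {P A B : Finset V} (hA : A ⊆ P) (hB : B ⊆ P) :
    ∃ a b c d : Finset V, a = A \ B ∧ b = B \ A ∧ c = A ∩ B ∧ d = P \ (A ∪ B) ∧
      Disjoint a b ∧ Disjoint a c ∧ Disjoint a d ∧ Disjoint b c ∧ Disjoint b d ∧ Disjoint c d := by
  refine ⟨_, _, _, _, rfl, rfl, rfl, rfl, ?_, ?_, ?_, ?_, ?_, ?_⟩ <;>
  · rw [disjoint_left]; intro x; simp only [mem_sdiff, mem_inter, mem_union]; tauto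

/-- expansions of all the cuts in four atoms -/
lemma h_atoms {P A B : Finset V} (hA : A ⊆ P) (hB : B ⊆ P) :
    G.h P A = G.bt (A \ B) (B \ A) + G.bt (A \ B) (P \ (A ∪ B)) + G.bt (A ∩ B) (B \ A) + G.bt (A ∩ B) (P \ (A ∪ B)) ∧
    G.h P B = G.bt (A \ B) (B \ A) + G.bt (B \ A) (P \ (A ∪ B)) + G.bt (A ∩ B) (A \ B) + G.bt (A ∩ B) (P \ (A ∪ B)) ∧
    G.h P (A ∩ B) = G.bt (A ∩ B) (A \ B) + G.bt (A ∩ B) (B \ A) + G.bt (A ∩ B) (P \ (A ∪ B)) ∧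
    G.h P (A ∪ B) = G.bt (A \ B) (P \ (A ∪ B)) + G.bt (B \ A) (P \ (A ∪ B)) + G.bt (A ∩ B) (P \ (A ∪ B)) ∧
    G.h P (A \ B) = G.bt (A \ B) (B \ A) + G.bt (A \ B) (P \ (A ∪ B)) + G.bt (A ∩ B) (A \ B) ∧
    G.h P (B \ A) = G.bt (A \ B) (B \ A) + G.bt (B \ A) (P \ (A ∪ B)) + G.bt (A ∩ B) (B \ A) := by
  obtain ⟨a, b, c, d, ha, hb, hc, hd, dab, dac, dad, dbc, dbd, dcd⟩ := sep4 hA hB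
  have e1 : A = a ∪ c := by rw [ha, hc]; ext x; simp only [mem_sdiff, mem_inter, mem_union]; tauto
  have e2 : B = b ∪ c := by rw [hb, hc]; ext x; simp only [mem_sdiff, mem_inter, mem_union]; tauto
  have e3 : P \ A = b ∪ d := by
    rw [hb, hd]; ext x; simp only [mem_sdiff, mem_inter, mem_union]
    have := @hA x; have := @hB x; tauto
  have e4 : P \ B = a ∪ d := by
    rw [ha, hd]; ext x; simp only [mem_sdiff, mem_inter, mem_union]
    have := @hA x; have := @hB x; tauto
  have e5 : P \ (A ∩ B) = a ∪ (b ∪ d) := by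
    rw [ha, hb, hd]; ext x; simp only [mem_sdiff, mem_inter, mem_union]
    have := @hA x; have := @hB x; tauto
  have e6 : A ∪ B = a ∪ (b ∪ c) := by
    rw [ha, hb, hc]; ext x; simp only [mem_sdiff, mem_inter, mem_union]
    have := @hA x; have := @hB x; tauto
  have e7 : P \ (A \ B) = b ∪ (c ∪ d) := by
    rw [hc, hb, hd]; ext x; simp only [mem_sdiff, mem_inter, mem_union]
    have := @hA x; have := @hB x; tauto
  have e8 : P \ (B \ A) = a ∪ (c ∪ d) := by
    rw [ha, hc, hd]; ext x; simp only [mem_sdiff, mem_inter, mem_union]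
    have := @hA x; have := @hB x; tauto
  unfold h
  rw [e3, e4, e5, e7, e8, ← ha, ← hb, ← hc, ← hd, e6]
  have q1 : G.bt A (b ∪ d) = G.bt a b + G.bt a d + G.bt c b + G.bt c d := by
    rw [e1, bt_union_left G dac, bt_union_right G _ dbd, bt_union_right G _ dbd]; omega
  have q2 : G.bt B (a ∪ d) = G.bt a b + G.bt b d + G.bt c a + G.bt c d := by
    rw [e2, bt_union_left G dbc, bt_union_right G _ dad, bt_union_right G _ dad, bt_comm G b a]; omega
  have d1 : Disjoint a (b ∪ d) := disjoint_union_right.2 ⟨dab, dad⟩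
  have d2 : Disjoint a (b ∪ c) := disjoint_union_right.2 ⟨dab, dac⟩
  have d3 : Disjoint b (c ∪ d) := disjoint_union_right.2 ⟨dbc, dbd⟩
  have d4 : Disjoint a (c ∪ d) := disjoint_union_right.2 ⟨dac, dad⟩
  refine ⟨q1, q2, ?_, ?_, ?_, ?_⟩
  · rw [bt_union_right G _ d1, bt_union_right G _ dbd]; omega
  · rw [bt_union_left G d2, bt_union_left G dbc]; omega
  · rw [bt_union_right G _ d3, bt_union_right G _ dcd, bt_comm G a c]; omega
  · rw [bt_union_right G _ d4, bt_union_right G _ dcd, bt_comm G b a, bt_comm G b c]; omega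

lemma h_compl {P A : Finset V} (hA : A ⊆ P) : G.h P (P \ A) = G.h P A := by
  unfold h
  rw [Finset.sdiff_sdiff_eq_self hA, bt_comm]

lemma h_disj {P A B : Finset V} (hA : A ⊆ P) (hB : B ⊆ P) (hd : Disjoint A B) :
    G.h P (A ∪ B) + 2 * G.bt A B = G.h P A + G.h P B := by
  obtain ⟨h1, h2, h3, h4, h5, h6⟩ := G.h_atoms hA hB
  have e1 : A \ B = A := sdiff_eq_self_of_disjoint hd
  have e2 : B \ A = B := sdiff_eq_self_of_disjoint hd.symm
  have e3 : A ∩ B = ∅ := disjoint_iff_inter_eq_empty.1 hd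
  rw [e1, e2, e3] at h1 h2 h4
  simp only [bt_empty_left] at h1 h2 h4
  omega

/-- degree sum -/
lemma bt_sum (X Y : Finset V) : G.bt X Y = ∑ v ∈ X, G.bt {v} Y := by
  induction X using Finset.induction_on with
  | empty => simp
  | insert v X hv ih =>
    rw [insert_eq, bt_union_left G (by simpa using hv), ih, ← insert_eq, sum_insert hv]

end Gr

end Bt

end CubicFlow

namespace CubicFlow

section Factor

variable {V E : Type} [Fintype V] [DecidableEq V] [DecidableEq E]

namespace Gr

variable (G : Gr V E)

/-- edges not inside `X` -/
def keep (X : Finset V) : Finset E := G.F.filter fun e => ¬ (G.s e ∈ X ∧ G.t e ∈ X)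

/-- edges touching `X` -/
def tou (X : Finset V) : Finset E := G.F.filter fun e => G.s e ∈ X ∨ G.t e ∈ X

lemma ph_cut (q : ℝ) {S T : Finset V} (hd : Disjoint S T) {s0 t0 : V} (hs0 : s0 ∈ S) (ht0 : t0 ∈ T)
    (hends : ∀ e ∈ G.F, G.s e ∈ S ∪ T ∧ G.t e ∈ S ∪ T) (hle : G.bt S T ≤ 3) :
    G.ph q * bond q (G.bt S T) =
      (G.mp (col T t0) (G.keep T)).ph q * (G.mp (col S s0) (G.keep S)).ph q := by
  have hST : ∀ x ∈ S, x ∉ T := fun x h1 h2 => disjoint_left.1 hd h1 h2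
  have hTS : ∀ x ∈ T, x ∉ S := fun x h1 h2 => disjoint_left.1 hd h2 h1
  have hL : ∀ e ∈ G.bte S T, Leg G.s G.t T e := by
    intro e he
    rcases (G.mem_bte.1 he).2 with h | h
    · exact Or.inr ⟨hST _ h.1, h.2⟩
    · exact Or.inl ⟨h.1, hST _ h.2⟩
  obtain ⟨k, hk⟩ := collapseA q G.s G.t T t0 ht0 (G.bte S T)
    (G.F.filter fun e => G.s e ∈ T ∧ G.t e ∈ T) hL (by rw [← bt_eq_card G hd]; exact hle)
    (fun e he => (mem_filter.1 he).2)
  have h1 := hk (id, G.keep T) (by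
    refine ⟨fun _ _ => rfl, fun _ _ => rfl, fun _ h => h, ?_, ?_, ?_⟩
    · intro e he
      rw [mem_bte] at he
      simp only [keep, mem_filter]
      have := hST (G.s e); have := hST (G.t e)
      tauto
    · rw [disjoint_left]; intro e; simp only [keep, mem_filter]; tauto
    · intro e he he'
      simp only [keep, mem_filter, mem_bte] at he he'
      have h1 := hends e he.1
      simp only [mem_union] at h1
      tauto)
  have h2 := hk (col S s0, G.bte S T) (by
    refine ⟨fun x h => col_not (hTS x h), by simp, ?_, Subset.rfl, ?_, ?_⟩
    · intro x hx
      show col S s0 x ∉ T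
      unfold col
      split_ifs
      · exact hST _ hs0
      · exact hx
    · rw [disjoint_left]; intro e; simp only [mem_bte, mem_filter]
      have := hST (G.s e); have := hST (G.t e)
      tauto
    · intro e he he'
      exact absurd he he')
  have e1 : G.keep T ∪ (G.F.filter fun e => G.s e ∈ T ∧ G.t e ∈ T) = G.F := by
    ext e; simp only [keep, mem_union, mem_filter]; tauto
  have e2 : G.bte S T ∪ (G.F.filter fun e => G.s e ∈ T ∧ G.t e ∈ T) = G.keep S := by
    ext e; simp only [keep, mem_bte, mem_union, mem_filter]
    constructor
    · have := hST (G.s e); have := hST (G.t e)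
      tauto
    · rintro ⟨h1, h2⟩
      have h3 := hends e h1
      simp only [mem_union] at h3
      tauto
  simp only at h1 h2
  rw [e1] at h1
  rw [e2] at h2
  have hst : s0 ≠ t0 := fun h => hST s0 hs0 (h ▸ ht0)
  rw [phi_bond q _ _ (G.bte S T) s0 t0 hst (by
    intro e he
    rcases (G.mem_bte.1 he).2 with h | h
    · left; simp [col_mem h.1, col_not (hST _ hs0), col_not (hTS _ h.2), col_mem h.2]
    · right; simp [col_mem h.2, col_not (hST _ hs0), col_not (hTS _ h.1), col_mem h.1]),
    ← bt_eq_card G hd] at h2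
  unfold ph mp
  simp only
  rw [h2]
  have h1' : phi q G.s G.t G.F = k * phi q (col T t0 ∘ G.s) (col T t0 ∘ G.t) (G.keep T) := h1
  rw [h1']
  ring

set_option maxHeartbeats 1000000 in
lemma ph_sep (q : ℝ) {S T : Finset V} (hd : Disjoint S T) {s0 t0 w : V} (hs0 : s0 ∈ S) (ht0 : t0 ∈ T)
    (hwS : w ∉ S) (hwT : w ∉ T) (hl : ∀ e ∈ G.F, G.s e ≠ G.t e)
    (hends : ∀ e ∈ G.F, G.s e ∈ S ∪ T ∪ {w} ∧ G.t e ∈ S ∪ T ∪ {w})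
    {f g : E} (hfg : f ≠ g) (hb : G.bte S T = {f, g}) {eT eS : E} (heT : eT ∈ G.bte T {w})
    (heS : eS ∈ G.bte S {w}) :
    (q - 1) * (q - 2) * G.ph q =
      (q - 2) * (G.mp (col T t0) (G.tou S)).ph q * (G.mp (col S s0) (G.tou T)).ph q +
      (G.mp (col T t0) (insert eT (G.tou S))).ph q * (G.mp (col S s0) (insert eS (G.tou T))).ph q := by
  have hST : ∀ x ∈ S, x ∉ T := fun x h1 h2 => disjoint_left.1 hd h1 h2
  have hTS : ∀ x ∈ T, x ∉ S := fun x h1 h2 => disjoint_left.1 hd h2 h1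
  have hwt : w ≠ t0 := fun h => hwT (h ▸ ht0)
  have hws : w ≠ s0 := fun h => hwS (h ▸ hs0)
  have hst : s0 ≠ t0 := fun h => hST s0 hs0 (h ▸ ht0)
  have hfgL : ∀ e ∈ ({f, g} : Finset E), e ∈ G.bte S T := by rw [hb]; exact fun _ h => h
  have hL : ∀ e ∈ ({f, g} : Finset E), Leg G.s G.t T e := by
    intro e he
    rcases (G.mem_bte.1 (hfgL e he)).2 with h | h
    · exact Or.inr ⟨hST _ h.1, h.2⟩
    · exact Or.inl ⟨h.1, hST _ h.2⟩
  have hends' : ∀ e ∈ G.F, ((G.s e ∈ S ∨ G.s e ∈ T) ∨ G.s e = w) ∧ ((G.t e ∈ S ∨ G.t e ∈ T) ∨ G.t e = w) := by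
    simpa only [mem_union, mem_singleton] using hends
  have hww : ∀ e ∈ G.F, G.s e = w → G.t e ≠ w := fun e he h h' => hl e he (h.trans h'.symm)
  set FT := G.F.filter fun e => G.s e ∉ S ∧ G.t e ∉ S with hFT
  obtain ⟨k, k', hk⟩ := collapseB q G.s G.t T t0 ht0 w hwT f g FT hfg hL (by
    intro e he
    have h1 := mem_filter.1 he
    have h2 := hends' e h1.1
    simp only [mem_union, mem_singleton]
    tauto)
  have hfgb : ∀ e, e ∈ ({f, g} : Finset E) ↔ (e ∈ G.F ∧
    ((G.s e ∈ S ∧ G.t e ∈ T) ∨ (G.s e ∈ T ∧ G.t e ∈ S))) := by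
    intro e; rw [← hb, mem_bte]
  have h1 := hk (id, G.tou S) (by
    refine ⟨fun _ _ => rfl, fun _ _ => rfl, fun _ h => h, ?_, ?_, ?_⟩
    · intro e he
      simp only [hfgb] at he
      simp only [tou, mem_filter]
      tauto
    · rw [disjoint_left]; intro e; simp only [tou, hFT, mem_filter]; tauto
    · intro e he he'
      simp only [tou, mem_filter] at he
      rw [hfgb] at he'
      have h1 := hends' e he.1
      have := hST (G.s e); have := hST (G.t e)
      tauto)
  have hcol : ∀ x, x ∉ T → col S s0 x ∉ T := by
    intro x hx
    unfold col
    split_ifs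
    · exact hST _ hs0
    · exact hx
  have hcolw : col S s0 w = w := col_not hwS
  have h2 := hk (col S s0, {f, g}) (by
    refine ⟨fun x h => col_not (hTS x h), ?_, hcol, Subset.rfl, ?_, ?_⟩
    · intro x hx; rw [mem_singleton.1 hx]; exact hcolw
    · rw [disjoint_left]; intro e he; rw [hfgb] at he; simp only [hFT, mem_filter]
      tauto
    · intro e he he'
      exact absurd he he')
  have hS := G.mem_bte.1 heS
  have hT := G.mem_bte.1 heT
  simp only [mem_singleton] at hS hT
  have heSfg : eS ∉ ({f, g} : Finset E) := by
    rw [hfgb]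
    have := hST (G.s eS); have := hST (G.t eS)
    rintro ⟨-, h⟩
    rcases hS.2 with ⟨h1, h2⟩ | ⟨h1, h2⟩
    · rw [h2] at h; tauto
    · rw [h1] at h; tauto
  have h3 := hk (col S s0, insert eS {f, g}) (by
    refine ⟨fun x h => col_not (hTS x h), ?_, hcol, subset_insert _ _, ?_, ?_⟩
    · intro x hx; rw [mem_singleton.1 hx]; exact hcolw
    · rw [disjoint_left]; intro e he
      simp only at he
      rw [mem_insert, hfgb] at he; simp only [hFT, mem_filter]
      rcases he with rfl | he <;> tauto
    · intro e he he'
      rcases mem_insert.1 he with rfl | he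
      · rcases hS.2 with ⟨h1, h2⟩ | ⟨h1, h2⟩
        · exact ⟨hST _ h1, h2 ▸ hwT⟩
        · exact ⟨h1 ▸ hwT, hST _ h2⟩
      · exact absurd he he')
  have e1 : G.tou S ∪ FT = G.F := by
    ext e; simp only [tou, hFT, mem_union, mem_filter]; tauto
  have e2 : {f, g} ∪ FT = G.tou T := by
    ext e; rw [mem_union, hfgb]; simp only [tou, hFT, mem_filter]
    constructor
    · rintro (h | h)
      · exact ⟨h.1, by rcases h.2 with h | h <;> simp [h.1, h.2]⟩
      · obtain ⟨a1, a2⟩ := hends' e h.1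
        refine ⟨h.1, ?_⟩
        by_contra hcon
        push Not at hcon
        refine hww e h.1 ?_ ?_
        · rcases a1 with (a | a) | a
          · exact absurd a h.2.1
          · exact absurd a hcon.1
          · exact a
        · rcases a2 with (a | a) | a
          · exact absurd a h.2.2
          · exact absurd a hcon.2
          · exact a
    · rintro ⟨h1, h2⟩
      have h3 := hends' e h1
      have := hST (G.s e); have := hST (G.t e)
      tauto
  simp only at h1 h2 h3
  rw [e1] at h1
  rw [e2] at h2
  rw [insert_union, e2] at h3
  have b1 : phi q (col T t0 ∘ col S s0 ∘ G.s) (col T t0 ∘ col S s0 ∘ G.t) {f, g} = q - 1 := by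
    rw [phi_bond q _ _ _ s0 t0 hst, card_pair hfg, bond_two]
    intro e he
    rw [hfgb] at he
    rcases he.2 with h | h
    · left; simp [col_mem h.1, col_not (hST _ hs0), col_not (hTS _ h.2), col_mem h.2]
    · right; simp [col_mem h.2, col_not (hST _ hs0), col_not (hTS _ h.1), col_mem h.1]
  have ends2 : ∀ e ∈ ({f, g} : Finset E),
    ((col T w ∘ col S s0 ∘ G.s) e = s0 ∧ (col T w ∘ col S s0 ∘ G.t) e = w) ∨
    ((col T w ∘ col S s0 ∘ G.s) e = w ∧ (col T w ∘ col S s0 ∘ G.t) e = s0) := by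
    intro e he
    rw [hfgb] at he
    rcases he.2 with h | h
    · left; simp [col_mem h.1, col_not (hST _ hs0), col_not (hTS _ h.2), col_mem h.2]
    · right; simp [col_mem h.2, col_not (hST _ hs0), col_not (hTS _ h.1), col_mem h.1]
  have b2 : phi q (col T w ∘ col S s0 ∘ G.s) (col T w ∘ col S s0 ∘ G.t) {f, g} = q - 1 := by
    rw [phi_bond q _ _ _ s0 w hws.symm ends2, card_pair hfg, bond_two]
  have b3 : phi q (col T w ∘ col S s0 ∘ G.s) (col T w ∘ col S s0 ∘ G.t) (insert eS {f, g}) = (q - 1) * (q - 2) := by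
    rw [phi_bond q _ _ _ s0 w hws.symm, card_insert_of_notMem heSfg, card_pair hfg, bond_three]
    intro e he
    rcases mem_insert.1 he with rfl | he
    · rcases hS.2 with ⟨h1, h2⟩ | ⟨h1, h2⟩
      · left; simp [col_mem h1, h2, col_not hwS, col_not hwT, col_not (hST _ hs0)]
      · right; simp [col_mem h2, h1, col_not hwS, col_not hwT, col_not (hST _ hs0)]
    · exact ends2 e he
  have b4 : phi q (col T t0 ∘ col S s0 ∘ G.s) (col T t0 ∘ col S s0 ∘ G.t) (insert eS {f, g}) = 0 := by
    refine phi_pendant q _ _ (mem_insert_self eS _) w ?_ ?_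
    · rcases hS.2 with ⟨h1, h2⟩ | ⟨h1, h2⟩
      · right; simp [col_mem h1, h2, col_not hwS, col_not hwT, col_not (hST _ hs0), hws.symm]
      · left; simp [col_mem h2, h1, col_not hwS, col_not hwT, col_not (hST _ hs0), hws.symm]
    · intro e he hne
      have he := (mem_insert.1 he).resolve_left hne
      rw [hfgb] at he
      rcases he.2 with h | h
      · simp [col_mem h.1, col_not (hST _ hs0), col_not (hTS _ h.2), col_mem h.2, hws.symm, hwt.symm]
      · simp [col_mem h.2, col_not (hST _ hs0), col_not (hTS _ h.1), col_mem h.1, hws.symm, hwt.symm]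
  have heTS : eT ∉ G.tou S := by
    simp only [tou, mem_filter]
    rcases hT.2 with ⟨h1, h2⟩ | ⟨h1, h2⟩
    · have := hTS _ h1; rw [h2]; tauto
    · have := hTS _ h2; rw [h1]; tauto
  have hmv : mv t0 w ∘ col T t0 = col T w := by
    funext x
    simp only [Function.comp, col, mv]
    split_ifs with a1 a2 a3
    · rfl
    · exact absurd rfl a2
    · exact absurd (a3 ▸ ht0) a1
    · rfl
  have b5 : phi q (col T t0 ∘ G.s) (col T t0 ∘ G.t) (insert eT (G.tou S)) =
      phi q (col T w ∘ G.s) (col T w ∘ G.t) (G.tou S) - phi q (col T t0 ∘ G.s) (col T t0 ∘ G.t) (G.tou S) := by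
    rcases hT.2 with ⟨h1, h2⟩ | ⟨h1, h2⟩
    · have s1 : (col T t0 ∘ G.s) eT = t0 := col_mem h1
      have s2 : (col T t0 ∘ G.t) eT = w := by simp [h2, col_not hwT]
      rw [phi_contract q (col T t0 ∘ G.s) (col T t0 ∘ G.t) (mem_insert_self eT _) (by
        rw [s1, s2]; exact hwt.symm), erase_insert heTS, s1, s2, ← Function.comp_assoc, ← Function.comp_assoc, hmv]
    · have s1 : (col T t0 ∘ G.t) eT = t0 := col_mem h2
      have s2 : (col T t0 ∘ G.s) eT = w := by simp [h1, col_not hwT]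
      rw [phi_contract' q (col T t0 ∘ G.s) (col T t0 ∘ G.t) (mem_insert_self eT _) (by
        rw [s1, s2]; exact hwt), erase_insert heTS, s1, s2, ← Function.comp_assoc, ← Function.comp_assoc, hmv]
  unfold ph mp
  simp only
  rw [b1, b2] at h2
  rw [b3, b4] at h3
  rw [h2, h3, b5]
  have h1' : phi q G.s G.t G.F = k * phi q (col T t0 ∘ G.s) (col T t0 ∘ G.t) (G.tou S) + k' * phi q (col T w ∘ G.s) (col T w ∘ G.t) (G.tou S) := h1
  rw [h1']
  ring

lemma ph_suppress (q : ℝ) {e f : E} {v a : V} (he : e ∈ G.F) (hf : f ∈ G.F) (hef : e ≠ f) (hav : a ≠ v)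
    (h1 : (G.s e = v ∧ G.t e = a) ∨ (G.s e = a ∧ G.t e = v))
    (h2 : (G.s f = v ∧ G.t f ≠ v) ∨ (G.t f = v ∧ G.s f ≠ v))
    (h3 : ∀ e' ∈ G.F, e' ≠ e → e' ≠ f → G.s e' ≠ v ∧ G.t e' ≠ v) :
    G.ph q = (G.mp (col {v} a) (G.F.erase e)).ph q := by
  have h0 : phi q G.s G.t (G.F.erase e) = 0 :=
    phi_pendant q _ _ (e := f) (mem_erase.2 ⟨hef.symm, hf⟩) v h2
      (fun e' he' hne => h3 e' (mem_of_mem_erase he') (ne_of_mem_erase he') hne)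
  have hcm : mv v a = col {v} a := by funext x; simp [mv, col]
  unfold ph mp
  simp only
  rcases h1 with ⟨h, h'⟩ | ⟨h, h'⟩
  · rw [phi_contract q _ _ he (by rw [h, h']; exact hav.symm), h0, h, h', hcm, sub_zero]
  · rw [phi_contract' q _ _ he (by rw [h, h']; exact hav), h0, h, h', hcm, sub_zero]

/-- deletion-contraction -/
lemma ph_dc (q : ℝ) {e : E} {v w : V} (he : e ∈ G.F) (hvw : v ≠ w)
    (h1 : (G.s e = v ∧ G.t e = w) ∨ (G.s e = w ∧ G.t e = v)) :
    G.ph q = (G.mp (col {v} w) (G.F.erase e)).ph q - (⟨G.s, G.t, G.F.erase e⟩ : Gr V E).ph q := by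
  have hcm : mv v w = col {v} w := by funext x; simp [mv, col]
  unfold ph mp
  simp only
  rcases h1 with ⟨h, h'⟩ | ⟨h, h'⟩
  · rw [phi_contract q _ _ he (by rw [h, h']; exact hvw), h, h', hcm]
  · rw [phi_contract' q _ _ he (by rw [h, h']; exact hvw.symm), h, h', hcm]

end Gr

end Factor

end CubicFlow

namespace CubicFlow

section NearDefs

variable {V E : Type} [Fintype V] [DecidableEq V] [DecidableEq E]

/-- preimage -/
def pre (c : V → V) (X : Finset V) : Finset V := univ.filter fun x => c x ∈ X

lemma mem_pre {c : V → V} {X : Finset V} {x : V} : x ∈ pre c X ↔ c x ∈ X := by simp [pre]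

lemma pre_sdiff (c : V → V) (X Y : Finset V) : pre c (X \ Y) = pre c X \ pre c Y := by
  ext x; simp [mem_pre]

lemma pre_union (c : V → V) (X Y : Finset V) : pre c (X ∪ Y) = pre c X ∪ pre c Y := by
  ext x; simp [mem_pre]

lemma pre_disj {c : V → V} {X Y : Finset V} (h : Disjoint X Y) : Disjoint (pre c X) (pre c Y) := by
  rw [disjoint_left] at *
  intro x; simp only [mem_pre]; exact fun h1 => h h1

/-- an arm -/
def arm (P Y : Finset V) (l : V → ℕ) (i : ℕ) : Finset V := (P \ Y).filter fun v => l v = i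

namespace Gr

/-- bad configuration -/
def Bad (G : Gr V E) (P : Finset V) (w : V) : Prop :=
  ∃ Y ⊆ P, Y.Nonempty ∧ G.bt Y {w} = 0 ∧ ∃ l : V → ℕ,
    (∀ i, (arm P Y l i).Nonempty → 2 ≤ #(arm P Y l i) ∧ G.bt (arm P Y l i) Y = 2 ∧
      G.bt (arm P Y l i) (P \ (Y ∪ arm P Y l i)) = 0) ∧
    ∃ i j, i ≠ j ∧ (arm P Y l i).Nonempty ∧ (arm P Y l j).Nonempty

/-- nearly cubic graphs with root `w` -/
structure Near (G : Gr V E) (P : Finset V) (w : V) : Prop where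
  wP : w ∉ P
  ends : ∀ e ∈ G.F, G.s e ∈ insert w P ∧ G.t e ∈ insert w P
  nl : ∀ e ∈ G.F, G.s e ≠ G.t e
  deg : ∀ v ∈ P, G.h P {v} + G.bt {v} {w} = 3
  cut3 : ∀ X ⊆ P, X.Nonempty → 3 ≤ G.h P X + G.bt X {w}
  sep2 : ∀ X ⊆ P, X.Nonempty → X ≠ P → 2 ≤ G.h P X
  nb : 4 ≤ G.bt P {w} → ¬ G.Bad P w

/-- sign condition -/
def Pos (q : ℝ) (G : Gr V E) (P : Finset V) : Prop := 0 < (-1 : ℝ) ^ (#G.F + #P) * G.ph q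

variable (G : Gr V E)

/-- the removed edges become loops -/
def Good (c : V → V) (F' : Finset E) : Prop :=
  F' ⊆ G.F ∧ ∀ e ∈ G.F, e ∉ F' → c (G.s e) = c (G.t e)

variable {G}

lemma good_bt {c : V → V} {F' : Finset E} (hg : G.Good c F') {X Y : Finset V} (hd : Disjoint X Y) :
    (G.mp c F').bt X Y = G.bt (pre c X) (pre c Y) := by
  refine G.bt_mp c F' hg.1 X Y fun e he he' => ?_
  rw [hg.2 e he he']
  exact ⟨fun h => disjoint_left.1 hd h.1 h.2, fun h => disjoint_left.1 hd h.2 h.1⟩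

lemma good_h {c : V → V} {F' : Finset E} (hg : G.Good c F') (P X : Finset V) :
    (G.mp c F').h P X = G.h (pre c P) (pre c X) := by
  unfold h
  rw [good_bt hg disjoint_sdiff, pre_sdiff]

lemma pre_arm (c : V → V) (P Y : Finset V) (l : V → ℕ) (i : ℕ) :
    pre c (arm P Y l i) = arm (pre c P) (pre c Y) (l ∘ c) i := by
  ext x; simp [mem_pre, arm]

lemma pre_nonempty {c : V → V} {P X : Finset V} (hc : ∀ x ∈ P, c x = x) (hX : X ⊆ P)
    (hn : X.Nonempty) : (pre c X).Nonempty := by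
  obtain ⟨x, hx⟩ := hn
  exact ⟨x, mem_pre.2 (by rw [hc x (hX hx)]; exact hx)⟩

lemma sub_pre {c : V → V} {P X : Finset V} (hc : ∀ x ∈ P, c x = x) (hX : X ⊆ P) : X ⊆ pre c X := by
  intro x hx
  exact mem_pre.2 (by rw [hc x (hX hx)]; exact hx)

lemma pre_mono {c : V → V} {X Y : Finset V} (h : X ⊆ Y) : pre c X ⊆ pre c Y := by
  intro x; simp only [mem_pre]; exact fun h1 => h h1

lemma pre_ne {c : V → V} {P X : Finset V} (hc : ∀ x ∈ P, c x = x) (hX : X ⊆ P) (hne : X ≠ P) :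
    pre c X ≠ pre c P := by
  intro h
  apply hne
  refine Subset.antisymm hX fun x hx => ?_
  have : x ∈ pre c P := sub_pre hc Subset.rfl hx
  rw [← h, mem_pre, hc x hx] at this
  exact this

lemma arm_subset (P Y : Finset V) (l : V → ℕ) (i : ℕ) : arm P Y l i ⊆ P := fun x hx =>
  (mem_sdiff.1 (mem_filter.1 hx).1).1

lemma bad_pull {c : V → V} {F' : Finset E} (hg : G.Good c F') {P1 : Finset V} {w : V}
    (hc : ∀ x ∈ P1, c x = x) (hw : w ∉ P1) (hw' : w ∈ pre c {w}) (hb : (G.mp c F').Bad P1 w) :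
    G.Bad (pre c P1) w := by
  obtain ⟨Y, hY, hYn, hYw, l, h1, i, j, hij, hi, hj⟩ := hb
  have hYd : Disjoint Y {w} := by
    rw [disjoint_singleton_right]; exact fun h => hw (hY h)
  refine ⟨pre c Y, pre_mono hY, pre_nonempty hc hY hYn, ?_, l ∘ c, ?_, i, j, hij, ?_, ?_⟩
  · rw [good_bt hg hYd] at hYw
    have := G.bt_mono_right (pre c Y) (A := {w}) (B := pre c {w}) (by simpa using hw')
    omega
  · intro k hk
    rw [← pre_arm] at hk ⊢
    have hk' : (arm P1 Y l k).Nonempty := by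
      obtain ⟨x, hx⟩ := hk; exact ⟨c x, mem_pre.1 hx⟩
    obtain ⟨a1, a2, a3⟩ := h1 k hk'
    have d1 : Disjoint (arm P1 Y l k) Y := by
      rw [disjoint_left]; intro x hx; exact (mem_sdiff.1 (mem_filter.1 hx).1).2
    have d2 : Disjoint (arm P1 Y l k) (P1 \ (Y ∪ arm P1 Y l k)) := by
      rw [disjoint_left]; intro x hx; simp [hx]
    rw [good_bt hg d1] at a2
    rw [good_bt hg d2, pre_sdiff, pre_union] at a3
    exact ⟨a1.trans (card_le_card (sub_pre hc (arm_subset _ _ _ _))), a2, a3⟩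
  · rw [← pre_arm]; exact pre_nonempty hc (arm_subset _ _ _ _) hi
  · rw [← pre_arm]; exact pre_nonempty hc (arm_subset _ _ _ _) hj

lemma h_insert {P X : Finset V} {w : V} (hw : w ∉ P) (hX : X ⊆ P) :
    G.h (insert w P) X = G.h P X + G.bt X {w} := by
  unfold h
  have : insert w P \ X = (P \ X) ∪ {w} := by
    ext x; simp only [mem_sdiff, mem_insert, mem_union, mem_singleton]
    have : w ∉ X := fun h => hw (hX h)
    constructor
    · rintro ⟨h1 | h1, h2⟩ <;> tauto
    · rintro (h | rfl) <;> tauto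
  rw [this, bt_union_right]
  simp [hw]

lemma bt_self_zero (hnl : ∀ e ∈ G.F, G.s e ≠ G.t e) (v : V) : G.bt {v} {v} = 0 := by
  unfold bt
  refine Finset.sum_eq_zero fun e he => ?_
  unfold ec
  simp only [mem_singleton]
  have : ¬ (G.s e = v ∧ G.t e = v) := fun h => hnl e he (h.1.trans h.2.symm)
  simp [this]

lemma h_single {P : Finset V} {v : V} (hnl : ∀ e ∈ G.F, G.s e ≠ G.t e) (hv : v ∈ P) :
    G.h P {v} = G.bt {v} P := by
  unfold h
  rw [G.bt_split {v} (Y := P) (Z := {v}) (by simpa using hv), bt_self_zero hnl]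
  omega

/-- handshake: general form -/
lemma handshake {U X : Finset V} (hnl : ∀ e ∈ G.F, G.s e ≠ G.t e) (hX : X ⊆ U)
    (hdeg : ∀ v ∈ X, G.h U {v} = 3) : ∃ k, 3 * #X = 2 * k + G.h U X := by
  have h1 : G.bt X U = 3 * #X := by
    rw [bt_sum, Finset.sum_congr rfl (fun v hv => by rw [← h_single hnl (hX hv), hdeg v hv])]
    simp [mul_comm]
  obtain ⟨k, hk⟩ := G.bt_self_even X
  have h2 := G.bt_split X hX
  refine ⟨k, ?_⟩
  unfold h
  omega

lemma Near.parity {P : Finset V} {w : V} (hN : G.Near P w) {X : Finset V} (hX : X ⊆ P) :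
    ∃ k, 3 * #X = 2 * k + (G.h P X + G.bt X {w}) := by
  rw [← h_insert hN.wP hX]
  refine handshake hN.nl (hX.trans (subset_insert _ _)) fun v hv => ?_
  rw [h_insert hN.wP (by simpa using hX hv)]
  exact hN.deg v (hX hv)

end Gr

end NearDefs

end CubicFlow

namespace CubicFlow

section Step1

variable {V E : Type} [Fintype V] [DecidableEq V] [DecidableEq E]

lemma pre_col_mem {T X : Finset V} {t0 : V} (h : t0 ∈ X) (hX : ∀ x ∈ X, x ∈ T → x = t0) :
    pre (col T t0) X = X ∪ T := Gr.pre_mem h hX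

lemma pre_col_not {T X : Finset V} {t0 : V} (h : t0 ∉ X) (hX : ∀ x ∈ X, x ∉ T) :
    pre (col T t0) X = X := Gr.pre_not h hX

namespace Gr

variable {G : Gr V E}

lemma good_keep (S : Finset V) (v : V) : G.Good (col S v) (G.keep S) := by
  refine ⟨filter_subset _ _, fun e he he' => ?_⟩
  simp only [keep, mem_filter, not_and, not_not] at he'
  have := he' he
  by_cases h1 : G.s e ∈ S
  · by_cases h2 : G.t e ∈ S
    · rw [col_mem h1, col_mem h2]
    · simp_all
  · simp_all

lemma col_keep_nl {S : Finset V} {v : V} (hnl : ∀ e ∈ G.F, G.s e ≠ G.t e)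
    (hv : ∀ e ∈ G.F, (G.s e ∉ S → G.s e ≠ v) ∧ (G.t e ∉ S → G.t e ≠ v)) :
    ∀ e ∈ (G.mp (col S v) (G.keep S)).F, (G.mp (col S v) (G.keep S)).s e ≠ (G.mp (col S v) (G.keep S)).t e := by
  intro e he
  simp only [mp, keep, mem_filter] at he
  obtain ⟨h1, h2⟩ := he
  have h3 := hnl e h1
  obtain ⟨h4, h5⟩ := hv e h1
  simp only [mp, Function.comp, col]
  split_ifs with a b b
  · tauto
  · exact (h5 b).symm
  · exact h4 a
  · exact h3

lemma Near.side {P S : Finset V} {w : V} (hN : G.Near P w) (hS : S ⊆ P)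
    (h3 : G.h P S + G.bt S {w} = 3) :
    (G.mp (col (insert w (P \ S)) w) (G.keep (insert w (P \ S)))).Near S w := by
  have hwS : w ∉ S := fun h => hN.wP (hS h)
  set R := insert w (P \ S) with hR
  have hg := good_keep (G := G) R w
  have hRS : ∀ x ∈ S, x ∉ R := by
    intro x hx; simp only [hR, mem_insert, mem_sdiff]; rintro (rfl | h)
    · exact hwS hx
    · exact h.2 hx
  have pX : ∀ X ⊆ S, pre (col R w) X = X := fun X hX =>
    pre_col_not (fun h => hwS (hX h)) fun x hx => hRS x (hX hx)
  have pw : pre (col R w) {w} = R := by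
    rw [pre_col_mem (by simp) (by simp)]
    simp [hR]
  have hbw : ∀ X ⊆ S, (G.mp (col R w) (G.keep R)).bt X {w} = G.bt X R := by
    intro X hX
    rw [good_bt hg (by simpa using fun h => hwS (hX h)), pX X hX, pw]
  have hhX : ∀ X ⊆ S, (G.mp (col R w) (G.keep R)).h S X = G.h S X := by
    intro X hX
    rw [good_h hg, pX X hX, pX S Subset.rfl]
  have hRb : ∀ X ⊆ S, G.h S X + G.bt X R = G.h P X + G.bt X {w} := by
    intro X hX
    have d1 : Disjoint (P \ S) {w} := by simp [hN.wP]
    have e1 : R = (P \ S) ∪ {w} := by rw [hR, insert_eq, union_comm]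
    have e2 : P \ X = (S \ X) ∪ (P \ S) := by
      ext x; simp only [mem_sdiff, mem_union]
      have := @hX x; have := @hS x; tauto
    have d2 : Disjoint (S \ X) (P \ S) := by
      rw [disjoint_left]; intro x; simp only [mem_sdiff]; tauto
    unfold h
    rw [e1, e2, bt_union_right G _ d1, bt_union_right G _ d2]
    omega
  refine ⟨hwS, ?_, ?_, ?_, ?_, ?_, ?_⟩
  · intro e he
    have he' : e ∈ G.F := filter_subset _ _ he
    have := hN.ends e he'
    have key : ∀ x ∈ insert w P, col R w x ∈ insert w S := by
      intro x hx
      unfold col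
      split_ifs with h
      · simp
      · simp only [hR, mem_insert, mem_sdiff] at h hx ⊢; tauto
    exact ⟨key _ this.1, key _ this.2⟩
  · apply col_keep_nl hN.nl
    intro e he
    constructor
    · rintro h rfl; exact h (by simp [hR])
    · rintro h rfl; exact h (by simp [hR])
  · intro v hv
    rw [hhX _ (by simpa using hv), hbw _ (by simpa using hv), hRb _ (by simpa using hv)]
    exact hN.deg v (hS hv)
  · intro X hX hn
    rw [hhX X hX, hbw X hX, hRb X hX]
    exact hN.cut3 X (hX.trans hS) hn
  · intro X hX hn hne
    rw [hhX X hX]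
    have hXc : (S \ X).Nonempty := by
      rw [sdiff_nonempty]; intro h; exact hne (Subset.antisymm hX h)
    have h1 := hRb X hX
    have h2 := hRb (S \ X) sdiff_subset
    have h4 := hRb S Subset.rfl
    have h5 := hN.cut3 X (hX.trans hS) hn
    have h6 := hN.cut3 (S \ X) (sdiff_subset.trans hS) hXc
    have h7 := G.bt_split_left R hX
    have h8 := G.h_compl hX
    have h9 : G.h S S = 0 := by simp [h]
    omega
  · intro h4
    rw [hbw S Subset.rfl] at h4
    have h1 := hRb S Subset.rfl
    have h9 : G.h S S = 0 := by simp [h]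
    omega

lemma Near.coll {P S : Finset V} {w s0 : V} (hN : G.Near P w) (hS : S ⊆ P) (hs0 : s0 ∈ S)
    (h3 : G.h P S + G.bt S {w} = 3) :
    (G.mp (col S s0) (G.keep S)).Near (insert s0 (P \ S)) w := by
  have hwS : w ∉ S := fun h => hN.wP (hS h)
  have hws : w ≠ s0 := fun h => hwS (h ▸ hs0)
  have hg := good_keep (G := G) S s0
  set P1 := insert s0 (P \ S) with hP1
  have hc : ∀ x ∈ P1, col S s0 x = x := by
    intro x hx
    simp only [hP1, mem_insert, mem_sdiff] at hx
    rcases hx with rfl | hx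
    · exact col_mem hs0
    · exact col_not hx.2
  have pP : pre (col S s0) P1 = P := by
    rw [pre_col_mem (by simp [hP1])]
    · ext x; simp only [hP1, mem_union, mem_insert, mem_sdiff]
      have := @hS x
      constructor
      · rintro ((rfl | h) | h)
        · exact hS hs0
        · tauto
        · tauto
      · tauto
    · intro x hx hx'; simp only [hP1, mem_insert, mem_sdiff] at hx; tauto
  have pw : pre (col S s0) {w} = {w} := pre_col_not (by simpa using hws.symm) (by simpa using hwS)
  have hwP1 : w ∉ P1 := by simp [hP1, hws, hN.wP]
  have hsub : ∀ X ⊆ P1, pre (col S s0) X ⊆ P := fun X hX => by rw [← pP]; exact pre_mono hX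
  have hbw : ∀ X ⊆ P1, (G.mp (col S s0) (G.keep S)).bt X {w} = G.bt (pre (col S s0) X) {w} := by
    intro X hX
    rw [good_bt hg (by simpa using fun h => hwP1 (hX h)), pw]
  refine ⟨hwP1, ?_, ?_, ?_, ?_, ?_, ?_⟩
  · intro e he
    have he' : e ∈ G.F := filter_subset _ _ he
    have := hN.ends e he'
    have key : ∀ x ∈ insert w P, col S s0 x ∈ insert w P1 := by
      intro x hx
      unfold col
      split_ifs with h
      · simp [hP1]
      · simp only [hP1, mem_insert, mem_sdiff] at h hx ⊢; tauto
    exact ⟨key _ this.1, key _ this.2⟩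
  · apply col_keep_nl hN.nl
    intro e he
    constructor
    · rintro h rfl; exact h hs0
    · rintro h rfl; exact h hs0
  · intro v hv
    rw [good_h hg, hbw _ (by simpa using hv), pP]
    simp only [hP1, mem_insert, mem_sdiff] at hv
    rcases hv with rfl | hv
    · have : pre (col S v) {v} = S := by
        rw [pre_col_mem (by simp) (by simp)]
        simp [hs0]
      rw [this]; exact h3
    · have : pre (col S s0) {v} = {v} := by
        apply pre_col_not
        · simp; rintro rfl; exact hv.2 hs0
        · simpa using hv.2
      rw [this]; exact hN.deg v hv.1
  · intro X hX hn
    rw [good_h hg, hbw X hX, pP]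
    exact hN.cut3 _ (hsub X hX) (pre_nonempty hc hX hn)
  · intro X hX hn hne
    rw [good_h hg, pP]
    refine hN.sep2 _ (hsub X hX) (pre_nonempty hc hX hn) ?_
    rw [← pP]; exact pre_ne hc hX hne
  · intro h4 hb
    rw [hbw P1 Subset.rfl, pP] at h4
    refine hN.nb h4 ?_
    have := bad_pull hg hc hwP1 (by rw [pw]; simp) hb
    rwa [pP] at this

lemma keep_card {P S : Finset V} {w : V} (hw : w ∉ P) (hS : S ⊆ P)
    (hends : ∀ e ∈ G.F, G.s e ∈ insert w P ∧ G.t e ∈ insert w P) :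
    #(G.keep S) + #(G.keep (insert w (P \ S))) = #G.F + (G.h P S + G.bt S {w}) := by
  have hwS : w ∉ S := fun h => hw (hS h)
  set R := insert w (P \ S) with hR
  have hd : Disjoint S R := by
    rw [disjoint_left]; intro x hx; simp only [hR, mem_insert, mem_sdiff]; rintro (rfl | h)
    · exact hwS hx
    · exact h.2 hx
  have e1 : insert w P \ S = R := by
    ext x; simp only [hR, mem_insert, mem_sdiff]
    constructor
    · tauto
    · rintro (rfl | h) <;> tauto
  have hmem : ∀ e ∈ G.F, (G.s e ∈ S ∨ G.s e ∈ R) ∧ (G.t e ∈ S ∨ G.t e ∈ R) := by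
    intro e he
    have := hends e he
    simp only [hR, mem_insert, mem_sdiff] at this ⊢; tauto
  have hn : ∀ x, ¬ (x ∈ S ∧ x ∈ R) := fun x h => disjoint_left.1 hd h.1 h.2
  rw [← h_insert hw hS, ← card_union_add_card_inter]
  unfold h
  rw [e1, bt_eq_card G hd]
  congr 2
  · ext e; simp only [keep, mem_union, mem_filter]
    have := hn (G.s e)
    tauto
  · ext e; simp only [keep, mem_inter, mem_filter, mem_bte]
    have h1 := hn (G.s e); have h2 := hn (G.t e)
    constructor
    · rintro ⟨⟨h3, h4⟩, -, h5⟩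
      have := hmem e h3
      tauto
    · tauto

lemma keep_lt {X : Finset V} (h : ∃ e ∈ G.F, G.s e ∈ X ∧ G.t e ∈ X) : #(G.keep X) < #G.F := by
  obtain ⟨e, he, h1⟩ := h
  refine card_lt_card ⟨filter_subset _ _, fun h => ?_⟩
  have := h he
  simp [keep, h1] at this

lemma exists_edge {X Y : Finset V} (h : 0 < G.bt X Y) :
    ∃ e ∈ G.F, (G.s e ∈ X ∧ G.t e ∈ Y) ∨ (G.s e ∈ Y ∧ G.t e ∈ X) := by
  by_contra hcon
  push Not at hcon
  have : G.bt X Y = 0 := by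
    unfold bt
    refine Finset.sum_eq_zero fun e he => ?_
    obtain ⟨h1, h2⟩ := hcon e he
    unfold ec
    rw [if_neg (fun h => h1 h.1 h.2), if_neg (fun h => h2 h.1 h.2)]
    rfl
  omega

/-- Step 1: reducing nontrivial 3-edge-cuts -/
lemma Near.step1 {q : ℝ} (hq : 2 < q) {P S : Finset V} {w : V} (hN : G.Near P w)
    (IH : ∀ (G' : Gr V E) (P' : Finset V) (w' : V), #G'.F < #G.F → G'.Near P' w' → Pos q G' P')
    (hS : S ⊆ P) (h2 : 2 ≤ #S) (hne : S ≠ P) (h3 : G.h P S + G.bt S {w} = 3) : Pos q G P := by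
  have hwS : w ∉ S := fun h => hN.wP (hS h)
  obtain ⟨s0, hs0⟩ : S.Nonempty := card_pos.1 (by omega)
  set R := insert w (P \ S) with hR
  have hd : Disjoint R S := by
    rw [disjoint_right]; intro x hx; simp only [hR, mem_insert, mem_sdiff]; rintro (rfl | h)
    · exact hwS hx
    · exact h.2 hx
  have hPR : insert w P = R ∪ S := by
    ext x; simp only [hR, mem_insert, mem_sdiff, mem_union]
    have := @hS x; tauto
  have hbt : G.bt R S = 3 := by
    rw [bt_comm, ← h3, ← h_insert hN.wP hS]
    unfold h
    congr 1
    rw [hPR, union_sdiff_cancel_right hd]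
  have hf := G.ph_cut q hd (s0 := w) (t0 := s0) (by simp [hR]) hs0
    (by rw [← hPR]; exact hN.ends) hbt.le
  rw [hbt, bond_three] at hf
  have hk := keep_card hN.wP hS hN.ends
  rw [h3, ← hR] at hk
  -- both sides contain an inner edge
  have hex1 : ∃ e ∈ G.F, G.s e ∈ S ∧ G.t e ∈ S := by
    have hpos : 0 < G.bt {s0} (S \ {s0}) := by
      by_contra h0
      have h5 : S \ {s0} ⊆ P := sdiff_subset.trans hS
      have hn : (S \ {s0}).Nonempty := by
        rw [← card_pos, card_sdiff_of_subset (by simpa using hs0)]; simp; omega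
      have a1 := hN.cut3 {s0} (by simpa using hS hs0) (by simp)
      have a2 := hN.cut3 (S \ {s0}) h5 hn
      have a3 := G.h_disj (P := P) (A := {s0}) (B := S \ {s0}) (by simpa using hS hs0) h5 disjoint_sdiff
      rw [union_sdiff_of_subset (by simpa using hs0)] at a3
      have a4 := G.bt_split_left {w} (X := S) (Z := {s0}) (by simpa using hs0)
      omega
    obtain ⟨e, he, h⟩ := exists_edge hpos
    refine ⟨e, he, ?_⟩
    simp only [mem_singleton, mem_sdiff] at h
    rcases h with ⟨rfl, h⟩ | ⟨h, rfl⟩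
    · exact ⟨hs0, h.1⟩
    · exact ⟨h.1, hs0⟩
  have hex2 : ∃ e ∈ G.F, G.s e ∈ R ∧ G.t e ∈ R := by
    have hTn : (P \ S).Nonempty := by
      rw [sdiff_nonempty]; intro h; exact hne (Subset.antisymm hS h)
    have hpos : 0 < G.bt (P \ S) {w} := by
      have a1 := hN.cut3 (P \ S) sdiff_subset hTn
      rw [G.h_compl hS] at a1
      have a5 := hN.sep2 S hS ⟨s0, hs0⟩ hne
      rcases Nat.lt_or_ge (G.h P S) 3 with h | h
      · omega
      · by_contra h0
        have b1 : G.bt S {w} = 0 := by omega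
        have b2 : G.bt P {w} = 0 := by
          rw [G.bt_split_left {w} hS]; omega
        have b3 := hN.cut3 P Subset.rfl (hTn.mono sdiff_subset)
        have b4 : G.h P P = 0 := by simp [Gr.h]
        omega
    obtain ⟨e, he, h⟩ := exists_edge hpos
    refine ⟨e, he, ?_⟩
    simp only [mem_singleton] at h
    rcases h with ⟨h, h'⟩ | ⟨h', h⟩
    · exact ⟨mem_insert_of_mem h, by rw [h']; simp [hR]⟩
    · exact ⟨by rw [h']; simp [hR], mem_insert_of_mem h⟩
  have p1 := IH _ _ _ (keep_lt hex1) (hN.coll hS hs0 h3)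
  have p2 := IH _ _ _ (keep_lt hex2) (hN.side hS h3)
  unfold Pos at *
  have c1 : #(insert s0 (P \ S)) = #P - #S + 1 := by
    rw [card_insert_of_notMem (by simp [hs0]), card_sdiff_of_subset hS]
  have c2 := card_le_card hS
  have hsign : (-1 : ℝ) ^ (#G.F + #P) = (-1 : ℝ) ^ (#(G.keep S) + #(insert s0 (P \ S))) *
      (-1 : ℝ) ^ (#(G.keep R) + #S) := by
    rw [← pow_add, c1]
    have : #(G.keep S) + (#P - #S + 1) + (#(G.keep R) + #S) = #G.F + #P + 2 * 2 := by omega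
    rw [this, pow_add _ _ (2 * 2), pow_mul]
    norm_num
  have hpp := mul_pos p1 p2
  have hxy : 0 < (q - 1) * (q - 2) := by
    apply mul_pos <;> linarith
  have h10 : 0 < (-1 : ℝ) ^ (#G.F + #P) * (G.ph q * ((q - 1) * (q - 2))) := by
    rw [hf, hsign]
    have e1 : ((G.mp (col S s0) (G.keep S)).F) = G.keep S := rfl
    have e2 : ((G.mp (col R w) (G.keep R)).F) = G.keep R := rfl
    rw [e1, e2] at hpp
    refine lt_of_lt_of_eq hpp ?_
    ring
  rw [← mul_assoc] at h10
  exact (pos_iff_pos_of_mul_pos h10).2 hxy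

end Gr

end Step1

end CubicFlow

namespace CubicFlow

section Step2

variable {V E : Type} [Fintype V] [DecidableEq V] [DecidableEq E]

namespace Gr

variable {G : Gr V E}

/-- change of the edge set -/
def del (G : Gr V E) (F' : Finset E) : Gr V E := ⟨G.s, G.t, F'⟩

lemma del_bt {F' : Finset E} (hF : F' ⊆ G.F) {X Y : Finset V}
    (hr : ∀ e ∈ G.F, e ∉ F' → ¬ (G.s e ∈ X ∧ G.t e ∈ Y) ∧ ¬ (G.s e ∈ Y ∧ G.t e ∈ X)) :
    (G.del F').bt X Y = G.bt X Y := by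
  unfold bt del
  refine Finset.sum_subset hF fun e he he' => ?_
  obtain ⟨h1, h2⟩ := hr e he he'
  unfold ec
  rw [if_neg h1, if_neg h2]; rfl

/-- the arms condition -/
def Arms (G : Gr V E) (P Y : Finset V) (l : V → ℕ) : Prop :=
  (∀ i, (arm P Y l i).Nonempty → 2 ≤ #(arm P Y l i) ∧ G.bt (arm P Y l i) Y = 2 ∧
      G.bt (arm P Y l i) (P \ (Y ∪ arm P Y l i)) = 0) ∧
    ∃ i j, i ≠ j ∧ (arm P Y l i).Nonempty ∧ (arm P Y l j).Nonempty

lemma bad_iff {P : Finset V} {w : V} :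
    G.Bad P w ↔ ∃ Y ⊆ P, Y.Nonempty ∧ G.bt Y {w} = 0 ∧ ∃ l, G.Arms P Y l := Iff.rfl

lemma arms_pull {G1 : Gr V E} {c : V → V} {P1 Y : Finset V} {l : V → ℕ}
    (hc : ∀ x ∈ P1, c x = x) (hY : Y ⊆ P1)
    (hb : ∀ X ⊆ P1, ∀ Z ⊆ P1, Disjoint X Z → G1.bt X Z = G.bt (pre c X) (pre c Z))
    (h : G1.Arms P1 Y l) : G.Arms (pre c P1) (pre c Y) (l ∘ c) := by
  obtain ⟨h1, i, j, hij, hi, hj⟩ := h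
  refine ⟨?_, i, j, hij, ?_, ?_⟩
  · intro k hk
    rw [← pre_arm] at hk ⊢
    have hk' : (arm P1 Y l k).Nonempty := by
      obtain ⟨x, hx⟩ := hk; exact ⟨c x, mem_pre.1 hx⟩
    obtain ⟨a1, a2, a3⟩ := h1 k hk'
    have d1 : Disjoint (arm P1 Y l k) Y := by
      rw [disjoint_left]; intro x hx; exact (mem_sdiff.1 (mem_filter.1 hx).1).2
    have d2 : Disjoint (arm P1 Y l k) (P1 \ (Y ∪ arm P1 Y l k)) := by
      rw [disjoint_left]; intro x hx; simp [hx]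
    rw [hb _ (arm_subset _ _ _ _) _ hY d1] at a2
    rw [hb _ (arm_subset _ _ _ _) _ sdiff_subset d2, pre_sdiff, pre_union] at a3
    exact ⟨a1.trans (card_le_card (sub_pre hc (arm_subset _ _ _ _))), a2, a3⟩
  · rw [← pre_arm]; exact pre_nonempty hc (arm_subset _ _ _ _) hi
  · rw [← pre_arm]; exact pre_nonempty hc (arm_subset _ _ _ _) hj

/-- two arms suffice -/
lemma bad_two {P Y A B : Finset V} {w : V} (hY : Y.Nonempty) (hP : P = Y ∪ A ∪ B)
    (hYA : Disjoint Y A) (hYB : Disjoint Y B) (hAB : Disjoint A B)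
    (hw : G.bt Y {w} = 0) (hA : 2 ≤ #A) (hB : 2 ≤ #B) (h1 : G.bt A Y = 2) (h2 : G.bt B Y = 2)
    (h3 : G.bt A B = 0) : G.Bad P w := by
  rw [disjoint_left] at hYA hYB hAB
  set l : V → ℕ := fun v => if v ∈ A then 0 else 1 with hl
  have e0 : arm P Y l 0 = A := by
    ext x; simp only [arm, hl, hP, mem_filter, mem_sdiff, mem_union]
    have := @hYA x; have := @hYB x; have := @hAB x
    by_cases hx : x ∈ A <;> simp [hx] <;> tauto
  have e1 : arm P Y l 1 = B := by
    ext x; simp only [arm, hl, hP, mem_filter, mem_sdiff, mem_union]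
    have := @hYA x; have := @hYB x; have := @hAB x
    by_cases hx : x ∈ A <;> simp [hx] <;> tauto
  have e2 : ∀ i, i ≠ 0 → i ≠ 1 → arm P Y l i = ∅ := by
    intro i hi hi'
    ext x; simp only [arm, hl, mem_filter, notMem_empty, iff_false]
    rintro ⟨-, h⟩
    split_ifs at h <;> omega
  refine ⟨Y, by rw [hP]; intro x hx; simp [hx], hY, hw, l, ?_, 0, 1, by decide, ?_, ?_⟩
  · intro i hi
    rcases eq_or_ne i 0 with rfl | hi0
    · rw [e0]
      refine ⟨hA, h1, ?_⟩
      have : P \ (Y ∪ A) = B := by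
        ext x; rw [hP]; simp only [mem_sdiff, mem_union]
        have := @hYA x; have := @hYB x; have := @hAB x
        tauto
      rw [this]; exact h3
    rcases eq_or_ne i 1 with rfl | hi1
    · rw [e1]
      refine ⟨hB, h2, ?_⟩
      have : P \ (Y ∪ B) = A := by
        ext x; rw [hP]; simp only [mem_sdiff, mem_union]
        have := @hYA x; have := @hYB x; have := @hAB x
        tauto
      rw [this, bt_comm]; exact h3
    · rw [e2 i hi0 hi1] at hi; simp at hi
  · rw [e0, ← card_pos]; omega
  · rw [e1, ← card_pos]; omega

/-- a 2-separation of the non-root part -/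
structure Sep (G : Gr V E) (P : Finset V) (w : V) (S T : Finset V) : Prop where
  near : G.Near P w
  nbad : ¬ G.Bad P w
  un : P = S ∪ T
  dj : Disjoint S T
  cS : 2 ≤ #S
  cT : 2 ≤ #T
  b : G.bt S T = 2
  dS : 2 ≤ G.bt S {w}
  dT : 2 ≤ G.bt T {w}

lemma Sep.symm {P S T : Finset V} {w : V} (h : G.Sep P w S T) : G.Sep P w T S :=
  ⟨h.near, h.nbad, by rw [h.un, union_comm], h.dj.symm, h.cT, h.cS, by rw [bt_comm, h.b], h.dT, h.dS⟩

lemma Sep.hP {P S T : Finset V} {w : V} (h : G.Sep P w S T) {X : Finset V} (hX : X ⊆ S) :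
    G.h P X = G.bt X (S \ X) + G.bt X T := by
  have hd := disjoint_left.1 h.dj
  rw [← bt_union_right]
  · unfold Gr.h; congr 1; rw [h.un]; ext x; simp only [mem_sdiff, mem_union]
    have := @hX x; have := @hd x; tauto
  · exact h.dj.mono_left sdiff_subset

lemma Sep.one {P S T : Finset V} {w : V} (h : G.Sep P w S T) {v : V} (hv : v ∈ P) :
    G.bt {v} {w} ≤ 1 := by
  have h1 := h.near.deg v hv
  have h2 := h.near.sep2 {v} (by simpa using hv) (by simp) (by
    rintro hh
    have := h.cS; have := h.cT
    have h3 : #P = #S + #T := by rw [h.un, card_union_of_disjoint h.dj]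
    rw [← hh] at h3; simp at h3; omega)
  omega

lemma Sep.mid {P S T X : Finset V} {w : V} (h : G.Sep P w S T) (hX : X ⊆ S) (hXn : X.Nonempty)
    (hXw : G.bt X {w} = 0) (h2 : G.h P (S \ X) = 2) (hne : (S \ X).Nonempty) : False := by
  have e1 := h.hP (X := S \ X) sdiff_subset
  rw [Finset.sdiff_sdiff_eq_self hX, h2] at e1
  have e2 := h.hP hX
  have hSP : S ⊆ P := by rw [h.un]; exact subset_union_left
  have e3 := h.near.cut3 X (hX.trans hSP) hXn
  have e4 := G.bt_split_left T hX
  rw [h.b] at e4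
  have e5 := G.bt_comm (S \ X) X
  have e6 := G.bt_split_left {w} hX
  have hd := disjoint_left.1 h.dj
  have c2 : 2 ≤ #(S \ X) := by
    by_contra hc
    obtain ⟨v, hv⟩ := card_eq_one.1 (show #(S \ X) = 1 by have := card_pos.2 hne; omega)
    have hvP : v ∈ P := hSP (by have : v ∈ S \ X := by simp [hv]
                                exact (mem_sdiff.1 this).1)
    have := h.one hvP
    have := h.dS
    rw [hv] at e6; omega
  refine h.nbad (bad_two (Y := X) (A := S \ X) (B := T) hXn ?_ disjoint_sdiff (h.dj.mono_left hX)
    (h.dj.mono_left sdiff_subset) hXw c2 h.cT ?_ ?_ ?_)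
  · rw [union_sdiff_of_subset hX, h.un]
  · omega
  · rw [bt_comm]; omega
  · omega

/-- Cubic 3-edge-connected graphs -/
structure Cub (G : Gr V E) (U : Finset V) : Prop where
  ends : ∀ e ∈ G.F, G.s e ∈ U ∧ G.t e ∈ U
  nl : ∀ e ∈ G.F, G.s e ≠ G.t e
  deg : ∀ v ∈ U, G.h U {v} = 3
  cut3 : ∀ X ⊆ U, X.Nonempty → X ≠ U → 3 ≤ G.h U X

lemma Cub.near {U : Finset V} (hC : G.Cub U) {w : V} (hw : w ∈ U) : G.Near (U.erase w) w := by
  have e : insert w (U.erase w) = U := insert_erase hw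
  have hh : ∀ X ⊆ U.erase w, G.h (U.erase w) X + G.bt X {w} = G.h U X := by
    intro X hX
    rw [← h_insert (by simp) hX, e]
  have hne : ∀ X ⊆ U.erase w, X ≠ U := by
    rintro X hX rfl; have := hX hw; simp at this
  have hww : G.bt (U.erase w) {w} = 3 := by
    have := hC.deg w hw
    unfold h at this
    rw [bt_comm, sdiff_singleton_eq_erase] at this; exact this
  refine ⟨by simp, by rw [e]; exact hC.ends, hC.nl, ?_, ?_, ?_, ?_⟩
  · intro v hv
    rw [hh _ (by simpa using hv)]; exact hC.deg v (mem_of_mem_erase hv)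
  · intro X hX hn
    rw [hh X hX]; exact hC.cut3 X (hX.trans (erase_subset _ _)) hn (hne X hX)
  · intro X hX hn hX'
    have h1 := hC.cut3 X (hX.trans (erase_subset _ _)) hn (hne X hX)
    have hn' : (U.erase w \ X).Nonempty := by
      rw [sdiff_nonempty]; intro h; exact hX' (Subset.antisymm hX h)
    have h2 := hC.cut3 (U.erase w \ X) (sdiff_subset.trans (erase_subset _ _)) hn' (hne _ sdiff_subset)
    rw [← hh X hX] at h1
    rw [← hh _ sdiff_subset, h_compl G hX] at h2
    have h3 := G.bt_split_left {w} hX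
    omega
  · intro h; omega

end Gr

end Step2

end CubicFlow

namespace CubicFlow

section Step2b

variable {V E : Type} [Fintype V] [DecidableEq V] [DecidableEq E]

namespace Gr

variable {G : Gr V E}

lemma Sep.wS {P S T : Finset V} {w : V} (h : G.Sep P w S T) : w ∉ S := fun hh =>
  h.near.wP (by rw [h.un]; exact mem_union_left _ hh)

lemma Sep.wT {P S T : Finset V} {w : V} (h : G.Sep P w S T) : w ∉ T := h.symm.wS

lemma Sep.SP {P S T : Finset V} {w : V} (h : G.Sep P w S T) : S ⊆ P := by
  rw [h.un]; exact subset_union_left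

lemma Sep.TP {P S T : Finset V} {w : V} (h : G.Sep P w S T) : T ⊆ P := h.symm.SP

lemma Sep.SneP {P S T : Finset V} {w : V} (h : G.Sep P w S T) {X : Finset V} (hX : X ⊆ S) : X ≠ P := by
  rintro rfl
  obtain ⟨t, ht⟩ : T.Nonempty := card_pos.1 (by have := h.cT; omega)
  exact disjoint_left.1 h.dj (hX (h.TP ht)) ht

lemma Sep.ends {P S T : Finset V} {w : V} (h : G.Sep P w S T) {e : E} (he : e ∈ G.F) :
    (G.s e = w ∨ G.s e ∈ S ∨ G.s e ∈ T) ∧ (G.t e = w ∨ G.t e ∈ S ∨ G.t e ∈ T) := by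
  have := h.near.ends e he
  rw [h.un] at this
  simpa using this

lemma Sep.hat {P S T : Finset V} {w t0 : V} (h : G.Sep P w S T) (ht0 : t0 ∈ T) {eT : E}
    (heT : eT ∈ G.bte T {w}) :
    (G.mp (col T t0) (insert eT (G.tou S))).Near (insert t0 S) w := by
  have hd := disjoint_left.1 h.dj
  have hwS := h.wS
  have hwT := h.wT
  have hwt : w ≠ t0 := fun hh => hwT (hh ▸ ht0)
  have htS : t0 ∉ S := fun hh => hd hh ht0
  set F' := insert eT (G.tou S) with hF'
  set c := col T t0 with hc0
  set F0 := G.F \ ((G.bte T {w}).erase eT) with hF0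
  set G1 := G.mp c F' with hG1
  set P1 := insert t0 S with hP1
  have hcw : c w = w := col_not hwT
  have hcS : ∀ x ∈ S, c x = x := fun x hx => col_not (hd hx)
  have hcT : ∀ x ∈ T, c x = t0 := fun x hx => col_mem hx
  have hc : ∀ x ∈ P1, c x = x := by
    intro x hx
    rcases mem_insert.1 hx with rfl | hx
    · exact col_mem ht0
    · exact hcS x hx
  have hwP1 : w ∉ P1 := by simp [hP1, hwt, hwS]
  have heTF : eT ∈ G.F := (G.mem_bte.1 heT).1
  have hg : (G.del F0).Good c F' := by
    constructor
    · intro e he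
      rcases mem_insert.1 he with rfl | he
      · simp only [del, hF0, mem_sdiff, mem_erase]; exact ⟨heTF, by tauto⟩
      · simp only [tou, mem_filter] at he
        simp only [del, hF0, mem_sdiff, mem_erase, mem_bte, mem_singleton]
        refine ⟨he.1, ?_⟩
        rintro ⟨-, -, ⟨h1, h2⟩ | ⟨h1, h2⟩⟩
        · rcases he.2 with h3 | h3
          · exact hd h3 h1
          · exact hwS (h2 ▸ h3)
        · rcases he.2 with h3 | h3
          · exact hwS (h1 ▸ h3)
          · exact hd h3 h2
    · intro e he he'
      simp only [del, hF0, mem_sdiff, mem_erase, mem_bte, mem_singleton] at he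
      simp only [hF', mem_insert, tou, mem_filter, not_or, not_and] at he'
      have h1 := h.ends he.1
      have h2 := h.near.nl e he.1
      have h3 := he'.2 he.1
      have hs : G.s e ∈ T := by
        rcases h1 with ⟨a | a | a, b | b | b⟩ <;> first | assumption | tauto | exact absurd (a.trans b.symm) h2
      have ht : G.t e ∈ T := by
        rcases h1 with ⟨a | a | a, b | b | b⟩ <;> first | assumption | tauto | exact absurd (a.trans b.symm) h2
      show c (G.s e) = c (G.t e)
      rw [hcT _ hs, hcT _ ht]
  have hwpre : ∀ X ⊆ P1, w ∉ pre c X := by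
    intro X hX hh; rw [mem_pre, hcw] at hh; exact hwP1 (hX hh)
  have hb : ∀ X ⊆ P1, ∀ Z ⊆ P1, Disjoint X Z → G1.bt X Z = G.bt (pre c X) (pre c Z) := by
    intro X hX Z hZ hXZ
    have := good_bt hg hXZ
    refine this.trans (del_bt sdiff_subset fun e he he' => ?_)
    simp only [hF0, mem_sdiff, not_and, not_not] at he'
    have := mem_of_mem_erase (he' he)
    rw [mem_bte] at this
    have h1 := hwpre X hX
    have h2 := hwpre Z hZ
    rcases this.2 with ⟨a, b⟩ | ⟨a, b⟩
    · rw [mem_singleton] at b; rw [b]; tauto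
    · rw [mem_singleton] at a; rw [a]; tauto
  have hpS : ∀ X ⊆ S, pre c X = X := fun X hX =>
    pre_col_not (fun hh => htS (hX hh)) fun x hx => hd (hX hx)
  have hpT : ∀ X ⊆ P1, t0 ∈ X → pre c X = X.erase t0 ∪ T := by
    intro X hX hX'
    rw [hc0, pre_col_mem hX']
    · ext x; simp only [mem_union, mem_erase]
      constructor
      · rintro (h1 | h1)
        · by_cases h2 : x = t0
          · right; rw [h2]; exact ht0
          · tauto
        · tauto
      · tauto
    · intro x hx hx'
      rcases mem_insert.1 (hX hx) with h1 | h1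
      · exact h1
      · exact absurd hx' (hd h1)
  have pw : pre c {w} = {w} := pre_col_not (by simpa using hwt.symm) (by simpa using hwT)
  have pP : pre c P1 = P := by
    rw [hpT P1 Subset.rfl (by simp [hP1]), hP1, erase_insert htS, h.un]
  have hsubS : ∀ X ⊆ P1, X.erase t0 ⊆ S := by
    intro X hX x hx
    rw [mem_erase] at hx
    exact (mem_insert.1 (hX hx.2)).resolve_left hx.1
  have hbS : ∀ X ⊆ S, (G.del F0).bt X {w} = G.bt X {w} := by
    intro X hX
    refine del_bt sdiff_subset fun e he he' => ?_
    simp only [hF0, mem_sdiff, not_and, not_not] at he'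
    have := mem_of_mem_erase (he' he)
    rw [mem_bte] at this
    have h1 : w ∉ X := fun hh => hwS (hX hh)
    rcases this.2 with ⟨a, b⟩ | ⟨a, b⟩
    · rw [mem_singleton] at b; rw [b]
      exact ⟨fun hh => hd (hX hh.1) a, fun hh => h1 hh.2⟩
    · rw [mem_singleton] at a; rw [a]
      exact ⟨fun hh => h1 hh.1, fun hh => hd (hX hh.2) b⟩
  have hbT : (G.del F0).bt T {w} = 1 := by
    rw [bt_eq_card _ (by simpa using hwT), card_eq_one]
    refine ⟨eT, ?_⟩
    ext e
    simp only [bte, del, hF0, mem_filter, mem_sdiff, mem_erase, mem_singleton]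
    simp only [bte, mem_filter, mem_singleton] at heT
    constructor
    · tauto
    · rintro rfl; tauto
  have hw0 : ∀ X ⊆ S, G1.bt X {w} = G.bt X {w} := by
    intro X hX
    have := good_bt hg (X := X) (Y := {w}) (by simpa using fun hh => hwS (hX hh))
    rw [hpS X hX, pw, hbS X hX] at this
    exact this
  have hw1 : ∀ X ⊆ P1, t0 ∈ X → G1.bt X {w} = G.bt (X.erase t0) {w} + 1 := by
    intro X hX hX'
    have := good_bt hg (X := X) (Y := {w}) (by simpa using fun hh => hwP1 (hX hh))
    rw [hpT X hX hX', pw, bt_union_left _ (h.dj.mono_left (hsubS X hX)), hbS _ (hsubS X hX), hbT] at this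
    exact this
  have hh : ∀ X ⊆ P1, G1.h P1 X = G.h P (pre c X) := by
    intro X hX
    have : G1.h P1 X = G1.bt X (P1 \ X) := rfl
    rw [this, hb X hX _ sdiff_subset disjoint_sdiff, pre_sdiff, pP]; rfl
  have hsub : ∀ X ⊆ P1, pre c X ⊆ P := fun X hX => by rw [← pP]; exact pre_mono hX
  have hsep : ∀ X ⊆ P1, X.Nonempty → X ≠ P1 → 2 ≤ G1.h P1 X := by
    intro X hX hn hne
    rw [hh X hX]
    refine h.near.sep2 _ (hsub X hX) (pre_nonempty hc hX hn) ?_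
    rw [← pP]; exact pre_ne hc hX hne
  have hpSn : ∀ X ⊆ P1, t0 ∉ X → X ⊆ S := by
    intro X hX hX' x hx
    rcases mem_insert.1 (hX hx) with rfl | h1
    · exact absurd hx hX'
    · exact h1
  refine ⟨hwP1, ?_, ?_, ?_, ?_, hsep, ?_⟩
  · intro e he
    have he' : e ∈ G.F := (sdiff_subset (hg.1 he))
    have key : ∀ x, (x = w ∨ x ∈ S ∨ x ∈ T) → c x ∈ insert w P1 := by
      rintro x (rfl | hx | hx)
      · rw [hcw]; simp
      · rw [hcS x hx]; simp [hP1, hx]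
      · rw [hcT x hx]; simp [hP1]
    exact ⟨key _ (h.ends he').1, key _ (h.ends he').2⟩
  · intro e he
    show c (G.s e) ≠ c (G.t e)
    have he2 : e ∈ G.F := (sdiff_subset (hg.1 he))
    have h1 := h.ends he2
    have h2 := h.near.nl e he2
    have h3 : ¬ (G.s e ∈ T ∧ G.t e ∈ T) := by
      rintro ⟨a, b⟩
      rcases mem_insert.1 he with rfl | he'
      · rcases (G.mem_bte.1 heT).2 with ⟨-, x⟩ | ⟨x, -⟩ <;> rw [mem_singleton] at x
        · rw [x] at b; exact hwT b
        · rw [x] at a; exact hwT a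
      · rcases (mem_filter.1 he').2 with x | x
        · exact hd x a
        · exact hd x b
    have key : ∀ x, x ∉ T → c x = x := fun x hx => col_not hx
    by_cases a : G.s e ∈ T
    · by_cases b : G.t e ∈ T
      · tauto
      · rw [hcT _ a, key _ b]; rintro hh; exact b (hh ▸ ht0)
    · by_cases b : G.t e ∈ T
      · rw [hcT _ b, key _ a]; rintro hh; exact a (hh ▸ ht0)
      · rw [key _ a, key _ b]; exact h2
  · intro v hv
    rw [hh _ (by simpa using hv)]
    rcases mem_insert.1 hv with rfl | hvS
    · rw [hw1 _ (by simpa using hv) (by simp), hpT _ (by simpa using hv) (by simp)]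
      simp only [erase_singleton, empty_union, bt_empty_left]
      have := h.symm.hP (X := T) Subset.rfl
      rw [this]
      simp [h.symm.b]
    · rw [hw0 _ (by simpa using hvS), hpS _ (by simpa using hvS)]
      exact h.near.deg v (h.SP hvS)
  · intro X hX hn
    by_cases ht : t0 ∈ X
    · rw [hw1 X hX ht]
      by_cases hXP : X = P1
      · rw [hXP, hP1, erase_insert htS]
        have := h.dS
        omega
      · have := hsep X hX hn hXP; omega
    · have hXS := hpSn X hX ht
      rw [hh X hX, hw0 X hXS, hpS X hXS]
      exact h.near.cut3 X (hXS.trans h.SP) hn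
  · rintro - ⟨Y, hY, hYn, hYw, l, ha⟩
    have htY : t0 ∉ Y := by
      intro ht
      rw [hw1 Y hY ht] at hYw; omega
    have hYS := hpSn Y hY htY
    refine h.nbad ⟨Y, hYS.trans h.SP, hYn, ?_, l ∘ c, ?_⟩
    · rw [← hw0 Y hYS]; exact hYw
    · have := arms_pull (G := G) hc hY hb ha
      rw [pP, hpS Y hYS] at this
      exact this

end Gr

end Step2b

end CubicFlow

namespace CubicFlow

section Quasi

variable {V E : Type} [Fintype V] [DecidableEq V] [DecidableEq E]

namespace Gr

variable {G : Gr V E}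

/-- quasi near: the root may have degree two -/
structure QN (G : Gr V E) (P : Finset V) (w : V) : Prop where
  wP : w ∉ P
  ends : ∀ e ∈ G.F, G.s e ∈ insert w P ∧ G.t e ∈ insert w P
  nl : ∀ e ∈ G.F, G.s e ≠ G.t e
  deg : ∀ v ∈ P, G.h P {v} + G.bt {v} {w} = 3
  cut3 : ∀ X ⊆ P, X.Nonempty → X ≠ P → 3 ≤ G.h P X + G.bt X {w}
  sep2 : ∀ X ⊆ P, X.Nonempty → X ≠ P → 2 ≤ G.h P X

lemma QN.near {P : Finset V} {w : V} (hQ : G.QN P w) (h3 : 3 ≤ G.bt P {w})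
    (nb : 4 ≤ G.bt P {w} → ¬ G.Bad P w) : G.Near P w := by
  refine ⟨hQ.wP, hQ.ends, hQ.nl, hQ.deg, fun X hX hn => ?_, hQ.sep2, nb⟩
  by_cases hne : X = P
  · subst hne; omega
  · exact hQ.cut3 X hX hn hne

lemma edge_of_one {X : Finset V} {w : V} (hw : w ∉ X) (h : 0 < G.bt X {w}) :
    ∃ e ∈ G.F, ∃ r ∈ X, (G.s e = w ∧ G.t e = r) ∨ (G.s e = r ∧ G.t e = w) := by
  obtain ⟨e, he, h⟩ := exists_edge h
  simp only [mem_singleton] at h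
  rcases h with ⟨a, b⟩ | ⟨a, b⟩
  · exact ⟨e, he, _, a, Or.inr ⟨rfl, b⟩⟩
  · exact ⟨e, he, _, b, Or.inl ⟨a, rfl⟩⟩

/-- incidence number zero -/
lemma bt_zero_iff {X Y : Finset V} : G.bt X Y = 0 ↔
    ∀ e ∈ G.F, ¬ (G.s e ∈ X ∧ G.t e ∈ Y) ∧ ¬ (G.s e ∈ Y ∧ G.t e ∈ X) := by
  unfold bt ec
  rw [Finset.sum_eq_zero_iff]
  refine forall₂_congr fun e he => ?_
  split_ifs <;> simp_all

/-- suppression of a degree two root -/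
lemma QN.supp {P : Finset V} {w : V} (hQ : G.QN P w) (h2 : G.bt P {w} = 2) (hc : 2 ≤ #P) (q : ℝ) :
    ∃ G2 : Gr V E, G2.Cub P ∧ #G2.F + 1 = #G.F ∧ G2.ph q = G.ph q := by
  have hbte : #(G.bte P {w}) = 2 := by
    rw [← bt_eq_card G (by simpa using hQ.wP), h2]
  obtain ⟨e1, e2, he12, hbe⟩ := card_eq_two.1 hbte
  have hm : ∀ e, e ∈ G.bte P {w} ↔ e = e1 ∨ e = e2 := by intro e; rw [hbe]; simp
  have main : ∀ e ∈ G.bte P {w}, ∃ r ∈ P, (G.s e = w ∧ G.t e = r) ∨ (G.s e = r ∧ G.t e = w) := by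
    intro e he
    have := (G.mem_bte.1 he).2
    simp only [mem_singleton] at this
    rcases this with ⟨a, b⟩ | ⟨a, b⟩
    · exact ⟨_, a, Or.inr ⟨rfl, b⟩⟩
    · exact ⟨_, b, Or.inl ⟨a, rfl⟩⟩
  obtain ⟨r, hr, hr1⟩ := main e1 ((hm e1).2 (Or.inl rfl))
  obtain ⟨r', hr', hr2⟩ := main e2 ((hm e2).2 (Or.inr rfl))
  have he1F : e1 ∈ G.F := (G.mem_bte.1 ((hm e1).2 (Or.inl rfl))).1
  have he2F : e2 ∈ G.F := (G.mem_bte.1 ((hm e2).2 (Or.inr rfl))).1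
  have hrw : r ≠ w := fun hh => hQ.wP (hh ▸ hr)
  have hrw' : r' ≠ w := fun hh => hQ.wP (hh ▸ hr')
  have hone : ∀ v ∈ P, G.bt {v} {w} ≤ 1 := by
    intro v hv
    have a1 := hQ.deg v hv
    have a2 := hQ.sep2 {v} (by simpa using hv) (by simp) (by rintro rfl; simp at hc)
    omega
  have hrr : r ≠ r' := by
    rintro rfl
    have a1 := hone r hr
    rw [bt_eq_card G (by simpa using hrw)] at a1
    have : ({e1, e2} : Finset E) ⊆ G.bte {r} {w} := by
      intro e he
      simp only [mem_insert, mem_singleton] at he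
      rw [mem_bte]
      simp only [mem_singleton]
      rcases he with rfl | rfl <;> tauto
    have := card_le_card this
    rw [card_pair he12] at this
    omega
  have hedge : ∀ e ∈ G.F, G.s e = w ∨ G.t e = w → e = e1 ∨ e = e2 := by
    intro e he hh
    rw [← hm, mem_bte]
    refine ⟨he, ?_⟩
    have a1 := hQ.ends e he
    have a2 := hQ.nl e he
    simp only [mem_insert, mem_singleton] at a1 ⊢
    rcases hh with hh | hh
    · right; refine ⟨hh, a1.2.resolve_left fun h => a2 (hh.trans h.symm)⟩
    · left; refine ⟨a1.1.resolve_left fun h => a2 (h.trans hh.symm), hh⟩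
  set c := col {w} r with hcd
  have hcP : ∀ x ∈ P, c x = x := fun x hx => col_not (by simp; rintro rfl; exact hQ.wP hx)
  have hcw : c w = r := col_mem (by simp)
  have hg : G.Good c (G.F.erase e1) := by
    refine ⟨erase_subset _ _, fun e he he' => ?_⟩
    have : e = e1 := by simp [he] at he'; exact he'
    subst this
    rcases hr1 with ⟨a, b⟩ | ⟨a, b⟩ <;> rw [a, b, hcw, hcP r hr]
  have p0 : ∀ X ⊆ P, r ∉ X → pre c X = X := fun X hX hh =>
    pre_col_not hh (by intro x hx hh; rw [mem_singleton] at hh; rw [hh] at hx; exact hQ.wP (hX hx))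
  have p1 : ∀ X ⊆ P, r ∈ X → pre c X = insert w X := fun X hX hh => by
    rw [hcd, pre_col_mem hh]
    · ext x; simp
    · intro x hx hh; rw [mem_singleton] at hh; rw [hh] at hx; exact absurd (hX hx) hQ.wP
  have h0 : ∀ X ⊆ P, r ∉ X → (G.mp c (G.F.erase e1)).h P X = G.h P X + G.bt X {w} := by
    intro X hX hh
    rw [good_h hg, p0 X hX hh, p1 P Subset.rfl hr, h_insert hQ.wP hX]
  have h1 : ∀ X ⊆ P, r ∈ X → (G.mp c (G.F.erase e1)).h P X = G.h P (P \ X) + G.bt (P \ X) {w} := by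
    intro X hX hh
    rw [← h_compl _ hX]
    exact h0 _ sdiff_subset (by simp [hh])
  refine ⟨G.mp c (G.F.erase e1), ⟨?_, ?_, ?_, ?_⟩, ?_, ?_⟩
  · intro e he
    have key : ∀ x ∈ insert w P, c x ∈ P := by
      intro x hx
      rcases mem_insert.1 hx with rfl | hx
      · rw [hcw]; exact hr
      · rw [hcP x hx]; exact hx
    have := hQ.ends e (mem_of_mem_erase he)
    exact ⟨key _ this.1, key _ this.2⟩
  · intro e he
    show c (G.s e) ≠ c (G.t e)
    have a1 := hQ.ends e (mem_of_mem_erase he)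
    have a2 := hQ.nl e (mem_of_mem_erase he)
    by_cases hh : G.s e = w ∨ G.t e = w
    · have := (hedge e (mem_of_mem_erase he) hh).resolve_left (ne_of_mem_erase he)
      subst this
      rcases hr2 with ⟨a, b⟩ | ⟨a, b⟩
      · rw [a, b, hcw, hcP _ hr']; exact hrr
      · rw [a, b, hcw, hcP _ hr']; exact hrr.symm
    · push Not at hh
      rw [hcP _ (mem_of_mem_insert_of_ne a1.1 hh.1), hcP _ (mem_of_mem_insert_of_ne a1.2 hh.2)]
      exact a2
  · intro v hv
    by_cases hvr : r ∈ ({v} : Finset V)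
    · rw [h1 _ (by simpa using hv) hvr, h_compl _ (by simpa using hv)]
      have a1 := G.bt_split_left {w} (X := P) (Z := {v}) (by simpa using hv)
      have a2 : 1 ≤ G.bt {v} {w} := by
        rw [mem_singleton] at hvr
        subst hvr
        by_contra hh
        have := (bt_zero_iff.1 (show G.bt {r} {w} = 0 by omega)) e1 he1F
        simp only [mem_singleton] at this
        tauto
      have a3 := hone v hv
      have a4 := hQ.deg v hv
      omega
    · rw [h0 _ (by simpa using hv) hvr]
      exact hQ.deg v hv
  · intro X hX hn hne
    by_cases hX' : r ∈ X
    · rw [h1 X hX hX']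
      refine hQ.cut3 _ sdiff_subset ?_ ?_
      · rw [sdiff_nonempty]; intro h; exact hne (Subset.antisymm hX h)
      · intro hh
        have : r ∈ P \ X := by rw [hh]; exact hr
        simp [hX'] at this
    · rw [h0 X hX hX']
      exact hQ.cut3 X hX hn hne
  · exact card_erase_add_one he1F
  · refine (G.ph_suppress q (e := e1) (f := e2) (v := w) (a := r) he1F he2F he12 hrw hr1 ?_ ?_).symm
    · rcases hr2 with ⟨a, b⟩ | ⟨a, b⟩
      · left; rw [a, b]; exact ⟨rfl, hrw'⟩
      · right; rw [a, b]; exact ⟨rfl, hrw'⟩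
    · intro e he n1 n2
      by_contra hh
      have := hedge e he (by tauto)
      tauto

end Gr

end Quasi

end CubicFlow

namespace CubicFlow

section Circ

variable {V E : Type} [Fintype V] [DecidableEq V] [DecidableEq E]

namespace Gr

variable {G : Gr V E}

/-- a weak version of a 2-separation -/
structure Sep0 (G : Gr V E) (P : Finset V) (w : V) (S T : Finset V) : Prop where
  near : G.Near P w
  un : P = S ∪ T
  dj : Disjoint S T
  nT : T.Nonempty
  b : G.bt S T = 2
  mid : ∀ X ⊆ S, X.Nonempty → G.bt X {w} = 0 → G.h P (S \ X) = 2 → (S \ X).Nonempty → False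

lemma Sep.to0 {P S T : Finset V} {w : V} (h : G.Sep P w S T) : G.Sep0 P w S T :=
  ⟨h.near, h.un, h.dj, card_pos.1 (by have := h.cT; omega), h.b,
    fun X h1 h2 h3 h4 h5 => h.mid h1 h2 h3 h4 h5⟩

lemma Sep0.SP {P S T : Finset V} {w : V} (h : G.Sep0 P w S T) : S ⊆ P := by
  rw [h.un]; exact subset_union_left

lemma Sep0.TP {P S T : Finset V} {w : V} (h : G.Sep0 P w S T) : T ⊆ P := by
  rw [h.un]; exact subset_union_right

lemma Sep0.wS {P S T : Finset V} {w : V} (h : G.Sep0 P w S T) : w ∉ S := fun hh => h.near.wP (h.SP hh)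

lemma Sep0.wT {P S T : Finset V} {w : V} (h : G.Sep0 P w S T) : w ∉ T := fun hh => h.near.wP (h.TP hh)

lemma Sep0.SneP {P S T : Finset V} {w : V} (h : G.Sep0 P w S T) {X : Finset V} (hX : X ⊆ S) : X ≠ P := by
  rintro rfl
  obtain ⟨t, ht⟩ := h.nT
  exact disjoint_left.1 h.dj (hX (h.TP ht)) ht

lemma Sep0.ends {P S T : Finset V} {w : V} (h : G.Sep0 P w S T) {e : E} (he : e ∈ G.F) :
    (G.s e = w ∨ G.s e ∈ S ∨ G.s e ∈ T) ∧ (G.t e = w ∨ G.t e ∈ S ∨ G.t e ∈ T) := by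
  have := h.near.ends e he
  rw [h.un] at this
  simpa using this

lemma Sep0.hP {P S T : Finset V} {w : V} (h : G.Sep0 P w S T) {X : Finset V} (hX : X ⊆ S) :
    G.h P X = G.bt X (S \ X) + G.bt X T := by
  have hd := disjoint_left.1 h.dj
  rw [← bt_union_right]
  · unfold Gr.h; congr 1; rw [h.un]; ext x; simp only [mem_sdiff, mem_union]
    have := @hX x; have := @hd x; tauto
  · exact h.dj.mono_left sdiff_subset

set_option maxHeartbeats 2000000 in
lemma Sep0.circ {P S T : Finset V} {w a : V} (h : G.Sep0 P w S T) (ha : a ∈ S) {f : E} (hfF : f ∈ G.F)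
    (hf : (G.s f = a ∧ G.t f ∈ T) ∨ (G.s f ∈ T ∧ G.t f = a)) (h1 : G.bt {a} T = 1) :
    (G.mp (col T a) ((G.tou S).erase f)).QN S w ∧
    (G.mp (col T a) ((G.tou S).erase f)).bt S {w} = G.bt S {w} ∧
    (∀ X ⊆ S, ∀ Z ⊆ S, Disjoint X Z → (G.mp (col T a) ((G.tou S).erase f)).bt X Z =
      G.bt (pre (col T a) X) (pre (col T a) Z)) ∧
    (∀ X ⊆ S, (G.mp (col T a) ((G.tou S).erase f)).bt X {w} = G.bt X {w}) ∧
    (∀ X ⊆ S, a ∉ X → (G.mp (col T a) ((G.tou S).erase f)).h S X = G.h P X) := by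
  have hd := disjoint_left.1 h.dj
  have hwS := h.wS
  have hwT := h.wT
  have haT : a ∉ T := hd ha
  have hwa : w ≠ a := fun hh => hwS (hh ▸ ha)
  set F' := (G.tou S).erase f with hF'
  set c := col T a with hc0
  set F0 := G.F \ (G.bte T {w}) with hF0
  set G1 := G.mp c F' with hG1
  have hcn : ∀ x, x ∉ T → c x = x := fun x hx => col_not hx
  have hcw : c w = w := col_not hwT
  have hc : ∀ x ∈ S, c x = x := fun x hx => col_not (hd hx)
  have hcT : ∀ x ∈ T, c x = a := fun x hx => col_mem hx
  have hg : (G.del F0).Good c F' := by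
    constructor
    · intro e he
      have he := mem_of_mem_erase he
      simp only [tou, mem_filter] at he
      simp only [del, hF0, mem_sdiff, mem_bte, mem_singleton]
      refine ⟨he.1, ?_⟩
      rintro ⟨-, ⟨h1, h2⟩ | ⟨h1, h2⟩⟩
      · rcases he.2 with h3 | h3
        · exact hd h3 h1
        · exact hwS (h2 ▸ h3)
      · rcases he.2 with h3 | h3
        · exact hwS (h1 ▸ h3)
        · exact hd h3 h2
    · intro e he he'
      show c (G.s e) = c (G.t e)
      by_cases hef : e = f
      · subst hef
        rcases hf with ⟨x, y⟩ | ⟨x, y⟩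
        · rw [hcT _ y, x, hc a ha]
        · rw [hcT _ x, y, hc a ha]
      simp only [del, hF0, mem_sdiff, mem_bte, mem_singleton] at he
      simp only [hF', mem_erase, tou, mem_filter, not_and] at he'
      have h1 := h.ends he.1
      have h2 := h.near.nl e he.1
      have h3 := he' hef he.1
      have hs : G.s e ∈ T := by
        rcases h1 with ⟨a | a | a, b | b | b⟩ <;> first | assumption | tauto | exact absurd (a.trans b.symm) h2
      have ht : G.t e ∈ T := by
        rcases h1 with ⟨a | a | a, b | b | b⟩ <;> first | assumption | tauto | exact absurd (a.trans b.symm) h2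
      rw [hcT _ hs, hcT _ ht]
  have hwpre : ∀ X ⊆ S, w ∉ pre c X := by
    intro X hX hh; rw [mem_pre, hcw] at hh; exact hwS (hX hh)
  have hb : ∀ X ⊆ S, ∀ Z ⊆ S, Disjoint X Z → G1.bt X Z = G.bt (pre c X) (pre c Z) := by
    intro X hX Z hZ hXZ
    have := good_bt hg hXZ
    refine this.trans (del_bt sdiff_subset fun e he he' => ?_)
    simp only [hF0, mem_sdiff, not_and, not_not] at he'
    have := (he' he)
    rw [mem_bte] at this
    have h1 := hwpre X hX
    have h2 := hwpre Z hZ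
    rcases this.2 with ⟨a, b⟩ | ⟨a, b⟩
    · rw [mem_singleton] at b; rw [b]; tauto
    · rw [mem_singleton] at a; rw [a]; tauto
  have p0 : ∀ X ⊆ S, a ∉ X → pre c X = X := fun X hX hh =>
    pre_col_not hh fun x hx => hd (hX hx)
  have p1 : ∀ X ⊆ S, a ∈ X → pre c X = X ∪ T := fun X hX hh =>
    pre_col_mem hh fun x hx hx' => absurd hx' (hd (hX hx))
  have pw : pre c {w} = {w} := pre_col_not (by simpa using hwa.symm) (by simpa using hwT)
  have pP : pre c S = P := by rw [p1 S Subset.rfl ha, h.un]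
  have hbS : ∀ X ⊆ S, (G.del F0).bt X {w} = G.bt X {w} := by
    intro X hX
    refine del_bt sdiff_subset fun e he he' => ?_
    simp only [hF0, mem_sdiff, not_and, not_not] at he'
    have := (he' he)
    rw [mem_bte] at this
    have h1 : w ∉ X := fun hh => hwS (hX hh)
    rcases this.2 with ⟨a, b⟩ | ⟨a, b⟩
    · rw [mem_singleton] at b; rw [b]
      exact ⟨fun hh => hd (hX hh.1) a, fun hh => h1 hh.2⟩
    · rw [mem_singleton] at a; rw [a]
      exact ⟨fun hh => h1 hh.1, fun hh => hd (hX hh.2) b⟩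
  have hbT : (G.del F0).bt T {w} = 0 := by
    rw [bt_zero_iff]
    intro e he
    simp only [del, hF0, mem_sdiff, mem_bte] at he
    constructor
    · intro hh; exact he.2 ⟨he.1, Or.inl hh⟩
    · intro hh; exact he.2 ⟨he.1, Or.inr hh⟩
  have hw : ∀ X ⊆ S, G1.bt X {w} = G.bt X {w} := by
    intro X hX
    have := good_bt hg (X := X) (Y := {w}) (by simpa using fun hh => hwS (hX hh))
    by_cases haX : a ∈ X
    · rw [p1 X hX haX, pw, bt_union_left _ (h.dj.mono_left hX), hbS X hX, hbT] at this
      exact this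
    · rw [p0 X hX haX, pw, hbS X hX] at this
      exact this
  have hh : ∀ X ⊆ S, G1.h S X = G.h P (pre c X) := by
    intro X hX
    have : G1.h S X = G1.bt X (S \ X) := rfl
    rw [this, hb X hX _ sdiff_subset disjoint_sdiff, pre_sdiff, pP]; rfl
  have hh0 : ∀ X ⊆ S, a ∉ X → G1.h S X = G.h P X := by
    intro X hX haX; rw [hh X hX, p0 X hX haX]
  have hh1 : ∀ X ⊆ S, a ∈ X → G1.h S X = G.h P (S \ X) := by
    intro X hX haX
    rw [← h_compl _ hX, hh0 _ sdiff_subset (by simp [haX])]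
  have hTS : G.bt T (S \ {a}) = 1 := by
    have a1 := G.bt_split T (Y := S) (Z := {a}) (by simpa using ha)
    rw [bt_comm, h.b, G.bt_comm T {a}, h1] at a1
    omega
  have hdega : G1.h S {a} + G1.bt {a} {w} = 3 := by
    rw [hw _ (by simpa using ha), hh1 _ (by simpa using ha) (by simp), h.hP sdiff_subset,
      Finset.sdiff_sdiff_eq_self (by simpa using ha)]
    have a2 := h.near.deg a (h.SP ha)
    rw [h.hP (by simpa using ha)] at a2
    rw [G.bt_comm _ T, hTS, bt_comm]
    omega
  refine ⟨⟨hwS, ?_, ?_, ?_, ?_, ?_⟩, hw S Subset.rfl, hb, hw, hh0⟩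
  · intro e he
    have he' : e ∈ G.F := (sdiff_subset (hg.1 he))
    have key : ∀ x, (x = w ∨ x ∈ S ∨ x ∈ T) → c x ∈ insert w S := by
      rintro x (rfl | hx | hx)
      · rw [hcw]; simp
      · rw [hc x hx]; simp [hx]
      · rw [hcT x hx]; simp [ha]
    exact ⟨key _ (h.ends he').1, key _ (h.ends he').2⟩
  · intro e he
    show c (G.s e) ≠ c (G.t e)
    have he2 : e ∈ G.F := (sdiff_subset (hg.1 he))
    have hef : e ≠ f := ne_of_mem_erase he
    have h2 := h.near.nl e he2
    have htou := (mem_filter.1 (mem_of_mem_erase he)).2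
    have key : ¬ ((G.s e = a ∧ G.t e ∈ T) ∨ (G.s e ∈ T ∧ G.t e = a)) := by
      intro hh
      have : ({e, f} : Finset E) ⊆ G.bte {a} T := by
        intro e' he'
        simp only [mem_insert, mem_singleton] at he'
        rw [mem_bte]
        simp only [mem_singleton]
        rcases he' with rfl | rfl
        · exact ⟨he2, hh⟩
        · exact ⟨hfF, hf⟩
      have := card_le_card this
      rw [card_pair hef, ← bt_eq_card G (by simpa using haT), h1] at this
      omega
    by_cases x : G.s e ∈ T
    · by_cases y : G.t e ∈ T
      · have := hd (a := G.s e); have := hd (a := G.t e); tauto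
      · rw [hcT _ x, hcn _ y]; intro hh; exact key (Or.inr ⟨x, hh.symm⟩)
    · by_cases y : G.t e ∈ T
      · rw [hcT _ y, hcn _ x]; intro hh; exact key (Or.inl ⟨hh, y⟩)
      · rw [hcn _ x, hcn _ y]; exact h2
  · intro v hv
    by_cases hva : v = a
    · subst hva; exact hdega
    · rw [hh0 _ (by simpa using hv) (by simpa using Ne.symm hva), hw _ (by simpa using hv)]
      exact h.near.deg v (h.SP hv)
  · intro X hX hn hne
    rw [hw X hX]
    by_cases haX : a ∈ X
    · rw [hh1 X hX haX]
      have hn' : (S \ X).Nonempty := by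
        rw [sdiff_nonempty]; intro h; exact hne (Subset.antisymm hX h)
      have a1 := h.near.sep2 (S \ X) (sdiff_subset.trans h.SP) hn' (h.SneP sdiff_subset)
      by_contra hlt
      exact h.mid X hX hn (by omega) (by omega) hn'
    · rw [hh0 X hX haX]
      exact h.near.cut3 X (hX.trans h.SP) hn
  · intro X hX hn hne
    rw [hh X hX]
    refine h.near.sep2 _ (by rw [← pP]; exact pre_mono hX) (pre_nonempty hc hX hn) ?_
    rw [← pP]; exact pre_ne hc hX hne

set_option maxHeartbeats 1000000 in
lemma Sep.circ {P S T : Finset V} {w a : V} (h : G.Sep P w S T) (ha : a ∈ S) {f : E} (hfF : f ∈ G.F)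
    (hf : (G.s f = a ∧ G.t f ∈ T) ∨ (G.s f ∈ T ∧ G.t f = a)) (h1 : G.bt {a} T = 1) :
    (G.mp (col T a) ((G.tou S).erase f)).QN S w ∧
    (G.mp (col T a) ((G.tou S).erase f)).bt S {w} = G.bt S {w} ∧
    ¬ (G.mp (col T a) ((G.tou S).erase f)).Bad S w := by
  obtain ⟨hQ, hwS, hb, hw, hh0⟩ := h.to0.circ ha hfF hf h1
  refine ⟨hQ, hwS, ?_⟩
  have hd := disjoint_left.1 h.dj
  set c := col T a with hc0
  set G1 := G.mp c ((G.tou S).erase f) with hG1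
  have hc : ∀ x ∈ S, c x = x := fun x hx => col_not (hd hx)
  have p0 : ∀ X ⊆ S, a ∉ X → pre c X = X := fun X hX hh =>
    pre_col_not hh fun x hx => hd (hX hx)
  have p1 : ∀ X ⊆ S, a ∈ X → pre c X = X ∪ T := fun X hX hh =>
    pre_col_mem hh fun x hx hx' => absurd hx' (hd (hX hx))
  have pP : pre c S = P := by rw [p1 S Subset.rfl ha, h.un]
  rintro ⟨Y, hY, hYn, hYw, l, hA⟩
  rw [hw Y hY] at hYw
  have hYT : Disjoint Y T := h.dj.mono_left hY
  have hYT' := disjoint_left.1 hYT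
  by_cases haY : a ∈ Y
  swap
  · refine h.nbad ⟨Y, hY.trans h.SP, hYn, hYw, l ∘ c, ?_⟩
    have := arms_pull (G := G) hc hY hb hA
    rwa [pP, p0 Y hY haY] at this
  obtain ⟨hA1, i, j, hij, hi, hj⟩ := hA
  have harmS : ∀ k, arm S Y l k ⊆ S := fun k => arm_subset _ _ _ _
  have harmY : ∀ k, Disjoint (arm S Y l k) Y := by
    intro k; rw [disjoint_left]; intro x hx; exact (mem_sdiff.1 (mem_filter.1 hx).1).2
  have haarm : ∀ k, a ∉ arm S Y l k := fun k hk => disjoint_left.1 (harmY k) hk haY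
  have hA2 : ∀ k, (arm S Y l k).Nonempty → 2 ≤ #(arm S Y l k) ∧
      G.bt (arm S Y l k) Y + G.bt (arm S Y l k) T = 2 ∧
      G.bt (arm S Y l k) (S \ (Y ∪ arm S Y l k)) = 0 := by
    intro k hk
    obtain ⟨b1, b2, b3⟩ := hA1 k hk
    rw [hb _ (harmS k) _ hY (harmY k), p0 _ (harmS k) (haarm k), p1 _ hY haY,
      bt_union_right _ _ hYT] at b2
    rw [hb _ (harmS k) _ sdiff_subset (by rw [disjoint_left]; intro x hx; simp [hx]),
      p0 _ (harmS k) (haarm k), p0 _ sdiff_subset (by simp [haY])] at b3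
    exact ⟨b1, b2, b3⟩
  have hSY : G.bt T (S \ Y) + G.bt T Y = 2 := by
    have := G.bt_split T hY
    rw [bt_comm, h.b] at this; omega
  have hTY1 : 1 ≤ G.bt T Y := by
    have := G.bt_mono_left (A := {a}) (B := Y) (by simpa using haY) T
    rw [h1, bt_comm] at this; exact this
  rcases Nat.eq_zero_or_pos (G.bt T (S \ Y)) with hz | hpos
  · -- the set `T` is an additional arm
    have hTarm : ∀ k, G.bt (arm S Y l k) T = 0 := by
      intro k
      have := G.bt_mono_left (A := arm S Y l k) (B := S \ Y)
        (fun x hx => (mem_filter.1 hx).1) T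
      rw [G.bt_comm _ T, G.bt_comm _ T, hz] at this
      rw [bt_comm]; omega
    set l' : V → ℕ := fun x => if x ∈ T then 0 else l x + 1 with hl'
    have e0 : arm P Y l' 0 = T := by
      ext x
      simp only [arm, mem_filter, mem_sdiff, hl', h.un, mem_union]
      have := hYT' (a := x)
      by_cases hx : x ∈ T <;> simp [hx] <;> grind only
    have e1 : ∀ k, arm P Y l' (k + 1) = arm S Y l k := by
      intro k
      ext x
      simp only [arm, mem_filter, mem_sdiff, hl', h.un, mem_union]
      by_cases hx : x ∈ T
      · have := hd (a := x); simp [hx]; grind only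
      · simp [hx]
    refine h.nbad ⟨Y, hY.trans h.SP, hYn, hYw, l', ?_, i + 1, j + 1, by omega, ?_, ?_⟩
    · intro k hk
      rcases k with _ | k
      · rw [e0] at hk ⊢
        refine ⟨h.cT, by omega, ?_⟩
        have : P \ (Y ∪ T) = S \ Y := by
          ext x; rw [h.un]; simp only [mem_sdiff, mem_union]
          have := hd (a := x); grind only
        rw [this, hz]
      · rw [e1] at hk ⊢
        obtain ⟨b1, b2, b3⟩ := hA2 k hk
        refine ⟨b1, by have := hTarm k; omega, ?_⟩
        have : P \ (Y ∪ arm S Y l k) = S \ (Y ∪ arm S Y l k) ∪ T := by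
          ext x; rw [h.un]; simp only [mem_sdiff, mem_union]
          have := hd (a := x); have : x ∈ Y → x ∈ S := fun hh => hY hh; have : x ∈ arm S Y l k → x ∈ S := fun hh => harmS k hh; grind only
        rw [this, bt_union_right _ _ (h.dj.mono_left sdiff_subset), b3, hTarm k]
    · rw [e1]; exact hi
    · rw [e1]; exact hj
  · -- the set `T` is merged with the arm attached to it
    obtain ⟨e, he, hbe⟩ := exists_edge hpos
    obtain ⟨b, hbS, hbb⟩ : ∃ b ∈ S \ Y, 0 < G.bt {b} T := by
      rcases hbe with ⟨x, y⟩ | ⟨x, y⟩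
      · refine ⟨_, y, ?_⟩
        by_contra hcon
        have := (bt_zero_iff.1 (show G.bt {G.t e} T = 0 by omega) e he).2
        simp [x] at this
      · refine ⟨_, x, ?_⟩
        by_contra hcon
        have := (bt_zero_iff.1 (show G.bt {G.s e} T = 0 by omega) e he).1
        simp [y] at this
    have hbarm : b ∈ arm S Y l (l b) := mem_filter.2 ⟨hbS, rfl⟩
    have hbT : 1 ≤ G.bt (arm S Y l (l b)) T :=
      hbb.trans_le (G.bt_mono_left (by simpa using hbarm) T)
    have hsp : G.bt (S \ Y) T = G.bt (arm S Y l (l b)) T + G.bt ((S \ Y) \ arm S Y l (l b)) T :=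
      G.bt_split_left T (filter_subset _ _)
    rw [G.bt_comm _ T] at hsp
    have hrest : G.bt ((S \ Y) \ arm S Y l (l b)) T = 0 := by omega
    have hTarm : ∀ k, k ≠ l b → G.bt (arm S Y l k) T = 0 := by
      intro k hk
      have := G.bt_mono_left (A := arm S Y l k) (B := (S \ Y) \ arm S Y l (l b)) (by
        intro x hx
        have hx' := mem_filter.1 hx
        rw [mem_sdiff]
        refine ⟨hx'.1, fun hh => hk ?_⟩
        rw [← hx'.2, (mem_filter.1 hh).2]) T
      omega
    set l' : V → ℕ := fun x => if x ∈ T then l b else l x with hl'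
    have e0 : arm P Y l' (l b) = arm S Y l (l b) ∪ T := by
      ext x
      simp only [arm, mem_filter, mem_sdiff, hl', h.un, mem_union]
      have := hYT' (a := x)
      by_cases hx : x ∈ T <;> simp [hx] <;> grind only
    have e1 : ∀ k, k ≠ l b → arm P Y l' k = arm S Y l k := by
      intro k hk
      ext x
      simp only [arm, mem_filter, mem_sdiff, hl', h.un, mem_union]
      by_cases hx : x ∈ T
      · have := hd (a := x); simp [hx, hk.symm]; grind only
      · simp [hx]
    have hdj : ∀ k, Disjoint (arm S Y l k) T := fun k => h.dj.mono_left (harmS k)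
    have hne : ∀ k, (arm S Y l k).Nonempty → (arm P Y l' k).Nonempty := by
      intro k hk
      by_cases hkb : k = l b
      · rw [hkb, e0]; rw [hkb] at hk; exact hk.mono subset_union_left
      · rw [e1 k hkb]; exact hk
    refine h.nbad ⟨Y, hY.trans h.SP, hYn, hYw, l', ?_, i, j, hij, hne i hi, hne j hj⟩
    intro k hk
    by_cases hkb : k = l b
    · rw [hkb, e0]
      obtain ⟨b1, b2, b3⟩ := hA2 (l b) ⟨b, hbarm⟩
      refine ⟨b1.trans (card_le_card subset_union_left), ?_, ?_⟩
      · rw [bt_union_left _ (hdj _)]; omega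
      · have : P \ (Y ∪ (arm S Y l (l b) ∪ T)) = (S \ Y) \ arm S Y l (l b) := by
          ext x; rw [h.un]; simp only [mem_sdiff, mem_union]
          have := hd (a := x); have : x ∈ arm S Y l (l b) → x ∈ S := fun hh => harmS (l b) hh; grind only
        rw [this, bt_union_left _ (hdj _), G.bt_comm T, hrest, sdiff_sdiff_left]
        exact b3
    · rw [e1 k hkb] at hk ⊢
      obtain ⟨b1, b2, b3⟩ := hA2 k hk
      have hz := hTarm k hkb
      refine ⟨b1, by omega, ?_⟩
      have : P \ (Y ∪ arm S Y l k) = S \ (Y ∪ arm S Y l k) ∪ T := by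
        ext x; rw [h.un]; simp only [mem_sdiff, mem_union]
        have := hd (a := x); have : x ∈ Y → x ∈ S := fun hh => hY hh; have : x ∈ arm S Y l k → x ∈ S := fun hh => harmS k hh; grind only
      rw [this, bt_union_right _ _ (h.dj.mono_left sdiff_subset), b3, hz]

end Gr

end Circ

end CubicFlow

namespace CubicFlow

section Step2c

variable {V E : Type} [Fintype V] [DecidableEq V] [DecidableEq E]

namespace Gr

variable {G : Gr V E}

lemma Sep.tou_card {P S T : Finset V} {w : V} (h : G.Sep P w S T) :
    #(G.tou S) + #(G.tou T) = #G.F + 2 := by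
  have hd := disjoint_left.1 h.dj
  rw [← card_union_add_card_inter, ← h.b, bt_eq_card G h.dj]
  congr 2
  · ext e
    simp only [tou, mem_union, mem_filter]
    constructor
    · rintro (x | x) <;> exact x.1
    · intro he
      have h1 := h.ends he
      have h2 := h.near.nl e he
      rcases h1 with ⟨a | a | a, b | b | b⟩ <;> first | exact absurd (a.trans b.symm) h2 | grind only
  · ext e
    simp only [tou, mem_inter, mem_filter, mem_bte]
    have := hd (a := G.s e)
    have := hd (a := G.t e)
    grind only

lemma Sep.tou_ge {P S T : Finset V} {w : V} (h : G.Sep P w S T) : 4 ≤ #(G.tou S) := by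
  have hd := disjoint_left.1 h.dj
  have hwT := h.wT
  have hwS := h.wS
  have h1 := h.b
  have h2 := h.dS
  rw [bt_eq_card G h.dj] at h1
  rw [bt_eq_card G (by simpa using hwS)] at h2
  have hdj : Disjoint (G.bte S T) (G.bte S {w}) := by
    rw [disjoint_left]
    intro e
    simp only [mem_bte, mem_singleton]
    have := hd (a := G.s e)
    have := hd (a := G.t e)
    rintro ⟨-, ⟨a, b⟩ | ⟨a, b⟩⟩ ⟨-, ⟨c, d⟩ | ⟨c, d⟩⟩
    · exact hwT (d ▸ b)
    · tauto
    · tauto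
    · exact hwT (c ▸ a)
  have : G.bte S T ∪ G.bte S {w} ⊆ G.tou S := by
    intro e
    simp only [mem_union, mem_bte, tou, mem_filter]
    grind only
  have := card_le_card this
  rw [card_union_of_disjoint hdj] at this
  omega

lemma Sep.one_leg {P S T : Finset V} {w a : V} (h : G.Sep P w S T) (ha : a ∈ S)
    (h1 : 1 ≤ G.bt {a} T) : G.bt {a} T = 1 := by
  have a1 := G.bt_split_left T (X := S) (Z := {a}) (by simpa using ha)
  rw [h.b] at a1
  have a2 := h.near.deg a (h.SP ha)
  rw [h.hP (by simpa using ha)] at a2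
  have hn : (S \ {a}).Nonempty := by
    rw [← card_pos, card_sdiff_of_subset (by simpa using ha)]
    have := h.cS; simp; omega
  have a3 := h.near.sep2 (S \ {a}) (sdiff_subset.trans h.SP) hn (h.SneP sdiff_subset)
  rw [h.hP sdiff_subset, Finset.sdiff_sdiff_eq_self (by simpa using ha), G.bt_comm _ {a}] at a3
  omega

/-- the signs of the two graphs on the side of `S` -/
lemma Sep.half {q : ℝ} {P S T : Finset V} {w t0 : V} (h : G.Sep P w S T) (ht0 : t0 ∈ T) {f g eT : E}
    (hfg : f ≠ g) (hb : G.bte S T = {f, g}) (heT : eT ∈ G.bte T {w})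
    (IH : ∀ (G' : Gr V E) (P' : Finset V) (w' : V), #G'.F < #G.F → G'.Near P' w' → Pos q G' P') :
    0 < (-1 : ℝ) ^ (#(G.tou S) + #S) * (G.mp (col T t0) (insert eT (G.tou S))).ph q ∧
    0 < - ((-1 : ℝ) ^ (#(G.tou S) + #S) * (G.mp (col T t0) (G.tou S)).ph q) := by
  have hd := disjoint_left.1 h.dj
  have hwT := h.wT
  have hwS := h.wS
  have hcard := h.tou_card
  have hT4 := h.symm.tou_ge
  have htS : t0 ∉ S := fun hh => hd hh ht0
  constructor
  · have heTS : eT ∉ G.tou S := by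
      intro hh
      have h1 := (mem_filter.1 hh).2
      have h2 := (G.mem_bte.1 heT).2
      simp only [mem_singleton] at h2
      rcases h2 with ⟨a, b⟩ | ⟨a, b⟩
      · rcases h1 with x | x
        · exact hd x a
        · exact hwS (b ▸ x)
      · rcases h1 with x | x
        · exact hwS (a ▸ x)
        · exact hd x b
    have hcF : #(insert eT (G.tou S)) = #(G.tou S) + 1 := card_insert_of_notMem heTS
    have := IH _ _ _ (show #(insert eT (G.tou S)) < #G.F by rw [hcF]; omega) (h.hat ht0 heT)
    unfold Pos at this
    have e1 : #(G.mp (col T t0) (insert eT (G.tou S))).F + #(insert t0 S) = #(G.tou S) + #S + 2 := by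
      rw [card_insert_of_notMem htS]
      show #(insert eT (G.tou S)) + (#S + 1) = _
      omega
    rw [e1, pow_add _ _ 2] at this
    simpa using this
  · have hfm : f ∈ G.bte S T := by rw [hb]; simp
    have hgm : g ∈ G.bte S T := by rw [hb]; simp
    have hfF := (G.mem_bte.1 hfm).1
    have hgF := (G.mem_bte.1 hgm).1
    have hft : f ∈ G.tou S := by
      rw [tou, mem_filter]; refine ⟨hfF, ?_⟩
      have := (G.mem_bte.1 hfm).2; grind only
    have hgt : g ∈ G.tou S := by
      rw [tou, mem_filter]; refine ⟨hgF, ?_⟩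
      have := (G.mem_bte.1 hgm).2; grind only
    obtain ⟨a, ha, hf⟩ : ∃ a ∈ S, (G.s f = a ∧ G.t f ∈ T) ∨ (G.s f ∈ T ∧ G.t f = a) := by
      rcases (G.mem_bte.1 hfm).2 with ⟨x, y⟩ | ⟨x, y⟩
      · exact ⟨_, x, Or.inl ⟨rfl, y⟩⟩
      · exact ⟨_, y, Or.inr ⟨x, rfl⟩⟩
    have hone : G.bt {a} T = 1 := by
      apply h.one_leg ha
      by_contra hcon
      have := bt_zero_iff.1 (show G.bt {a} T = 0 by omega) f hfF
      simp only [mem_singleton] at this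
      tauto
    have hat : a ≠ t0 := fun hh => htS (hh ▸ ha)
    obtain ⟨hQ, hQw, hQb⟩ := h.circ ha hfF hf hone
    have hcomp : (G.mp (col T t0) (G.tou S)).mp (col {t0} a) ((G.mp (col T t0) (G.tou S)).F.erase f) =
        G.mp (col T a) ((G.tou S).erase f) := by
      have : ∀ x, col {t0} a (col T t0 x) = col T a x := by
        intro x
        by_cases hx : x ∈ T
        · rw [col_mem hx, col_mem hx, col_mem (by simp)]
        · rw [col_not hx, col_not hx, col_not]
          simp; rintro rfl; exact hx ht0
      simp only [mp]
      congr 1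
      · funext e; simp [this]
      · funext e; simp [this]
    have hsup : (G.mp (col T t0) (G.tou S)).ph q = (G.mp (col T a) ((G.tou S).erase f)).ph q := by
      rw [← hcomp]
      refine ph_suppress _ q (f := g) hft hgt hfg hat ?_ ?_ ?_
      · show (col T t0 (G.s f) = t0 ∧ col T t0 (G.t f) = a) ∨ (col T t0 (G.s f) = a ∧ col T t0 (G.t f) = t0)
        rcases hf with ⟨x, y⟩ | ⟨x, y⟩
        · right; rw [col_mem y, x, col_not (hd ha)]; simp
        · left; rw [col_mem x, y, col_not (hd ha)]; simp
      · show (col T t0 (G.s g) = t0 ∧ col T t0 (G.t g) ≠ t0) ∨ (col T t0 (G.t g) = t0 ∧ col T t0 (G.s g) ≠ t0)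
        rcases (G.mem_bte.1 hgm).2 with ⟨x, y⟩ | ⟨x, y⟩
        · right; rw [col_mem y, col_not (hd x)]; exact ⟨rfl, fun hh => htS (hh ▸ x)⟩
        · left; rw [col_mem x, col_not (hd y)]; exact ⟨rfl, fun hh => htS (hh ▸ y)⟩
      · intro e he n1 n2
        have he' := mem_filter.1 he
        have hnb : e ∉ G.bte S T := by rw [hb]; simp [n1, n2]
        have key : ∀ x, col T t0 x = t0 → x ∈ T := by
          intro x hx
          by_contra hxT
          rw [col_not hxT] at hx; exact hxT (hx ▸ ht0)
        rw [mem_bte] at hnb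
        constructor
        · intro hh
          have := key _ hh
          have := hd (a := G.s e)
          grind only
        · intro hh
          have := key _ hh
          have := hd (a := G.t e)
          grind only
    rw [hsup]
    have hcF : #((G.tou S).erase f) + 1 = #(G.tou S) := card_erase_add_one hft
    rcases Nat.lt_or_ge (G.bt S {w}) 3 with hlt | hge
    · have hd2 := h.dS
      obtain ⟨G2, hC, hc2, hp2⟩ := hQ.supp (by rw [hQw]; omega) h.cS q
      have hc2' : #G2.F + 1 = #((G.tou S).erase f) := hc2
      have hnear := hC.near ha
      have := IH _ _ _ (by omega) hnear
      unfold Pos at this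
      have e2 : #(S.erase a) + 1 = #S := card_erase_add_one ha
      rw [hp2] at this
      have e1 : #(G.tou S) + #S = #G2.F + #(S.erase a) + 2 + 1 := by omega
      rw [e1, pow_add _ _ 1, pow_add _ _ 2]
      simpa using this
    · have hnear := hQ.near (by rw [hQw]; exact hge) (fun _ => hQb)
      have := IH _ _ _ (show #((G.tou S).erase f) < #G.F by omega) hnear
      unfold Pos at this
      have e1 : #(G.tou S) + #S = #(G.mp (col T a) ((G.tou S).erase f)).F + #S + 1 := by
        show _ = #((G.tou S).erase f) + #S + 1
        omega
      rw [e1, pow_add _ _ 1]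
      simpa using this

/-- Step 2 -/
lemma Sep.pos {q : ℝ} (hq : 2 < q) {P S T : Finset V} {w : V} (h : G.Sep P w S T)
    (IH : ∀ (G' : Gr V E) (P' : Finset V) (w' : V), #G'.F < #G.F → G'.Near P' w' → Pos q G' P') :
    Pos q G P := by
  have hbc := h.b
  rw [bt_eq_card G h.dj] at hbc
  obtain ⟨f, g, hfg, hb⟩ := card_eq_two.1 hbc
  obtain ⟨s0, hs0⟩ : S.Nonempty := card_pos.1 (by have := h.cS; omega)
  obtain ⟨t0, ht0⟩ : T.Nonempty := card_pos.1 (by have := h.cT; omega)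
  have hS1 := h.dS
  have hT1 := h.dT
  rw [bt_eq_card G (by simpa using h.wS)] at hS1
  rw [bt_eq_card G (by simpa using h.wT)] at hT1
  obtain ⟨eS, heS⟩ : (G.bte S {w}).Nonempty := card_pos.1 (by omega)
  obtain ⟨eT, heT⟩ : (G.bte T {w}).Nonempty := card_pos.1 (by omega)
  have hb' : G.bte T S = {f, g} := by
    rw [← hb]; ext e; simp only [mem_bte]; grind only
  obtain ⟨a1, a2⟩ := h.half ht0 hfg hb heT IH
  obtain ⟨b1, b2⟩ := h.symm.half hs0 hfg hb' heS IH
  have hs := G.ph_sep q h.dj hs0 ht0 h.wS h.wT h.near.nl (by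
    intro e he
    have := h.ends he
    simp only [mem_union, mem_singleton]
    grind only) hfg hb heT heS
  have hcard := h.tou_card
  have hP : #P = #S + #T := by rw [h.un, card_union_of_disjoint h.dj]
  have hsign : (-1 : ℝ) ^ (#G.F + #P) = (-1 : ℝ) ^ (#(G.tou S) + #S) * (-1 : ℝ) ^ (#(G.tou T) + #T) := by
    rw [← pow_add]
    have : #(G.tou S) + #S + (#(G.tou T) + #T) = #G.F + #P + 2 := by omega
    rw [this, pow_add _ _ 2]; norm_num
  unfold Pos
  have hxy : 0 < (q - 1) * (q - 2) := by
    apply mul_pos <;> linarith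
  have h10 : 0 < (-1 : ℝ) ^ (#G.F + #P) * (((q - 1) * (q - 2)) * G.ph q) := by
    rw [hs, hsign]
    have m1 := mul_pos a1 b1
    have m2 := mul_pos (mul_pos a2 b2) (show 0 < q - 2 by linarith)
    refine lt_of_lt_of_eq (add_pos m1 m2) ?_
    ring
  have : (-1 : ℝ) ^ (#G.F + #P) * (((q - 1) * (q - 2)) * G.ph q) =
    ((-1 : ℝ) ^ (#G.F + #P) * G.ph q) * ((q - 1) * (q - 2)) := by ring
  rw [this] at h10
  exact (pos_iff_pos_of_mul_pos h10).2 hxy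

end Gr

end Step2c

end CubicFlow

namespace CubicFlow

section DelContr

variable {V E : Type} [Fintype V] [DecidableEq V] [DecidableEq E]

namespace Gr

variable {G : Gr V E}

/-- the edge `e` joins `v` and `w` -/
def Jn (G : Gr V E) (e : E) (v w : V) : Prop :=
  e ∈ G.F ∧ ((G.s e = v ∧ G.t e = w) ∨ (G.s e = w ∧ G.t e = v))

lemma exists_jn {v w : V} (h : 0 < G.bt {v} {w}) : ∃ e, G.Jn e v w := by
  obtain ⟨e, he, h⟩ := exists_edge h
  simp only [mem_singleton] at h
  exact ⟨e, he, h⟩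

lemma jn_unique {v w : V} (hvw : v ≠ w) (h1 : G.bt {v} {w} = 1) {e e' : E} (he : G.Jn e v w)
    (he' : G.Jn e' v w) : e' = e := by
  rw [bt_eq_card G (by simpa using hvw)] at h1
  refine card_le_one.1 h1.le e' ?_ e ?_
  · rw [mem_bte]; simpa using (id he' : _ ∧ _)
  · rw [mem_bte]; simpa using (id he : _ ∧ _)

lemma contract_good {v w : V} (hvw : v ≠ w) {e : E} (he : G.Jn e v w) :
    G.Good (col {v} w) (G.F.erase e) := by
  refine ⟨erase_subset _ _, fun f hf hf' => ?_⟩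
  have : f = e := by by_contra h; exact hf' (mem_erase.2 ⟨h, hf⟩)
  subst this
  rcases he.2 with ⟨a, b⟩ | ⟨a, b⟩
  · rw [a, b, col_mem (by simp), col_not (by simpa using hvw.symm)]
  · rw [a, b, col_mem (x := v) (by simp), col_not (by simpa using hvw.symm)]

lemma contract_near {P : Finset V} {v w : V} {e : E} (hN : G.Near P w) (hv : v ∈ P) (he : G.Jn e v w)
    (h1 : G.bt {v} {w} = 1)
    (hs : ∀ X ⊆ P.erase v, X.Nonempty → X ≠ P.erase v → 2 ≤ G.bt X (P.erase v \ X))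
    (nb : ∀ Y ⊆ P.erase v, Y.Nonempty → G.bt Y {w} = 0 → G.bt Y {v} = 0 → ∀ l, ¬ G.Arms (P.erase v) Y l) :
    (G.mp (col {v} w) (G.F.erase e)).Near (P.erase v) w := by
  have hvw : v ≠ w := fun h => hN.wP (h ▸ hv)
  have hg := contract_good hvw he
  have hwP1 : w ∉ P.erase v := fun h => hN.wP (mem_of_mem_erase h)
  have preX : ∀ X ⊆ P.erase v, pre (col {v} w) X = X := by
    intro X hX
    refine pre_col_not (fun h => hwP1 (hX h)) fun x hx hx' => ?_
    rw [mem_singleton] at hx'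
    exact (mem_erase.1 (hX hx)).1 hx'
  have prew : pre (col {v} w) {w} = {w} ∪ {v} := by
    refine pre_col_mem (by simp) ?_
    simp
  have hbt : ∀ X ⊆ P.erase v, ∀ Z ⊆ P.erase v, Disjoint X Z →
      (G.mp (col {v} w) (G.F.erase e)).bt X Z = G.bt X Z := by
    intro X hX Z hZ hd
    rw [good_bt hg hd, preX X hX, preX Z hZ]
  have hbw : ∀ X ⊆ P.erase v, (G.mp (col {v} w) (G.F.erase e)).bt X {w} = G.bt X {w} + G.bt X {v} := by
    intro X hX
    rw [good_bt hg (by simpa using fun h => hwP1 (hX h)), preX X hX, prew, bt_union_right]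
    simpa using hvw.symm
  have hh : ∀ X ⊆ P.erase v, (G.mp (col {v} w) (G.F.erase e)).h (P.erase v) X = G.bt X (P.erase v \ X) := by
    intro X hX
    exact hbt X hX _ sdiff_subset disjoint_sdiff
  have hP : ∀ X ⊆ P.erase v, G.h P X = G.bt X (P.erase v \ X) + G.bt X {v} := by
    intro X hX
    rw [← bt_union_right _ _ (by simp)]
    unfold h; congr 1; ext x
    simp only [mem_sdiff, mem_union, mem_erase, mem_singleton]
    have : x ∈ X → x ∈ P.erase v := fun hh => hX hh
    rw [mem_erase] at this
    by_cases hx : x = v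
    · subst hx; simp [hv]; tauto
    · simp [hx]
  have hsum : ∀ X ⊆ P.erase v, (G.mp (col {v} w) (G.F.erase e)).h (P.erase v) X +
      (G.mp (col {v} w) (G.F.erase e)).bt X {w} = G.h P X + G.bt X {w} := by
    intro X hX
    rw [hh X hX, hbw X hX, hP X hX]; ring
  refine ⟨hwP1, ?_, ?_, ?_, ?_, ?_, ?_⟩
  · intro f hf
    have hf' : f ∈ G.F := mem_of_mem_erase hf
    have h2 := hN.ends f hf'
    show col {v} w (G.s f) ∈ _ ∧ col {v} w (G.t f) ∈ _
    simp only [col, mem_singleton, mem_insert, mem_erase] at h2 ⊢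
    constructor <;> split_ifs <;> tauto
  · intro f hf
    have hf0 : f ≠ e := ne_of_mem_erase hf
    have hf' : f ∈ G.F := mem_of_mem_erase hf
    have h2 := hN.nl f hf'
    show col {v} w (G.s f) ≠ col {v} w (G.t f)
    simp only [col, mem_singleton]
    intro h3
    refine hf0 (jn_unique hvw h1 he ⟨hf', ?_⟩)
    split_ifs at h3 <;> simp_all
  · intro x hx
    rw [hsum _ (by simpa using hx)]
    exact hN.deg x (mem_of_mem_erase hx)
  · intro X hX hn
    rw [hsum X hX]
    exact hN.cut3 X (hX.trans (erase_subset _ _)) hn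
  · intro X hX hn hne
    rw [hh X hX]
    exact hs X hX hn hne
  · rintro - ⟨Y, hY, hYn, hYw, l, hl⟩
    rw [hbw Y hY] at hYw
    have := arms_pull (G := G) (G1 := G.mp (col {v} w) (G.F.erase e)) (c := id) (P1 := P.erase v) (l := l)
      (by simp) hY (by
        intro X hX Z hZ hd
        rw [hbt X hX Z hZ hd]; simp [pre]) hl
    exact nb Y hY hYn (by omega) (by omega) l (by
      have e : ∀ X : Finset V, pre id X = X := fun X => by simp [pre]
      rw [e, e] at this; exact this)

lemma delete_qn (q : ℝ) {P : Finset V} {v w : V} {e : E} (hN : G.Near P w) (hv : v ∈ P) (he : G.Jn e v w)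
    (h1 : G.bt {v} {w} = 1) (hone : ∀ a ∈ P.erase v, G.bt {a} {v} ≤ 1)
    (mid : ∀ X ⊆ P.erase v, X.Nonempty → G.bt X {w} = 0 → G.h P (P.erase v \ X) = 2 →
      (P.erase v \ X).Nonempty → False) :
    ∃ G2 : Gr V E, G2.QN (P.erase v) w ∧ #G2.F + 2 = #G.F ∧ G2.ph q = (G.del (G.F.erase e)).ph q ∧
      G2.bt (P.erase v) {w} = G.bt (P.erase v) {w} ∧
      ((∀ A ⊆ P, 2 ≤ #A → 2 ≤ #(P \ A) → 3 ≤ G.h P A) → ¬ G2.Bad (P.erase v) w) := by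
  have hvw : v ≠ w := fun h => hN.wP (h ▸ hv)
  have hPv : P.erase v = P \ {v} := by rw [sdiff_singleton_eq_erase]
  have hb : G.bt (P.erase v) {v} = 2 := by
    have := hN.deg v hv
    unfold h at this
    rw [bt_comm, hPv]; omega
  have S0 : G.Sep0 P w (P.erase v) {v} :=
    ⟨hN, by rw [union_comm, ← insert_eq, insert_erase hv], by simp, by simp, hb, mid⟩
  have hbc := hb
  rw [bt_eq_card G (by simp)] at hbc
  obtain ⟨f, g, hfg, hbe⟩ := card_eq_two.1 hbc
  have hm : ∀ e', e' ∈ G.bte (P.erase v) {v} ↔ e' = f ∨ e' = g := by intro e'; rw [hbe]; simp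
  have hf := (hm f).2 (Or.inl rfl)
  have hgg := (hm g).2 (Or.inr rfl)
  simp only [mem_bte, mem_singleton] at hf hgg hm
  obtain ⟨hfF, hf⟩ := hf
  obtain ⟨hgF, hgg⟩ := hgg
  obtain ⟨a, ha, hfa⟩ : ∃ a ∈ P.erase v, (G.s f = a ∧ G.t f = v) ∨ (G.s f = v ∧ G.t f = a) := by
    rcases hf with hf | hf
    · exact ⟨_, hf.1, Or.inl ⟨rfl, hf.2⟩⟩
    · exact ⟨_, hf.2, Or.inr ⟨hf.1, rfl⟩⟩
  have hav : a ≠ v := (mem_erase.1 ha).1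
  have hwP1 : w ∉ P.erase v := fun h => hN.wP (mem_of_mem_erase h)
  have ha1 : G.bt {a} {v} = 1 := by
    have h2 := hone a ha
    have : 0 < G.bt {a} {v} := by
      rw [bt_eq_card G (by simpa using hav), card_pos]
      exact ⟨f, by rw [mem_bte]; simpa using ⟨hfF, hfa⟩⟩
    omega
  obtain ⟨hQ, hQw, hb2, -, hh⟩ := S0.circ ha hfF (by simpa using hfa) ha1
  have hte : G.tou (P.erase v) = G.F.erase e := by
    ext e'
    simp only [tou, mem_filter, mem_erase]
    constructor
    · rintro ⟨h2, h3⟩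
      refine ⟨?_, h2⟩
      rintro rfl
      have hNw := hN.wP
      rcases he.2 with ⟨x, y⟩ | ⟨x, y⟩ <;> simp only [x, y] at h3 <;> tauto
    · rintro ⟨h2, h3⟩
      refine ⟨h3, ?_⟩
      by_contra hcon
      push Not at hcon
      have h4 := hN.ends e' h3
      have h5 := hN.nl e' h3
      refine h2 (jn_unique hvw h1 he ⟨h3, ?_⟩)
      simp only [mem_insert] at h4
      grind only
  have hef : e ≠ f := by
    rintro rfl
    have h2 := he.2
    rcases h2 with ⟨x, y⟩ | ⟨x, y⟩ <;> rcases hfa with ⟨z, u⟩ | ⟨z, u⟩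
    · exact hav (z.symm.trans x)
    · exact hwP1 (by rw [← y, u]; exact ha)
    · exact hwP1 (by rw [← x, z]; exact ha)
    · exact hav (u.symm.trans y)
  have heg : e ≠ g := by
    rintro rfl
    have h2 := he.2
    have : v ∉ P.erase v := by simp
    rcases h2 with ⟨x, y⟩ | ⟨x, y⟩ <;> rw [x, y] at hgg <;> tauto
  have hsup := (G.del (G.F.erase e)).ph_suppress q (e := f) (f := g) (v := v) (a := a)
    (mem_erase.2 ⟨hef.symm, hfF⟩) (mem_erase.2 ⟨heg.symm, hgF⟩) hfg hav
    (by show (G.s f = v ∧ G.t f = a) ∨ (G.s f = a ∧ G.t f = v); tauto)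
    (by show (G.s g = v ∧ G.t g ≠ v) ∨ (G.t g = v ∧ G.s g ≠ v)
        have h2 := hN.nl g hgF
        rcases hgg with ⟨-, x⟩ | ⟨x, -⟩
        · right; exact ⟨x, fun hh => h2 (hh.trans x.symm)⟩
        · left; exact ⟨x, fun hh => h2 (x.trans hh.symm)⟩)
    (by
      intro e' he' h2 h3
      show G.s e' ≠ v ∧ G.t e' ≠ v
      have h4 : e' ≠ e := ne_of_mem_erase he'
      have h5 : e' ∈ G.F := mem_of_mem_erase he'
      have h6 := hN.ends e' h5
      have h7 := hN.nl e' h5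
      have h8 := mt (hm e').1 (by tauto)
      have h9 : ¬ ((G.s e' = v ∧ G.t e' = w) ∨ (G.s e' = w ∧ G.t e' = v)) :=
        fun hh => h4 (jn_unique hvw h1 he ⟨h5, hh⟩)
      simp only [mem_insert, mem_erase] at h6 h8
      grind only)
  refine ⟨_, hQ, ?_, ?_, hQw, ?_⟩
  · show #((G.tou (P.erase v)).erase f) + 2 = _
    rw [hte]
    have c1 := card_erase_of_mem he.1
    have c2 := card_erase_of_mem (mem_erase.2 ⟨hef.symm, hfF⟩ : f ∈ G.F.erase e)
    have : 0 < #(G.F.erase e) := card_pos.2 ⟨f, mem_erase.2 ⟨hef.symm, hfF⟩⟩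
    omega
  · rw [hsup, hte]; rfl
  · rintro hA ⟨Y, hY, hYn, hYw, l, harm, i, j, hij, hi, hj⟩
    have key : ∀ i j, i ≠ j → (arm (P.erase v) Y l i).Nonempty → (arm (P.erase v) Y l j).Nonempty →
        a ∉ arm (P.erase v) Y l i → False := by
      intro i j hij hi hj hai
      have hsub := arm_subset (P.erase v) Y l i
      obtain ⟨c1, c2, c3⟩ := harm i hi
      obtain ⟨d1, -, -⟩ := harm j hj
      have h3 := hh _ hsub hai
      have h4 : (G.mp (col {v} a) ((G.tou (P.erase v)).erase f)).h (P.erase v) (arm (P.erase v) Y l i) = 2 := by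
        unfold h
        rw [bt_split _ _ (Z := Y), c2]
        · have : (P.erase v \ arm (P.erase v) Y l i) \ Y = P.erase v \ (Y ∪ arm (P.erase v) Y l i) := by
            ext x; simp only [mem_sdiff, mem_union]; tauto
          rw [this, c3]
        · intro x hx
          rw [mem_sdiff]
          refine ⟨hY hx, fun hh => ?_⟩
          exact (mem_sdiff.1 (mem_filter.1 hh).1).2 hx
      have h5 := hA _ (hsub.trans (erase_subset _ _)) c1 (d1.trans (card_le_card ?_))
      · omega
      · intro x hx
        rw [mem_sdiff]
        refine ⟨mem_of_mem_erase (arm_subset _ _ _ _ hx), fun hx' => hij ?_⟩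
        rw [← (mem_filter.1 hx').2, ← (mem_filter.1 hx).2]
    by_cases hai : a ∈ arm (P.erase v) Y l i
    · refine key j i hij.symm hj hi fun haj => hij ?_
      rw [← (mem_filter.1 hai).2, ← (mem_filter.1 haj).2]
    · exact key i j hij hi hj hai

/-- signs in deletion-contraction -/
lemma dc_pos {q : ℝ} {P : Finset V} {v w : V} {e : E} (hvw : v ≠ w) (hv : v ∈ P) (he : G.Jn e v w)
    (h1 : Pos q (G.mp (col {v} w) (G.F.erase e)) (P.erase v))
    (h2 : (-1 : ℝ) ^ (#G.F + #P) * (G.del (G.F.erase e)).ph q < 0) : Pos q G P := by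
  unfold Pos at *
  rw [G.ph_dc q he.1 hvw he.2]
  have c1 : #(G.F.erase e) + 1 = #G.F := card_erase_add_one he.1
  have c2 : #(P.erase v) + 1 = #P := card_erase_add_one hv
  have e1 : #G.F + #P = #(G.mp (col {v} w) (G.F.erase e)).F + #(P.erase v) + 2 := by
    show _ = #(G.F.erase e) + #(P.erase v) + 2
    omega
  have e2 : (-1 : ℝ) ^ (#G.F + #P) = (-1 : ℝ) ^ (#(G.mp (col {v} w) (G.F.erase e)).F + #(P.erase v)) := by
    rw [e1, pow_add _ _ 2]; norm_num
  rw [← e2] at h1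
  rw [mul_sub]
  have h3 : (-1 : ℝ) ^ (#G.F + #P) * (⟨G.s, G.t, G.F.erase e⟩ : Gr V E).ph q < 0 := h2
  linarith

end Gr

end DelContr

end CubicFlow

namespace CubicFlow

section Step3

variable {V E : Type} [Fintype V] [DecidableEq V] [DecidableEq E]

namespace Gr

variable {G : Gr V E}

/-- no nontrivial 3-cuts, no nontrivial 2-separations, root degree at least four -/
structure St3 (G : Gr V E) (P : Finset V) (w : V) : Prop where
  near : G.Near P w
  d4 : 4 ≤ G.bt P {w}
  c4 : ∀ S ⊆ P, 2 ≤ #S → S ≠ P → 4 ≤ G.h P S + G.bt S {w}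
  h3 : ∀ A ⊆ P, 2 ≤ #A → 2 ≤ #(P \ A) → 3 ≤ G.h P A

/-- bad vertex -/
def BadAt (G : Gr V E) (P : Finset V) (w v : V) : Prop :=
  ∃ Y ⊆ P.erase v, Y.Nonempty ∧ G.bt Y {w} = 0 ∧ G.bt Y {v} = 0 ∧ ∃ l, G.Arms (P.erase v) Y l

lemma bt_le_of_one {X : Finset V} {w : V} (h : ∀ v ∈ X, G.bt {v} {w} ≤ 1) : G.bt X {w} ≤ #X := by
  rw [bt_sum]
  calc _ ≤ ∑ v ∈ X, 1 := sum_le_sum h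
    _ = _ := by simp

lemma h_pair {P : Finset V} {x y : V} (hx : x ∈ P) (hy : y ∈ P) (hxy : x ≠ y) :
    G.h P {x, y} + 2 * G.bt {x} {y} = G.h P {x} + G.h P {y} := by
  have := h_disj G (P := P) (A := {x}) (B := {y}) (by simpa using hx) (by simpa using hy) (by simpa using hxy)
  rwa [← insert_eq] at this

namespace St3

variable {P : Finset V} {w : V}


lemma one (hs : G.St3 P w) {v : V} (hv : v ∈ P) : G.bt {v} {w} ≤ 1 := by
  have h1 := hs.near.deg v hv
  have h2 := hs.near.sep2 {v} (by simpa using hv) (by simp) (by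
    rintro hh
    have := hs.d4
    rw [← hh] at this
    omega)
  omega

lemma P4 (hs : G.St3 P w) : 4 ≤ #P := hs.d4.trans (bt_le_of_one fun v hv => hs.one hv)

lemma ne_P (hs : G.St3 P w) {X : Finset V} (hX : #X < 4) : X ≠ P := by
  rintro rfl; have := hs.P4; omega

lemma nadj (hs : G.St3 P w) {x y : V} (hx : x ∈ P) (hy : y ∈ P) (hxy : x ≠ y) (h1 : G.bt {x} {w} = 1)
    (h2 : G.bt {y} {w} = 1) : G.bt {x} {y} = 0 := by
  have a1 := h_pair (G := G) hx hy hxy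
  have a2 := hs.near.deg x hx
  have a3 := hs.near.deg y hy
  have c := card_pair hxy
  have hsub : ({x, y} : Finset V) ⊆ P := by intro z; simp only [mem_insert, mem_singleton]; rintro (rfl | rfl) <;> assumption
  have a4 := hs.h3 {x, y} hsub (by omega) (by rw [card_sdiff_of_subset hsub]; have := hs.P4; omega)
  omega

lemma adj1 (hs : G.St3 P w) {x v : V} (hx : x ∈ P) (hv : v ∈ P) (hxv : x ≠ v) (h1 : G.bt {v} {w} = 1) :
    G.bt {x} {v} ≤ 1 := by
  have a1 := h_pair (G := G) hx hv hxv
  have a2 := hs.near.deg x hx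
  have a3 := hs.near.deg v hv
  have c := card_pair hxv
  have hsub : ({x, v} : Finset V) ⊆ P := by intro z; simp only [mem_insert, mem_singleton]; rintro (rfl | rfl) <;> assumption
  have a4 := hs.near.sep2 {x, v} hsub (by simp) (hs.ne_P (by omega))
  omega

lemma hP (hs : G.St3 P w) {v : V} (hv : v ∈ P) {X : Finset V} (hX : X ⊆ P.erase v) :
    G.h P X = G.bt X (P.erase v \ X) + G.bt X {v} := by
  rw [← bt_union_right _ _ (by simp)]
  unfold h; congr 1; ext x
  simp only [mem_sdiff, mem_union, mem_erase, mem_singleton]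
  have : x ∈ X → x ∈ P.erase v := fun hh => hX hh
  rw [mem_erase] at this
  by_cases hx : x = v
  · subst hx; simp [hv]; tauto
  · simp [hx]

lemma contract (hs : G.St3 P w) {v : V} {e : E} (hv : v ∈ P) (he : G.Jn e v w) (h1 : G.bt {v} {w} = 1)
    (hb : ¬ G.BadAt P w v) : (G.mp (col {v} w) (G.F.erase e)).Near (P.erase v) w := by
  refine contract_near hs.near hv he h1 ?_ ?_
  · have sing : ∀ x ∈ P.erase v, 2 ≤ G.bt {x} (P.erase v \ {x}) := by
      intro x hx
      have hx' := mem_erase.1 hx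
      have a1 := hs.hP hv (X := {x}) (by simpa using hx)
      have a2 := hs.adj1 hx'.2 hv hx'.1 h1
      have a3 := hs.near.sep2 {x} (by simpa using hx'.2) (by simp) (hs.ne_P (by simp))
      have a4 := hs.near.deg x hx'.2
      have a5 := hs.one hx'.2
      have a6 := hs.nadj hx'.2 hv hx'.1
      omega
    intro X hX hn hne
    have hR : (P.erase v \ X).Nonempty := by
      rw [sdiff_nonempty]; exact fun h => hne (Subset.antisymm hX h)
    have hRs : P.erase v \ X ⊆ P.erase v := sdiff_subset
    have hRR : P.erase v \ (P.erase v \ X) = X := Finset.sdiff_sdiff_eq_self hX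
    have hvX : v ∉ X := fun h => by simpa using hX h
    have b1 := hs.hP hv hX
    have b2 := hs.hP hv hRs
    rw [hRR, bt_comm G (P.erase v \ X) X] at b2
    have b3 : G.bt X {v} + G.bt (P.erase v \ X) {v} = 2 := by
      rw [← bt_split_left G _ hX]
      have := hs.near.deg v hv
      unfold h at this
      rw [bt_comm, ← sdiff_singleton_eq_erase]; omega
    rcases Nat.lt_or_ge #X 2 with c | c
    · obtain ⟨x, rfl⟩ := card_eq_one.1 (show #X = 1 by have := hn.card_pos; omega)
      exact sing x (by simpa using hX)
    rcases Nat.lt_or_ge #(P.erase v \ X) 2 with c' | c'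
    · obtain ⟨x, hx⟩ := card_eq_one.1 (show #(P.erase v \ X) = 1 by have := hR.card_pos; omega)
      have := sing x (by rw [← singleton_subset_iff, ← hx]; exact hRs)
      rw [← hx, hRR, bt_comm] at this
      exact this
    · have hXP : X ⊆ P := hX.trans (erase_subset _ _)
      have hRP : P.erase v \ X ⊆ P := hRs.trans (erase_subset _ _)
      have d1 := hs.h3 X hXP c (c'.trans (card_le_card (sdiff_subset_sdiff (erase_subset _ _) Subset.rfl)))
      have d2 := hs.h3 _ hRP c' (c.trans (card_le_card (by
        intro x hx; simp only [mem_sdiff]; exact ⟨hXP hx, by tauto⟩)))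
      omega
  · intro Y h2 h3 h4 h5 l h6
    exact hb ⟨Y, h2, h3, h4, h5, l, h6⟩

lemma pos_of (hs : G.St3 P w) {q : ℝ} {v : V} (hv : v ∈ P) (h1 : G.bt {v} {w} = 1) (hb : ¬ G.BadAt P w v)
    (IH : ∀ (G' : Gr V E) (P' : Finset V) (w' : V), #G'.F < #G.F → G'.Near P' w' → Pos q G' P') :
    Pos q G P := by
  obtain ⟨e, he⟩ := exists_jn (G := G) (v := v) (w := w) (by omega)
  have hvw : v ≠ w := fun h => hs.near.wP (h ▸ hv)
  have hcF := card_erase_add_one he.1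
  have hdv : G.bt (P.erase v) {w} + 1 = G.bt P {w} := by
    rw [bt_split_left G {w} (X := P) (Z := {v}) (by simpa using hv), sdiff_singleton_eq_erase]; omega
  have hd4 := hs.d4
  refine dc_pos hvw hv he (IH _ _ w ?_ (hs.contract hv he h1 hb)) ?_
  · show #(G.F.erase e) < _
    omega
  · obtain ⟨G2, hQ, hc, hph, hbw, hnb⟩ := delete_qn q hs.near hv he h1
      (fun a ha => hs.adj1 (mem_of_mem_erase ha) hv (ne_of_mem_erase ha) h1) (by
        intro X hX hn hw h2 hne
        have hRP : P.erase v \ X ⊆ P := sdiff_subset.trans (erase_subset _ _)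
        rcases Nat.lt_or_ge #(P.erase v \ X) 2 with c | c
        · have := bt_split_left G {w} hX
          have := bt_le_of_one (G := G) (X := P.erase v \ X) (w := w) (fun x hx => hs.one (hRP hx))
          omega
        · have := hs.h3 _ hRP c (by
            have hsub : insert v X ⊆ P \ (P.erase v \ X) := by
              intro x hx
              simp only [mem_sdiff, mem_insert, mem_erase] at *
              rcases hx with rfl | hx
              · tauto
              · exact ⟨mem_of_mem_erase (hX hx), by tauto⟩
            refine le_trans ?_ (card_le_card hsub)
            rw [card_insert_of_notMem (fun h => by simpa using hX h)]
            have := hn.card_pos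
            omega)
          omega)
    have hN2 := hQ.near (by omega) (fun _ => hnb hs.h3)
    have := IH _ _ _ (by omega) hN2
    unfold Pos at this
    rw [← hph]
    have e1 : #G.F + #P = #G2.F + #(P.erase v) + 3 := by
      have := card_erase_add_one hv
      omega
    rw [e1, pow_add _ _ 3]
    norm_num
    linarith

end St3

end Gr

end Step3

end CubicFlow

namespace CubicFlow

section Step3b

variable {V E : Type} [Fintype V] [DecidableEq V] [DecidableEq E]

namespace Gr

variable {G : Gr V E}

/-- ring structure of `P1` with respect to the vertices `N` -/
structure Ring (G : Gr V E) (P1 N : Finset V) (m : ℕ) (A Y B : Finset V) : Prop where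
  un : P1 = A ∪ Y ∪ B
  dAY : Disjoint A Y
  dAB : Disjoint A B
  dYB : Disjoint Y B
  cA : 2 ≤ #A
  cB : 2 ≤ #B
  nY : Y.Nonempty
  bAY : G.bt A Y = 2
  bBY : G.bt B Y = 2
  bAB : G.bt A B = 0
  nA : G.bt A N = m
  nB : G.bt B N = m
  nYN : G.bt Y N = 0

lemma Ring.symm {P1 N A Y B : Finset V} {m : ℕ} (h : G.Ring P1 N m A Y B) : G.Ring P1 N m B Y A :=
  ⟨by rw [h.un]; ext x; simp only [mem_union]; tauto, h.dYB.symm, h.dAB.symm, h.dAY.symm, h.cB, h.cA, h.nY,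
    h.bBY, h.bAY, by rw [bt_comm, h.bAB], h.nB, h.nA, h.nYN⟩

lemma arms_two {P1 Y N : Finset V} {l : V → ℕ} {m : ℕ} (hm : 0 < m) (hY : Y ⊆ P1) (hYn : Y.Nonempty)
    (hl : G.Arms P1 Y l) (hN : G.bt P1 N = 2 * m)
    (hlow : ∀ A ⊆ P1, 2 ≤ #A → 2 ≤ #(P1 \ A) → G.bt A (P1 \ A) = 2 → m ≤ G.bt A N) :
    ∃ A B, G.Ring P1 N m A Y B := by
  obtain ⟨h1, i, j, hij, hi, hj⟩ := hl
  have hdis : ∀ i j, i ≠ j → Disjoint (arm P1 Y l i) (arm P1 Y l j) := by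
    intro i j hij
    rw [disjoint_left]
    intro x hx hx'
    exact hij (by rw [← (mem_filter.1 hx).2, ← (mem_filter.1 hx').2])
  have hdY : ∀ i, Disjoint (arm P1 Y l i) Y := by
    intro i
    rw [disjoint_left]
    intro x hx
    exact (mem_sdiff.1 (mem_filter.1 hx).1).2
  have key : ∀ i j, i ≠ j → (arm P1 Y l i).Nonempty → (arm P1 Y l j).Nonempty → m ≤ G.bt (arm P1 Y l i) N := by
    intro i j hij hi hj
    obtain ⟨c1, c2, c3⟩ := h1 i hi
    obtain ⟨d1, -, -⟩ := h1 j hj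
    refine hlow _ (arm_subset _ _ _ _) c1 (d1.trans (card_le_card ?_)) ?_
    · intro x hx
      rw [mem_sdiff]
      exact ⟨arm_subset _ _ _ _ hx, fun hx' => disjoint_left.1 (hdis i j hij) hx' hx⟩
    · rw [bt_split G _ (Z := Y), c2]
      · have : (P1 \ arm P1 Y l i) \ Y = P1 \ (Y ∪ arm P1 Y l i) := by
          ext x; simp only [mem_sdiff, mem_union]; tauto
        rw [this, c3]
      · intro x hx
        rw [mem_sdiff]
        exact ⟨hY hx, fun hh => disjoint_left.1 (hdY i) hh hx⟩
  have hun : P1 = arm P1 Y l i ∪ Y ∪ arm P1 Y l j := by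
    refine Subset.antisymm ?_ ?_
    · intro x hx
      by_contra hcon
      simp only [mem_union, not_or] at hcon
      have hxk : x ∈ arm P1 Y l (l x) := by
        simp [arm, hx, hcon]
      have hki : l x ≠ i := fun h => hcon.1.1 (h ▸ hxk)
      have hkj : l x ≠ j := fun h => hcon.2 (h ▸ hxk)
      have k1 := key i j hij hi hj
      have k2 := key j i hij.symm hj hi
      have k3 := key (l x) i hki ⟨x, hxk⟩ hi
      have : G.bt (arm P1 Y l i ∪ arm P1 Y l j ∪ arm P1 Y l (l x)) N ≤ G.bt P1 N :=
        G.bt_mono_left (by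
          refine union_subset (union_subset ?_ ?_) ?_ <;> exact arm_subset _ _ _ _) N
      rw [bt_union_left, bt_union_left G (hdis i j hij)] at this
      · omega
      · rw [disjoint_union_left]
        exact ⟨hdis _ _ hki.symm, hdis _ _ hkj.symm⟩
    · refine union_subset (union_subset ?_ hY) ?_ <;> exact arm_subset _ _ _ _
  have hsum : G.bt (arm P1 Y l i) N + G.bt Y N + G.bt (arm P1 Y l j) N = 2 * m := by
    rw [← hN, ← bt_union_left G (hdY i), ← bt_union_left, ← hun]
    rw [disjoint_union_left]
    exact ⟨hdis _ _ hij, (hdY j).symm⟩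
  have k1 := key i j hij hi hj
  have k2 := key j i hij.symm hj hi
  obtain ⟨c1, c2, c3⟩ := h1 i hi
  obtain ⟨d1, d2, d3⟩ := h1 j hj
  refine ⟨_, _, hun, hdY i, hdis _ _ hij, (hdY j).symm, c1, d1, hYn, c2, d2, ?_, by omega, by omega, by omega⟩
  have := G.bt_mono_right (arm P1 Y l i) (A := arm P1 Y l j) (B := P1 \ (Y ∪ arm P1 Y l i)) (by
    intro x hx
    simp only [mem_sdiff, mem_union, not_or]
    exact ⟨arm_subset _ _ _ _ hx, fun h => disjoint_left.1 (hdY j) hx h,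
      fun h => disjoint_left.1 (hdis _ _ hij) h hx⟩)
  omega

/-- number of vertices not adjacent to the root -/
def kc (G : Gr V E) (w : V) (X : Finset V) : ℕ := #(X.filter fun x => G.bt {x} {w} = 0)

lemma kc_union {w : V} {A B : Finset V} (h : Disjoint A B) : G.kc w (A ∪ B) = G.kc w A + G.kc w B := by
  unfold kc
  rw [filter_union, card_union_of_disjoint (disjoint_filter_filter h)]

lemma kc_mono {w : V} {A B : Finset V} (h : A ⊆ B) : G.kc w A ≤ G.kc w B :=
  card_le_card (filter_subset_filter _ h)

lemma kc_le {w : V} (A : Finset V) : G.kc w A ≤ #A := card_le_card (filter_subset _ _)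

lemma kc_pos {w x : V} {A : Finset V} (hx : x ∈ A) (h : G.bt {x} {w} = 0) : 1 ≤ G.kc w A :=
  card_pos.2 ⟨x, by simp [hx, h]⟩

lemma kc_split {w : V} {A : Finset V} (B : Finset V) : G.kc w A = G.kc w (A ∩ B) + G.kc w (A \ B) := by
  rw [← kc_union (disjoint_sdiff_inter A B).symm]
  congr 1
  ext x; simp only [mem_union, mem_inter, mem_sdiff]; tauto

namespace St3

variable {P : Finset V} {w : V}


lemma kc_card (hs : G.St3 P w) {X : Finset V} (hX : X ⊆ P) : #X = G.kc w X + G.bt X {w} := by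
  unfold kc
  rw [bt_sum, card_filter, ← sum_add_distrib, card_eq_sum_ones]
  refine sum_congr rfl fun x hx => ?_
  have := hs.one (hX hx)
  split_ifs <;> omega

lemma par (hs : G.St3 P w) {X : Finset V} (hX : X ⊆ P) : (G.kc w X + G.h P X) % 2 = 0 := by
  obtain ⟨m, hm⟩ := hs.near.parity hX
  have := hs.kc_card hX
  omega

lemma kP (hs : G.St3 P w) : G.kc w P % 2 = 0 := by
  have := hs.par (Subset.refl P)
  unfold h at this
  simpa using this

lemma ring (hs : G.St3 P w) {v : V} (hv : v ∈ P) (h1 : G.bt {v} {w} = 1) (hb : G.BadAt P w v) :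
    ∃ A Y B, G.Ring (P.erase v) {v} 1 A Y B ∧ G.bt Y {w} = 0 := by
  obtain ⟨Y, hY, hYn, hYw, hYv, l, hl⟩ := hb
  obtain ⟨A, B, h⟩ := arms_two (N := {v}) (m := 1) one_pos hY hYn hl (by
      have := hs.near.deg v hv
      unfold h at this
      rw [bt_comm, ← sdiff_singleton_eq_erase]; omega) (by
    intro A hA cA cA' h2
    have h3 := hs.hP hv hA
    have h4 := hs.h3 A (hA.trans (erase_subset _ _)) cA (cA'.trans (card_le_card
      (sdiff_subset_sdiff (erase_subset _ _) Subset.rfl)))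
    omega)
  exact ⟨A, Y, B, h, hYw⟩

/-- cut of `A` in a ring -/
lemma ringA (hs : G.St3 P w) {v : V} (hv : v ∈ P) {A Y B : Finset V} (hr : G.Ring (P.erase v) {v} 1 A Y B) :
    A ⊆ P.erase v ∧ G.h P A = 3 := by
  have hA : A ⊆ P.erase v := by rw [hr.un]; intro x; simp only [mem_union]; tauto
  refine ⟨hA, ?_⟩
  rw [hs.hP hv hA, hr.nA]
  have : P.erase v \ A = Y ∪ B := by
    rw [hr.un]; ext x; simp only [mem_union, mem_sdiff]
    have d1 := disjoint_left.1 hr.dAY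
    have d2 := disjoint_left.1 hr.dAB
    have := @d1 x; have := @d2 x
    tauto
  rw [this, bt_union_right _ _ hr.dYB, hr.bAY, hr.bAB]

/-- `h ≥ 3` for odd sets -/
lemma odd3 (hs : G.St3 P w) {X : Finset V} (hX : X ⊆ P) (hk : G.kc w X % 2 = 1) : 3 ≤ G.h P X := by
  have h1 := hs.par hX
  have h2 := hs.near.sep2 X hX (by
    rw [nonempty_iff_ne_empty]; rintro rfl; simp [kc] at hk) (by
    rintro rfl; have := hs.kP; omega)
  omega

lemma even4 (hs : G.St3 P w) {X : Finset V} (hX : X ⊆ P) (hk : G.kc w X % 2 = 0) (h1 : 1 ≤ G.kc w X) (hc : 2 ≤ #(P \ X)) :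
    4 ≤ G.h P X := by
  have h2 := hs.par hX
  have h3 := kc_le (G := G) (w := w) X
  have h4 := hs.h3 X hX (by omega) hc
  omega

/-- the D vertices of a minimal set have no edges leaving the set -/
lemma inner (hs : G.St3 P w) {S : Finset V} (hS : S ⊆ P) (h3 : G.h P S = 3) (hk : 2 ≤ G.kc w S) (hk' : 2 ≤ G.kc w (P \ S))
    (hmin : ∀ S' ⊆ S, S' ≠ S → G.h P S' = 3 → 2 ≤ G.kc w S' → False) :
    ∃ v ∈ S, G.bt {v} {w} = 1 ∧ G.bt {v} (P \ S) = 0 := by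
  have hc := kc_le (G := G) (w := w) S
  have hne : S ≠ P := by rintro rfl; simp [kc] at hk'
  have h4 := hs.c4 S hS (by omega) hne
  obtain ⟨e, he, v, hv, hj⟩ := edge_of_one (G := G) (X := S) (w := w) (fun h => hs.near.wP (hS h)) (by omega)
  have hvw : v ≠ w := fun h => hs.near.wP (h ▸ hS hv)
  have hv1 : G.bt {v} {w} = 1 := by
    have h5 := hs.one (hS hv)
    have : 0 < G.bt {v} {w} := by
      rw [bt_eq_card G (by simpa using hvw), card_pos]
      exact ⟨e, by rw [mem_bte]; simp only [mem_singleton]; tauto⟩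
    omega
  refine ⟨v, hv, hv1, ?_⟩
  have hsub : S.erase v ⊆ P := (erase_subset _ _).trans hS
  have h6 := h_disj G (P := P) (A := S.erase v) (B := {v}) hsub (by simpa using hS hv) (by simp)
  have hu : S.erase v ∪ {v} = S := by rw [union_comm, ← insert_eq, insert_erase hv]
  rw [hu] at h6
  have h7 := hs.near.deg v (hS hv)
  have hk2 : G.kc w (S.erase v) = G.kc w S := by
    have := kc_union (G := G) (w := w) (A := S.erase v) (B := {v}) (by simp)
    rw [hu] at this
    rw [this]
    have : G.kc w {v} = 0 := by simp [kc, hv1]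
    omega
  have h8 : G.h P {v} = G.bt {v} (S.erase v) + G.bt {v} (P \ S) := by
    unfold h
    rw [← bt_union_right G]
    · congr 1; ext x; simp only [mem_sdiff, mem_union, mem_erase, mem_singleton]
      have : x ∈ S → x ∈ P := fun h => hS h
      by_cases hx : x = v
      · subst hx; simp [hv]
      · simp [hx]; tauto
    · rw [disjoint_left]; intro x; simp only [mem_sdiff, mem_erase]; tauto
  rw [bt_comm G {v}] at h8
  have h9 := hs.near.sep2 (S.erase v) hsub (by
    rw [nonempty_iff_ne_empty]; intro h; rw [h] at hk2; simp [kc] at hk2; unfold kc at hk; omega) (by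
    intro h; exact absurd (hS hv) (by rw [← h]; simp))
  have h10 := hmin (S.erase v) (erase_subset _ _) (by intro h; rw [← h] at hv; simp at hv)
  rw [hk2] at h10
  by_contra hcon
  exact h10 (by omega) hk

end St3

end Gr

end Step3b

end CubicFlow

namespace CubicFlow

section Step3c

variable {V E : Type} [Fintype V] [DecidableEq V] [DecidableEq E]

namespace Gr

variable {G : Gr V E}

lemma exists_nbr {x : V} {Y : Finset V} (h : 0 < G.bt {x} Y) : ∃ y ∈ Y, 0 < G.bt {x} {y} := by
  by_contra hcon
  push Not at hcon
  rw [bt_comm, bt_sum] at h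
  have : ∑ v ∈ Y, G.bt {v} {x} = 0 := sum_eq_zero fun y hy => by
    have := hcon y hy
    rw [bt_comm]; omega
  omega

namespace St3

variable {P : Finset V} {w : V}


lemma core_nbr (hs : G.St3 P w) {x y : V} (hx : x ∈ P) (hy : y ∈ P) (h1 : G.bt {x} {w} = 1) (h : 0 < G.bt {x} {y}) :
    G.bt {y} {w} = 0 := by
  have hxy : x ≠ y := by
    rintro rfl
    rw [bt_self_zero hs.near.nl] at h; omega
  have := hs.one hy
  by_contra hc
  have := hs.nadj hx hy hxy h1 (by omega)
  omega

lemma odd_part (hs : G.St3 P w) {S A Y B : Finset V} {v : V} (hS : S ⊆ P) (hSh : G.h P S = 3) (hk : 2 ≤ G.kc w S)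
    (hk' : 2 ≤ G.kc w (P \ S))
    (hmin : ∀ S' ⊆ S, S' ≠ S → G.h P S' = 3 → 2 ≤ G.kc w S' → False)
    (hv : v ∈ S) (hv1 : G.bt {v} {w} = 1) (hvS : G.bt {v} (P \ S) = 0)
    (hr : G.Ring (P.erase v) {v} 1 A Y B) (hYw : G.bt Y {w} = 0) :
    G.kc w (S ∩ A) = 1 ∧ G.h P (S ∩ A) = 3 := by
  obtain ⟨hA, hAh⟩ := hs.ringA (hS hv) hr
  obtain ⟨hB, hBh⟩ := hs.ringA (hS hv) hr.symm
  have hAP : A ⊆ P := hA.trans (erase_subset _ _)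
  have hBP : B ⊆ P := hB.trans (erase_subset _ _)
  have hvA : v ∉ A := fun h => by simpa using hA h
  have nb : ∀ Z ⊆ P, G.bt Z {v} = 1 → ∃ a ∈ S ∩ Z, G.bt {a} {w} = 0 := by
    intro Z hZ h1
    obtain ⟨a, ha, ha1⟩ := exists_nbr (G := G) (x := v) (Y := Z) (by rw [bt_comm]; omega)
    refine ⟨a, mem_inter.2 ⟨?_, ha⟩, hs.core_nbr (hS hv) (hZ ha) hv1 ha1⟩
    by_contra haS
    have := G.bt_mono_right {v} (A := {a}) (B := P \ S) (by simp [haS, hZ ha])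
    omega
  obtain ⟨a, haS, haw⟩ := nb A hAP hr.nA
  obtain ⟨b, hbS, hbw⟩ := nb B hBP hr.nB
  obtain ⟨t1, t2, t3, t4, t5, t6⟩ := G.h_atoms hS hAP
  have hkA := hs.par hAP
  have hkS := hs.par hS
  have sp1 := kc_split (G := G) (w := w) (A := S) A
  have sp2 := kc_split (G := G) (w := w) (A := A) S
  rw [inter_comm A S] at sp2
  have hSA : S \ A ⊆ P := sdiff_subset.trans hS
  have hAS : A \ S ⊆ P := sdiff_subset.trans hAP
  have hI : S ∩ A ⊆ P := inter_subset_left.trans hS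
  have dAB := disjoint_left.1 hr.dAB
  have dAY := disjoint_left.1 hr.dAY
  have dYB := disjoint_left.1 hr.dYB
  rcases Nat.mod_two_eq_zero_or_one (G.kc w (S ∩ A)) with hev | hod
  · exfalso
    have o1 := hs.odd3 hSA (by omega)
    have o2 := hs.odd3 hAS (by omega)
    have hm := imp_false.1 <| hmin (S \ A) sdiff_subset (by
      intro h; have := (mem_inter.1 haS).1; rw [← h] at this
      exact (mem_sdiff.1 this).2 (mem_inter.1 haS).2) (by omega)
    have hb1 := kc_pos (G := G) (w := w) (A := S ∩ B) hbS hbw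
    have ha1 := kc_pos (G := G) (w := w) (A := S ∩ A) haS haw
    have dSS : Disjoint (S ∩ B) (S ∩ Y) := by
      rw [disjoint_left]; intro x; simp only [mem_inter]
      have := @dYB x; tauto
    have hsub : (S ∩ B) ∪ (S ∩ Y) ⊆ S \ A := by
      intro x; simp only [mem_union, mem_inter, mem_sdiff]
      have := @dAB x
      have := @dAY x; tauto
    have hle := kc_mono (G := G) (w := w) hsub
    rw [kc_union dSS] at hle
    have hSY : S ∩ Y = ∅ := by
      by_contra hne
      obtain ⟨y, hy⟩ := nonempty_iff_ne_empty.2 hne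
      have := kc_pos (G := G) (w := w) hy (by
        have := G.bt_mono_left (A := {y}) (B := Y) (by simpa using (mem_inter.1 hy).2) {w}
        omega)
      omega
    have hvP := hS hv
    have h4 := hs.even4 hI hev ha1 (by
      have hs2 : ({v, b} : Finset V) ⊆ P \ (S ∩ A) := by
        intro x; simp only [mem_insert, mem_singleton, mem_sdiff, mem_inter]
        rintro (rfl | rfl)
        · tauto
        · exact ⟨hBP (mem_inter.1 hbS).2, fun h => dAB h.2 (mem_inter.1 hbS).2⟩
      have hvb : v ≠ b := by
        rintro rfl
        simpa using hB (mem_inter.1 hbS).2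
      have := card_le_card hs2
      rwa [card_pair hvb] at this)
    have hsub2 : S \ A ⊆ B ∪ {v} := by
      intro x hx
      rw [mem_sdiff] at hx
      by_cases hxv : x = v
      · simp [hxv]
      · have : x ∈ P.erase v := mem_erase.2 ⟨hxv, hS hx.1⟩
        rw [hr.un] at this
        simp only [mem_union, mem_singleton] at this ⊢
        have hxY : x ∉ Y := fun h => by
          have : x ∈ S ∩ Y := mem_inter.2 ⟨hx.1, h⟩
          rw [hSY] at this; simp at this
        tauto
    have h5 := G.bt_mono (A := S ∩ A) (B := A) inter_subset_right hsub2
    rw [bt_union_right G A (by simpa using fun h => by simpa using hB h), hr.bAB, hr.nA] at h5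
    omega
  · have hun : S ∪ A ⊆ P := union_subset hS hAP
    have sp3 : G.kc w (S ∪ A) = G.kc w S + G.kc w (A \ S) := by
      rw [← kc_union disjoint_sdiff, union_sdiff_self_eq_union]
    have o1 := hs.odd3 hI hod
    have o2 := hs.odd3 hun (by omega)
    have h3 : G.h P (S ∩ A) = 3 := by omega
    refine ⟨?_, h3⟩
    have hm := imp_false.1 <| hmin (S ∩ A) inter_subset_left (by
      intro h; rw [← h] at hv; exact hvA (mem_inter.1 hv).2) h3
    omega

lemma caseI (hs : G.St3 P w) (hall : ∀ v ∈ P, G.bt {v} {w} = 1 → G.BadAt P w v)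
    (hS : ∃ S ⊆ P, G.h P S = 3 ∧ 2 ≤ G.kc w S ∧ 2 ≤ G.kc w (P \ S)) : False := by
  classical
  have hmn : ∀ Q ⊆ P, (∃ S ⊆ Q, G.h P S = 3 ∧ 2 ≤ G.kc w S ∧ 2 ≤ G.kc w (P \ S)) →
      ∃ S ⊆ Q, G.h P S = 3 ∧ 2 ≤ G.kc w S ∧ 2 ≤ G.kc w (P \ S) ∧
        (∀ S' ⊆ S, S' ≠ S → G.h P S' = 3 → 2 ≤ G.kc w S' → False) := by
    intro Q hQ hex
    obtain ⟨S0, hS0⟩ := hex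
    obtain ⟨S, hSm, hmin⟩ := exists_min_image
      (Q.powerset.filter fun S => G.h P S = 3 ∧ 2 ≤ G.kc w S ∧ 2 ≤ G.kc w (P \ S)) card
      ⟨S0, by simpa using hS0⟩
    simp only [mem_filter, mem_powerset] at hSm hmin
    refine ⟨S, hSm.1, hSm.2.1, hSm.2.2.1, hSm.2.2.2, ?_⟩
    intro S' h1 h2 h3 h4
    have := hmin S' ⟨h1.trans hSm.1, h3, h4, hSm.2.2.2.trans (kc_mono (sdiff_subset_sdiff Subset.rfl h1))⟩
    exact h2 (eq_of_subset_of_card_le h1 this)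
  obtain ⟨S, hSP, hS3, hk, hk', hmin⟩ := hmn P Subset.rfl hS
  obtain ⟨v, hv, hv1, hvS⟩ := hs.inner hSP hS3 hk hk' hmin
  obtain ⟨A, Y, B, hr, hYw⟩ := hs.ring (hSP hv) hv1 (hall v (hSP hv) hv1)
  have hPS : P \ (P \ S) = S := Finset.sdiff_sdiff_eq_self hSP
  obtain ⟨Z, hZ, hZ3, hkZ, hkZ', hminZ⟩ := hmn (P \ S) sdiff_subset
    ⟨P \ S, Subset.rfl, by rw [h_compl G hSP, hS3], hk', by rw [hPS]; exact hk⟩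
  obtain ⟨p, hp, hp1, hpZ⟩ := hs.inner (hZ.trans sdiff_subset) hZ3 hkZ hkZ' hminZ
  have hpP : p ∈ P := (mem_sdiff.1 (hZ hp)).1
  have hpS : p ∉ S := (mem_sdiff.1 (hZ hp)).2
  have hpS0 : G.bt {p} S = 0 := by
    have := G.bt_mono_right {p} (A := S) (B := P \ Z) (by
      intro x hx; rw [mem_sdiff]; exact ⟨hSP hx, fun h => (mem_sdiff.1 (hZ h)).2 hx⟩)
    omega
  have main : ∀ A B, G.Ring (P.erase v) {v} 1 A Y B → p ∈ A → False := by
    intro A B hr hpA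
    obtain ⟨hA, hAh⟩ := hs.ringA (hSP hv) hr
    have hAP : A ⊆ P := hA.trans (erase_subset _ _)
    obtain ⟨a1, a2⟩ := hs.odd_part hSP hS3 hk hk' hmin hv hv1 hvS hr hYw
    obtain ⟨b1, b2⟩ := hs.odd_part hSP hS3 hk hk' hmin hv hv1 hvS hr.symm hYw
    obtain ⟨t1, t2, t3, t4, t5, t6⟩ := G.h_atoms hSP hAP
    have hkA := hs.par hAP
    have hkS := hs.par hSP
    have sp1 := kc_split (G := G) (w := w) (A := S) A
    have sp2 := kc_split (G := G) (w := w) (A := A) S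
    rw [inter_comm A S] at sp2
    have dAB := disjoint_left.1 hr.dAB
    have hvA : v ∉ A := fun h => by simpa using hA h
    have hpv : p ≠ v := fun h => hvA (h ▸ hpA)
    -- cut of `A.erase p`
    have hsub : A.erase p ⊆ P := (erase_subset _ _).trans hAP
    have h6 := h_disj G (P := P) (A := A.erase p) (B := {p}) hsub (by simpa using hpP) (by simp)
    have hu : A.erase p ∪ {p} = A := by rw [union_comm, ← insert_eq, insert_erase hpA]
    rw [hu] at h6
    have h7 := hs.near.deg p hpP
    have h8 := hs.near.sep2 (A.erase p) hsub (by
      rw [← card_pos, card_erase_of_mem hpA]; have := hr.cA; omega) (by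
      intro h; rw [← h] at hpP; simp at hpP)
    have h9 : 0 < G.bt {p} (A.erase p) := by rw [bt_comm]; omega
    obtain ⟨x, hx, hx1⟩ := exists_nbr h9
    have hxA := mem_of_mem_erase hx
    have hxw := hs.core_nbr hpP (hAP hxA) hp1 hx1
    have hxS : x ∉ S := fun h => by
      have := G.bt_mono_right {p} (A := {x}) (B := S) (by simpa using h)
      omega
    have k1 := kc_pos (G := G) (w := w) (A := A \ S) (mem_sdiff.2 ⟨hxA, hxS⟩) hxw
    have hSB := kc_mono (G := G) (w := w) (A := S ∩ B) (B := S \ A) (by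
      intro z; simp only [mem_inter, mem_sdiff]; have := @dAB z; tauto)
    have g1 := hs.even4 (X := A \ S) (sdiff_subset.trans hAP) (by omega) k1 (by
      have := kc_le (G := G) (w := w) S
      refine le_trans (hk.trans this) (card_le_card ?_)
      intro z hz; rw [mem_sdiff, mem_sdiff]; exact ⟨hSP hz, by tauto⟩)
    have g2 := hs.even4 (X := S \ A) (sdiff_subset.trans hSP) (by omega) (by omega) (by
      refine le_trans hr.cA (card_le_card ?_)
      intro z hz; rw [mem_sdiff, mem_sdiff]; exact ⟨hAP hz, by tauto⟩)
    omega
  have hpe : p ∈ P.erase v := mem_erase.2 ⟨fun h => hpS (h ▸ hv), hpP⟩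
  rw [hr.un] at hpe
  simp only [mem_union] at hpe
  rcases hpe with (h | h) | h
  · exact main A B hr h
  · have := G.bt_mono_left (A := {p}) (B := Y) (by simpa using h) {w}
    omega
  · exact main B A hr.symm h

lemma caseII_ring (hs : G.St3 P w) (hno : ¬ ∃ S ⊆ P, G.h P S = 3 ∧ 2 ≤ G.kc w S ∧ 2 ≤ G.kc w (P \ S))
    {v : V} (hv : v ∈ P) (hv1 : G.bt {v} {w} = 1) {A Y B : Finset V} (hr : G.Ring (P.erase v) {v} 1 A Y B)
    (hYw : G.bt Y {w} = 0) :
    ∃ a ∈ A, 0 < G.bt {v} {a} ∧ G.bt {a} {w} = 0 ∧ ∀ p ∈ A, p ≠ a → G.bt {p} {w} = 1 ∧ G.bt {p} {a} = 1 ∧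
      G.bt {p} Y = 1 := by
  obtain ⟨hA, hAh⟩ := hs.ringA hv hr
  obtain ⟨hB, hBh⟩ := hs.ringA hv hr.symm
  have hAP : A ⊆ P := hA.trans (erase_subset _ _)
  have hBP : B ⊆ P := hB.trans (erase_subset _ _)
  have hYe : Y ⊆ P.erase v := by rw [hr.un]; intro x; simp only [mem_union]; tauto
  have hYP : Y ⊆ P := hYe.trans (erase_subset _ _)
  have dAB := disjoint_left.1 hr.dAB
  have dAY := disjoint_left.1 hr.dAY
  have hkA := hs.par hAP
  have hkB := hs.par hBP
  have hYk := hs.kc_card hYP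
  have hYc := hr.nY.card_pos
  have hkc : 2 ≤ G.kc w (P \ A) := by
    have := kc_mono (G := G) (w := w) (A := Y ∪ B) (B := P \ A) (by
      intro x; simp only [mem_union, mem_sdiff]
      rintro (h | h)
      · exact ⟨hYP h, fun h' => dAY h' h⟩
      · exact ⟨hBP h, fun h' => dAB h' h⟩)
    rw [kc_union hr.dYB] at this
    omega
  have hk1 : G.kc w A = 1 := by
    by_contra hne
    exact hno ⟨A, hAP, hAh, by omega, hkc⟩
  obtain ⟨a, ha, ha1⟩ := exists_nbr (G := G) (x := v) (Y := A) (by rw [bt_comm, hr.nA]; omega)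
  have haw := hs.core_nbr hv (hAP ha) hv1 ha1
  have huniq : ∀ p ∈ A, p ≠ a → G.bt {p} {w} = 1 := by
    intro p hp hpa
    have := hs.one (hAP hp)
    by_contra hne
    refine hpa (card_le_one.1 hk1.le p ?_ a ?_) <;> rw [mem_filter]
    · exact ⟨hp, by omega⟩
    · exact ⟨ha, haw⟩
  refine ⟨a, ha, ha1, haw, fun p hp hpa => ⟨huniq p hp hpa, ?_⟩⟩
  have hpw := huniq p hp hpa
  have hpP := hAP hp
  have hpe := hA hp
  have hpv := (mem_erase.1 hpe).1
  have h7 := hs.near.deg p hpP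
  have e0 : P = {v} ∪ (A ∪ Y ∪ B) := by rw [← hr.un, ← insert_eq, insert_erase hv]
  have e1 : G.bt {p} P = G.bt {p} {v} + (G.bt {p} A + G.bt {p} Y + G.bt {p} B) := by
    conv_lhs => rw [e0]
    rw [bt_union_right, bt_union_right, bt_union_right _ _ hr.dAY]
    · rw [disjoint_union_left]; exact ⟨hr.dAB, hr.dYB⟩
    · rw [← hr.un]; simp
  rw [h_single hs.near.nl hpP, e1] at h7
  have e2 : G.bt {p} {v} = 0 := hs.nadj hpP hv hpv hpw hv1
  have e3 : G.bt {p} B = 0 := by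
    have := G.bt_mono_left (A := {p}) (B := A) (by simpa using hp) B
    have := hr.bAB; omega
  have e4 : G.bt {p} A = G.bt {p} {a} := by
    rw [G.bt_split {p} (Y := A) (Z := {a}) (by simpa using ha)]
    have : G.bt {p} (A \ {a}) = 0 := by
      by_contra hne
      obtain ⟨y, hy, hy1⟩ := exists_nbr (Nat.pos_of_ne_zero hne)
      have hyA := (mem_sdiff.1 hy).1
      have hya : y ≠ a := by have := (mem_sdiff.1 hy).2; simpa using this
      have := hs.core_nbr hpP (hAP hyA) hpw hy1
      have := huniq y hyA hya
      omega
    omega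
  have e5 : G.bt {p} {a} ≤ 1 := by
    rw [bt_comm]; exact hs.adj1 (hAP ha) hpP hpa.symm hpw
  have hsub : A.erase p ⊆ P := (erase_subset _ _).trans hAP
  have h6 := h_disj G (P := P) (A := A.erase p) (B := {p}) hsub (by simpa using hpP) (by simp)
  have hu : A.erase p ∪ {p} = A := by rw [union_comm, ← insert_eq, insert_erase hp]
  rw [hu] at h6
  have h7' := hs.near.deg p hpP
  have h8 := hs.near.sep2 (A.erase p) hsub ⟨a, mem_erase.2 ⟨hpa.symm, ha⟩⟩ (by
    intro h; rw [← h] at hpP; simp at hpP)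
  have e6 := G.bt_mono_left (A := A.erase p) (B := A) (erase_subset _ _) {p}
  rw [bt_comm G A] at e6
  omega

set_option maxHeartbeats 2000000 in
lemma caseII (hs : G.St3 P w) (hall : ∀ v ∈ P, G.bt {v} {w} = 1 → G.BadAt P w v)
    (hno : ¬ ∃ S ⊆ P, G.h P S = 3 ∧ 2 ≤ G.kc w S ∧ 2 ≤ G.kc w (P \ S)) : False := by
  -- neighbours of D-vertices
  have nbrs : ∀ p ∈ P, G.bt {p} {w} = 1 → ∀ x ∈ P, ∀ y ∈ P, x ≠ y → 0 < G.bt {p} {x} → 0 < G.bt {p} {y} →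
      ∀ r ∈ P, r ≠ p → G.bt {r} {w} = 1 → 0 < G.bt {r} {x} ∨ 0 < G.bt {r} {y} := by
    intro p hp hp1 x hx y hy hxy hpx hpy r hr hrp hr1
    obtain ⟨A, Y, B, hrg, hYw⟩ := hs.ring hp hp1 (hall p hp hp1)
    obtain ⟨a, ha, hpa, haw, hA⟩ := hs.caseII_ring hno hp hp1 hrg hYw
    obtain ⟨b, hb, hpb, hbw, hB⟩ := hs.caseII_ring hno hp hp1 hrg.symm hYw
    have hAP := (hs.ringA hp hrg).1.trans (erase_subset _ _)
    have hBP := (hs.ringA hp hrg.symm).1.trans (erase_subset _ _)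
    have hab : a ≠ b := fun h => disjoint_left.1 hrg.dAB ha (h ▸ hb)
    have hdeg := hs.near.deg p hp
    rw [h_single hs.near.nl hp] at hdeg
    have only : ∀ z ∈ P, 0 < G.bt {p} {z} → z = a ∨ z = b := by
      intro z hz hpz
      by_contra hcon
      push Not at hcon
      have := G.bt_mono_right {p} (A := {a} ∪ {b} ∪ {z}) (B := P) (by
        intro u; simp only [mem_union, mem_singleton]; rintro ((rfl | rfl) | rfl)
        · exact hAP ha
        · exact hBP hb
        · exact hz)
      rw [bt_union_right, bt_union_right _ _ (by simpa using hab)] at this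
      · omega
      · rw [disjoint_union_left]; constructor <;> simp <;> tauto
    have hre : r ∈ P.erase p := mem_erase.2 ⟨hrp, hr⟩
    rw [hrg.un] at hre
    simp only [mem_union] at hre
    have res : 0 < G.bt {r} {a} ∨ 0 < G.bt {r} {b} := by
      rcases hre with (h | h) | h
      · left
        have := hA r h (by rintro rfl; omega)
        omega
      · have := G.bt_mono_left (A := {r}) (B := Y) (by simpa using h) {w}
        omega
      · right
        have := hB r h (by rintro rfl; omega)
        omega
    rcases only x hx hpx with rfl | rfl <;> rcases only y hy hpy with rfl | rfl <;> tauto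
  have hd4 := hs.d4
  obtain ⟨e, he, v, hv, hj⟩ := edge_of_one (G := G) (X := P) (w := w) hs.near.wP (by omega)
  have hvw : v ≠ w := fun h => hs.near.wP (h ▸ hv)
  have hv1 : G.bt {v} {w} = 1 := by
    have h5 := hs.one hv
    have : 0 < G.bt {v} {w} := by
      rw [bt_eq_card G (by simpa using hvw), card_pos]
      exact ⟨e, by rw [mem_bte]; simp only [mem_singleton]; tauto⟩
    omega
  obtain ⟨A, Y, B, hr, hYw⟩ := hs.ring hv hv1 (hall v hv hv1)
  have hsum : G.bt {v} {w} + (G.bt A {w} + G.bt Y {w} + G.bt B {w}) = G.bt P {w} := by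
    have e0 : P = {v} ∪ (A ∪ Y ∪ B) := by rw [← hr.un, ← insert_eq, insert_erase hv]
    conv_rhs => rw [e0]
    rw [bt_union_left, bt_union_left, bt_union_left _ hr.dAY]
    · rw [disjoint_union_left]; exact ⟨hr.dAB, hr.dYB⟩
    · rw [← hr.un]; simp
  have main : ∀ A B, G.Ring (P.erase v) {v} 1 A Y B → 2 ≤ G.bt A {w} → 1 ≤ G.bt B {w} → False := by
    intro A B hr hA2 hB1
    obtain ⟨a, ha, -, haw, hA⟩ := hs.caseII_ring hno hv hv1 hr hYw
    obtain ⟨b, hb, -, hbw, hB⟩ := hs.caseII_ring hno hv hv1 hr.symm hYw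
    have hAe := (hs.ringA hv hr).1
    have hBe := (hs.ringA hv hr.symm).1
    have hAP := hAe.trans (erase_subset _ _)
    have hBP := hBe.trans (erase_subset _ _)
    have hYe : Y ⊆ P.erase v := by rw [hr.un]; intro x; simp only [mem_union]; tauto
    have hYP : Y ⊆ P := hYe.trans (erase_subset _ _)
    have dAB := disjoint_left.1 hr.dAB
    have dAY := disjoint_left.1 hr.dAY
    have dYB := disjoint_left.1 hr.dYB
    have hcA : 2 ≤ #(A.erase a) := by
      refine le_trans ?_ (bt_le_of_one (G := G) (w := w) fun x hx => hs.one (hAP (mem_of_mem_erase hx)))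
      rw [bt_split_left G {w} (X := A) (Z := {a}) (by simpa using ha), sdiff_singleton_eq_erase] at hA2
      omega
    obtain ⟨p, hp, p', hp', hpp⟩ := one_lt_card.1 hcA
    have hcB : 0 < G.bt {w} (B.erase b) := by
      rw [bt_split_left G {w} (X := B) (Z := {b}) (by simpa using hb), sdiff_singleton_eq_erase] at hB1
      rw [bt_comm]
      omega
    obtain ⟨r, hr', -⟩ := exists_nbr hcB
    rw [mem_erase] at hp hp' hr'
    obtain ⟨r1, r2, r3⟩ := hB r hr'.2 hr'.1
    have key : ∀ p ∈ A, p ≠ a → ∃ c ∈ Y, 0 < G.bt {p} {c} ∧ 0 < G.bt {r} {c} := by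
      intro p hp hpa
      obtain ⟨p1, p2, p3⟩ := hA p hp hpa
      obtain ⟨c, hc, hpc⟩ := exists_nbr (G := G) (x := p) (Y := Y) (by omega)
      refine ⟨c, hc, hpc, ?_⟩
      have := nbrs p (hAP hp) p1 a (hAP ha) c (hYP hc) (fun h => dAY ha (h ▸ hc)) (by omega) hpc r
        (hBP hr'.2) (fun h => dAB hp (h ▸ hr'.2)) r1
      rcases this with h | h
      · have h1 := G.bt_mono (A := {a}) (B := A) (C := {r}) (D := B) (by simpa using ha) (by simpa using hr'.2)
        rw [bt_comm, hr.bAB] at h1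
        omega
      · exact h
    obtain ⟨c, hc, hpc, hrc⟩ := key p hp.2 hp.1
    obtain ⟨c', hc', hpc', hrc'⟩ := key p' hp'.2 hp'.1
    have hcc : c = c' := by
      by_contra hne
      have := G.bt_mono_right {r} (A := {c} ∪ {c'}) (B := Y) (by
        intro u; simp only [mem_union, mem_singleton]; rintro (rfl | rfl) <;> assumption)
      rw [bt_union_right _ _ (by simpa using hne)] at this
      omega
    subst hcc
    obtain ⟨p1, p2, p3⟩ := hA p hp.2 hp.1
    obtain ⟨p1', p2', p3'⟩ := hA p' hp'.2 hp'.1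
    have hca : c ≠ a := fun h => dAY ha (h ▸ hc)
    have hcp : c ≠ p := fun h => dAY hp.2 (h ▸ hc)
    have hcp' : c ≠ p' := fun h => dAY hp'.2 (h ▸ hc)
    have s1 := h_pair (G := G) (P := P) (hAP ha) (hYP hc) hca.symm
    have s2 := h_pair (G := G) (P := P) (hAP hp.2) (hAP hp'.2) hpp
    have sub1 : ({a, c} : Finset V) ⊆ P := by
      intro u; simp only [mem_insert, mem_singleton]; rintro (rfl | rfl)
      · exact hAP ha
      · exact hYP hc
    have sub2 : ({p, p'} : Finset V) ⊆ P := by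
      intro u; simp only [mem_insert, mem_singleton]; rintro (rfl | rfl)
      · exact hAP hp.2
      · exact hAP hp'.2
    have hdj : Disjoint ({a, c} : Finset V) {p, p'} := by
      rw [disjoint_left]; intro u; simp only [mem_insert, mem_singleton, not_or]
      rintro (rfl | rfl)
      · exact ⟨hp.1.symm, hp'.1.symm⟩
      · exact ⟨hcp, hcp'⟩
    have s3 := h_disj G (P := P) sub1 sub2 hdj
    have s4 : G.bt {a, c} {p, p'} = (G.bt {a} {p} + G.bt {a} {p'}) + (G.bt {c} {p} + G.bt {c} {p'}) := by
      rw [insert_eq a, insert_eq p, bt_union_left _ (by simpa using hca.symm), bt_union_right _ _ (by simpa using hpp),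
        bt_union_right _ _ (by simpa using hpp)]
    rw [bt_comm G {a} {p}, bt_comm G {a} {p'}, bt_comm G {c} {p}, bt_comm G {c} {p'}] at s4
    have d1 := hs.near.deg a (hAP ha)
    have d2 := hs.near.deg c (hYP hc)
    have d3 := hs.near.deg p (hAP hp.2)
    have d4 := hs.near.deg p' (hAP hp'.2)
    have hvr : v ≠ r := by rintro rfl; simpa using hBe hr'.2
    have s5 := hs.h3 ({a, c} ∪ {p, p'}) (union_subset sub1 sub2) (by
        rw [card_union_of_disjoint hdj, card_pair hca.symm]; omega) (by
      rw [← card_pair hvr]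
      refine card_le_card ?_
      intro u
      have hva : ∀ z ∈ A, z ≠ v := fun z hz h => by subst h; simpa using hAe hz
      have hvc : c ≠ v := fun h => by subst h; simpa using hYe hc
      have har : ∀ z ∈ A, z ≠ r := fun z hz h => dAB hz (h ▸ hr'.2)
      have hcr : c ≠ r := fun h => dYB hc (h ▸ hr'.2)
      simp only [mem_insert, mem_singleton, mem_sdiff, mem_union, not_or]
      rintro (rfl | rfl)
      · exact ⟨hv, ⟨(hva a ha).symm, hvc.symm⟩, (hva p hp.2).symm, (hva p' hp'.2).symm⟩
      · exact ⟨hBP hr'.2, ⟨(har a ha).symm, hcr.symm⟩, (har p hp.2).symm, (har p' hp'.2).symm⟩)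
    omega
  have bnd : ∀ A B, G.Ring (P.erase v) {v} 1 A Y B → G.bt A {w} ≤ 2 := by
    intro A B hr
    obtain ⟨a, ha, -, haw, hA⟩ := hs.caseII_ring hno hv hv1 hr hYw
    rw [bt_split_left G {w} (X := A) (Z := {a}) (by simpa using ha), sdiff_singleton_eq_erase, haw]
    have h1 := hr.bAY
    rw [bt_split_left G Y (X := A) (Z := {a}) (by simpa using ha), sdiff_singleton_eq_erase] at h1
    have h2 : G.bt (A.erase a) {w} = G.bt (A.erase a) Y := by
      rw [bt_sum, bt_sum G _ Y]
      refine sum_congr rfl fun p hp => ?_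
      have := hA p (mem_of_mem_erase hp) (ne_of_mem_erase hp)
      omega
    omega
  have b1 := bnd A B hr
  have b2 := bnd B A hr.symm
  rcases Nat.lt_or_ge (G.bt A {w}) 2 with h | h
  · exact main B A hr.symm (by omega) (by omega)
  · exact main A B hr h (by omega)

/-- Step 3 -/
lemma pos (hs : G.St3 P w) {q : ℝ}
    (IH : ∀ (G' : Gr V E) (P' : Finset V) (w' : V), #G'.F < #G.F → G'.Near P' w' → Pos q G' P') :
    Pos q G P := by
  by_contra hcon
  have hall : ∀ v ∈ P, G.bt {v} {w} = 1 → G.BadAt P w v := by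
    intro v hv h1
    by_contra hb
    exact hcon (hs.pos_of hv h1 hb IH)
  by_cases hS : ∃ S ⊆ P, G.h P S = 3 ∧ 2 ≤ G.kc w S ∧ 2 ≤ G.kc w (P \ S)
  · exact hs.caseI hall hS
  · exact hs.caseII hall hS

end St3

end Gr

end Step3c

end CubicFlow

namespace CubicFlow

section Step4

variable {V E : Type} [Fintype V] [DecidableEq V] [DecidableEq E]

namespace Gr

variable {G : Gr V E}

/-- cyclically 4-edge-connected cubic graphs -/
structure C4 (G : Gr V E) (U : Finset V) : Prop where
  cub : G.Cub U
  c4 : ∀ X ⊆ U, 2 ≤ #X → 2 ≤ #(U \ X) → 4 ≤ G.h U X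
  c6 : 6 ≤ #U

namespace C4

variable {U : Finset V}


lemma par (hc : G.C4 U) {X : Finset V} (hX : X ⊆ U) : (#X + G.h U X) % 2 = 0 := by
  obtain ⟨k, hk⟩ := handshake hc.cub.nl hX (fun v hv => hc.cub.deg v (hX hv))
  omega

lemma bt1 (hc : G.C4 U) {u v : V} (hu : u ∈ U) (hv : v ∈ U) : G.bt {u} {v} ≤ 1 := by
  by_cases huv : u = v
  · subst huv; rw [bt_self_zero hc.cub.nl]; omega
  have h1 := h_pair (G := G) hu hv huv
  have h2 := hc.cub.deg u hu
  have h3 := hc.cub.deg v hv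
  have hsub : ({u, v} : Finset V) ⊆ U := by
    intro x; simp only [mem_insert, mem_singleton]; rintro (rfl | rfl) <;> assumption
  have c := card_pair huv
  have h4 := hc.c4 {u, v} hsub (by omega) (by rw [card_sdiff_of_subset hsub]; have := hc.c6; omega)
  omega

/-- no triangles -/
lemma tri (hc : G.C4 U) {u v x : V} (hu : u ∈ U) (hv : v ∈ U) (hx : x ∈ U) (huv : 0 < G.bt {u} {v}) (hxu : x ≠ u)
    (hxv : x ≠ v) : G.bt {x} {u, v} ≤ 1 := by
  have hne : u ≠ v := by rintro rfl; rw [bt_self_zero hc.cub.nl] at huv; omega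
  have hsub : ({u, v} : Finset V) ⊆ U := by
    intro y; simp only [mem_insert, mem_singleton]; rintro (rfl | rfl) <;> assumption
  have h1 := h_pair (G := G) hu hv hne
  have h2 := hc.cub.deg u hu
  have h3 := hc.cub.deg v hv
  have hd : Disjoint ({x} : Finset V) {u, v} := by simp; tauto
  have h4 := h_disj G (P := U) (A := {x}) (B := {u, v}) (by simpa using hx) hsub hd
  have h5 := hc.cub.deg x hx
  have c : #(({x} : Finset V) ∪ {u, v}) = 3 := by
    rw [card_union_of_disjoint hd, card_pair hne, card_singleton]
  have hsub' : ({x} : Finset V) ∪ {u, v} ⊆ U := union_subset (by simpa using hx) hsub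
  have h6 := hc.c4 _ hsub' (by omega) (by rw [card_sdiff_of_subset hsub']; have := hc.c6; omega)
  omega

lemma tri' (hc : G.C4 U) {u v x : V} (hu : u ∈ U) (hv : v ∈ U) (hx : x ∈ U) (huv : 0 < G.bt {u} {v})
    (hxu : 0 < G.bt {x} {u}) : G.bt {x} {v} = 0 := by
  have hne : u ≠ v := by rintro rfl; rw [bt_self_zero hc.cub.nl] at huv; omega
  have h1 : x ≠ u := by rintro rfl; rw [bt_self_zero hc.cub.nl] at hxu; omega
  by_cases h2 : x = v
  · subst h2; exact bt_self_zero hc.cub.nl _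
  have h3 := hc.tri hu hv hx huv h1 h2
  rw [insert_eq, bt_union_right _ _ (by simpa using hne)] at h3
  omega

/-- odd sets -/
lemma odd5 (hc : G.C4 U) {X : Finset V} (hX : X ⊆ U) (ho : #X % 2 = 1) (h2 : 2 ≤ #X) (h2' : 2 ≤ #(U \ X)) : 5 ≤ G.h U X := by
  have := hc.par hX
  have := hc.c4 X hX h2 h2'
  omega

/-- even sets -/
lemma even4 (hc : G.C4 U) {X : Finset V} (hX : X ⊆ U) (ho : #X % 2 = 0) (hn : X.Nonempty) (hne : X ≠ U) : 4 ≤ G.h U X := by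
  have := hc.par hX
  have := hc.cub.cut3 X hX hn hne
  omega

lemma evenU (hc : G.C4 U) : #U % 2 = 0 := by
  have := hc.par (Subset.refl U)
  unfold h at this
  simpa using this

lemma hsplit (hc : G.C4 U) {u v : V} (hu : u ∈ U) (hv : v ∈ U) (huv : u ≠ v) {X : Finset V} (hX : X ⊆ U \ {u, v}) :
    G.h U X = G.bt X ((U \ {u, v}) \ X) + G.bt X {u, v} := by
  rw [← bt_union_right]
  · unfold h; congr 1
    ext x; simp only [mem_sdiff, mem_union, mem_insert, mem_singleton]
    have : x ∈ X → x ∈ U \ {u, v} := fun h => hX h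
    simp only [mem_sdiff, mem_insert, mem_singleton] at this
    by_cases h1 : x = u
    · subst h1; simp [hu] at *; exact this
    · by_cases h2 : x = v
      · subst h2; simp [hv] at *; exact this
      · simp [h1, h2]
  · rw [disjoint_left]; intro x; simp only [mem_sdiff]; tauto

lemma btN (hc : G.C4 U) {u v : V} (hu : u ∈ U) (hv : v ∈ U) (h1 : G.bt {u} {v} = 1) :
    G.bt (U \ {u, v}) {u, v} = 4 := by
  have hne : u ≠ v := by rintro rfl; rw [bt_self_zero hc.cub.nl] at h1; omega
  have h2 := h_pair (G := G) hu hv hne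
  rw [hc.cub.deg u hu, hc.cub.deg v hv] at h2
  unfold h at h2
  rw [bt_comm]; omega

/-- an edge without ring gives the induction step -/
lemma dc (hc : G.C4 U) {q : ℝ} {u v : V} (hu : u ∈ U) (hv : v ∈ U) (h1 : G.bt {u} {v} = 1)
    (hnr : ∀ A Y B, ¬ G.Ring (U \ {u, v}) {u, v} 2 A Y B)
    (IH : ∀ (G' : Gr V E) (P' : Finset V) (w' : V), #G'.F < #G.F → G'.Near P' w' → Pos q G' P') :
    Pos q G (U.erase u) := by
  have hne : u ≠ v := by rintro rfl; rw [bt_self_zero hc.cub.nl] at h1; omega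
  have hN := hc.cub.near hu
  have hvP : v ∈ U.erase u := mem_erase.2 ⟨hne.symm, hv⟩
  obtain ⟨e, he⟩ := exists_jn (G := G) (v := v) (w := u) (by rw [bt_comm]; omega)
  have hc6 := hc.c6
  have hP1 : (U.erase u).erase v = U \ {u, v} := by
    ext x; simp only [mem_erase, mem_sdiff, mem_insert, mem_singleton]; tauto
  have hcard : #(U \ {u, v}) + 2 = #U := by
    have hsub : ({u, v} : Finset V) ⊆ U := by
      intro x; simp only [mem_insert, mem_singleton]; rintro (rfl | rfl) <;> assumption
    rw [card_sdiff_of_subset hsub, card_pair hne]; omega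
  have hbN := hc.btN hu hv h1
  have sub1 : U \ {u, v} ⊆ U := sdiff_subset
  have bsum : ∀ X, G.bt X {u, v} = G.bt X {u} + G.bt X {v} := by
    intro X; rw [insert_eq, bt_union_right _ _ (by simpa using hne)]
  have h1' : G.bt {v} {u} = 1 := by rw [bt_comm]; exact h1
  have hbu : G.bt (U \ {u, v}) {u} = 2 := by
    have h2 := hc.cub.deg u hu
    unfold h at h2
    rw [bt_split G {u} (Y := U \ {u}) (Z := {v}) (by simp [hv, hne.symm]), h1,
      show (U \ {u}) \ {v} = U \ {u, v} by
        ext x; simp only [mem_sdiff, mem_insert, mem_singleton]; tauto] at h2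
    rw [bt_comm]; omega
  have hcF := card_erase_add_one he.1
  have hPc : #(U.erase u) + 1 = #U := card_erase_add_one hu
  refine dc_pos hne.symm hvP he (IH _ _ u (show #(G.F.erase e) < #G.F by omega) ?_) ?_
  · refine contract_near hN hvP he h1' ?_ ?_
    · rw [hP1]
      have sing : ∀ x ∈ U \ {u, v}, 2 ≤ G.bt {x} ((U \ {u, v}) \ {x}) := by
        intro x hx
        have a1 := hc.hsplit hu hv hne (X := {x}) (by simpa using hx)
        simp only [mem_sdiff, mem_insert, mem_singleton, not_or] at hx
        have a2 := hc.tri hu hv hx.1 (by omega) hx.2.1 hx.2.2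
        have a3 := hc.cub.deg x hx.1
        omega
      intro X hX hn hXne
      have hR : ((U \ {u, v}) \ X).Nonempty := by
        rw [sdiff_nonempty]; exact fun h => hXne (Subset.antisymm hX h)
      have hRs : (U \ {u, v}) \ X ⊆ U \ {u, v} := sdiff_subset
      have hRR : (U \ {u, v}) \ ((U \ {u, v}) \ X) = X := Finset.sdiff_sdiff_eq_self hX
      have b1 := hc.hsplit hu hv hne hX
      have b2 := hc.hsplit hu hv hne hRs
      rw [hRR, bt_comm G ((U \ {u, v}) \ X) X] at b2
      have b3 := bt_split_left G {u, v} hX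
      rcases Nat.lt_or_ge #X 2 with c | c
      · obtain ⟨x, rfl⟩ := card_eq_one.1 (show #X = 1 by have := hn.card_pos; omega)
        exact sing x (by simpa using hX)
      rcases Nat.lt_or_ge #((U \ {u, v}) \ X) 2 with c' | c'
      · obtain ⟨x, hx⟩ := card_eq_one.1 (show #((U \ {u, v}) \ X) = 1 by have := hR.card_pos; omega)
        have := sing x (by rw [← singleton_subset_iff, ← hx]; exact hRs)
        rw [← hx, hRR, bt_comm] at this
        exact this
      · have d1 := hc.c4 X (hX.trans sub1) c (c'.trans (card_le_card (sdiff_subset_sdiff sub1 Subset.rfl)))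
        have d2 := hc.c4 _ (hRs.trans sub1) c' (c.trans (card_le_card (by
          intro x hx; rw [mem_sdiff]; exact ⟨sub1 (hX hx), by rw [mem_sdiff]; tauto⟩)))
        omega
    · rw [hP1]
      intro Y hY hYn hYu hYv l hl
      obtain ⟨A, B, hr⟩ := arms_two (N := {u, v}) (m := 2) (by omega) hY hYn hl hbN (by
        intro A hA cA cA' h2
        have h3 := hc.hsplit hu hv hne hA
        have h4 := hc.c4 A (hA.trans sub1) cA (cA'.trans (card_le_card
          (sdiff_subset_sdiff sub1 Subset.rfl)))
        omega)
      exact hnr _ _ _ hr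
  · obtain ⟨G2, hQ, hcd, hph, hbw, -⟩ := delete_qn q hN hvP he h1' (by
        intro a ha
        exact hc.bt1 (mem_of_mem_erase (mem_of_mem_erase ha)) hv) (by
      rw [hP1]
      intro X hX hn hXu h2 hRn
      have hRs : (U \ {u, v}) \ X ⊆ U \ {u, v} := sdiff_subset
      have b3 := bt_split_left G {u} hX
      have hRu : G.bt ((U \ {u, v}) \ X) {u} = 2 := by omega
      rcases Nat.lt_or_ge #((U \ {u, v}) \ X) 2 with c' | c'
      · obtain ⟨x, hx⟩ := card_eq_one.1 (show #((U \ {u, v}) \ X) = 1 by have := hRn.card_pos; omega)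
        rw [hx] at hRu
        have := hc.bt1 (u := x) (v := u) (sub1 (hRs (by rw [hx]; simp))) hu
        omega
      · have huR : u ∉ (U \ {u, v}) \ X := fun h => by have := hRs h; simp at this
        have k1 := h_insert (G := G) (P := U.erase u) (X := (U \ {u, v}) \ X) (w := u) (by simp)
          (by rw [← hP1]; exact sdiff_subset.trans (erase_subset _ _))
        rw [insert_erase hu, h2, hRu] at k1
        have k2 := h_disj G (P := U) (A := (U \ {u, v}) \ X) (B := {u}) (hRs.trans sub1) (by simpa using hu)
          (by simpa using huR)
        rw [hRu, hc.cub.deg u hu, k1] at k2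
        have k3 := hc.c4 ((U \ {u, v}) \ X ∪ {u}) (union_subset (hRs.trans sub1) (by simpa using hu))
          (c'.trans (card_le_card subset_union_left)) (by
            have hsub : insert v X ⊆ U \ ((U \ {u, v}) \ X ∪ {u}) := by
              intro x hx
              simp only [mem_insert] at hx
              simp only [mem_sdiff, mem_union, mem_insert, mem_singleton, not_or]
              rcases hx with rfl | hx
              · exact ⟨hv, by tauto, hne.symm⟩
              · have := hX hx
                simp only [mem_sdiff, mem_insert, mem_singleton] at this
                tauto
            refine le_trans ?_ (card_le_card hsub)
            rw [card_insert_of_notMem (fun h => by have := hX h; simp at this)]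
            have := hn.card_pos
            omega)
        omega)
    rw [hP1] at hQ hbw
    obtain ⟨G3, hC3, hcd3, hph3⟩ := hQ.supp (by rw [hbw, hbu]) (by omega) q
    obtain ⟨z, hz⟩ : (U \ {u, v}).Nonempty := card_pos.1 (by omega)
    have := IH _ _ _ (by omega) (hC3.near hz)
    unfold Pos at this
    rw [← hph, ← hph3]
    have hzc := card_erase_add_one hz
    have e1 : #G.F + #(U.erase u) = #G3.F + #((U \ {u, v}).erase z) + 5 := by omega
    rw [e1, pow_add _ _ 5]
    norm_num
    linarith

end C4

end Gr

end Step4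

end CubicFlow

namespace CubicFlow

section Step4b

variable {V E : Type} [Fintype V] [DecidableEq V] [DecidableEq E]

lemma dl {A B : Finset V} (h : Disjoint A B) (x : V) : x ∈ A → x ∉ B := fun hx => disjoint_left.1 h hx

namespace Gr

variable {G : Gr V E}

namespace C4

variable {U : Finset V}

/-- facts about a ring -/
lemma ringfacts (hc : G.C4 U) {u v : V} (hu : u ∈ U) (hv : v ∈ U) (h1 : G.bt {u} {v} = 1) {A Y B : Finset V}
    (hr : G.Ring (U \ {u, v}) {u, v} 2 A Y B) :
    A ⊆ U ∧ Y ⊆ U ∧ Disjoint {u, v} A ∧ Disjoint {u, v} Y ∧ Disjoint {u, v} B ∧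
    ({u, v} : Finset V) ⊆ U ∧ #({u, v} : Finset V) = 2 ∧ U \ A = {u, v} ∪ (Y ∪ B) ∧ U \ ({u, v} ∪ A) = Y ∪ B ∧
    G.h U {u, v} = 4 ∧ G.h U A = 4 ∧ G.h U ({u, v} ∪ A) = 4 ∧ #A % 2 = 0 ∧ 2 ≤ #Y := by
  have hne : u ≠ v := by rintro rfl; rw [bt_self_zero hc.cub.nl] at h1; omega
  have hN : ({u, v} : Finset V) ⊆ U := by
    intro x; simp only [mem_insert, mem_singleton]; rintro (rfl | rfl) <;> assumption
  have hA : A ⊆ U \ {u, v} := by rw [hr.un]; intro x; simp only [mem_union]; tauto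
  have hY : Y ⊆ U \ {u, v} := by rw [hr.un]; intro x; simp only [mem_union]; tauto
  have hB : B ⊆ U \ {u, v} := by rw [hr.un]; intro x; simp only [mem_union]; tauto
  have dA : Disjoint {u, v} A := disjoint_of_subset_right hA disjoint_sdiff
  have dY : Disjoint {u, v} Y := disjoint_of_subset_right hY disjoint_sdiff
  have dB : Disjoint {u, v} B := disjoint_of_subset_right hB disjoint_sdiff
  have hUU : U = {u, v} ∪ (A ∪ Y ∪ B) := by rw [← hr.un, union_sdiff_of_subset hN]
  have eA : (U \ {u, v}) \ A = Y ∪ B := by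
    rw [hr.un]; ext x; simp only [mem_union, mem_sdiff]
    have := dl hr.dAY x
    have := dl hr.dAB x
    tauto
  have eY : (U \ {u, v}) \ Y = A ∪ B := by
    rw [hr.un]; ext x; simp only [mem_union, mem_sdiff]
    have := dl hr.dAY x
    have := dl hr.dYB x
    tauto
  have k1 := hc.hsplit hu hv hne hA
  have k2 := hc.hsplit hu hv hne hY
  rw [eA, bt_union_right _ _ hr.dYB, hr.bAY, hr.bAB, hr.nA] at k1
  rw [eY, bt_union_right _ _ hr.dAB, bt_comm, hr.bAY, bt_comm, hr.bBY, hr.nYN] at k2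
  have k3 := h_pair (G := G) hu hv hne
  rw [hc.cub.deg u hu, hc.cub.deg v hv, h1] at k3
  have k4 := h_disj G hN (hA.trans sdiff_subset) dA
  rw [bt_comm, hr.nA, k1] at k4
  have p1 := hc.par (hA.trans sdiff_subset)
  have p2 := hc.par (hY.trans sdiff_subset)
  have := hr.nY.card_pos
  refine ⟨hA.trans sdiff_subset, hY.trans sdiff_subset, dA, dY, dB, hN, card_pair hne, ?_, ?_, by omega, k1,
    by omega, by omega, by omega⟩
  · rw [hUU]; ext x; simp only [mem_union, mem_sdiff]
    have := dl hr.dAY x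
    have := dl hr.dAB x
    have := dl dA x
    grind only
  · rw [← eA]; ext x; simp only [mem_union, mem_sdiff]; tauto

/-- the graph has a ring for every edge -/
def AllR (G : Gr V E) (U : Finset V) : Prop :=
  ∀ u ∈ U, ∀ v ∈ U, G.bt {u} {v} = 1 → ∃ A Y B, G.Ring (U \ {u, v}) {u, v} 2 A Y B

/-- nontrivial 4-cuts of minimal size -/
structure Mn (G : Gr V E) (U S : Finset V) : Prop where
  sub : S ⊆ U
  h4 : G.h U S = 4
  c1 : 4 ≤ #S
  c2 : 4 ≤ #(U \ S)
  mn : ∀ T ⊆ U, G.h U T = 4 → 4 ≤ #T → 4 ≤ #(U \ T) → #S ≤ #T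

lemma exists_mn (hc : G.C4 U) (ha : AllR G U) : ∃ S, Mn G U S := by
  obtain ⟨u, hu⟩ : U.Nonempty := card_pos.1 (by have := hc.c6; omega)
  obtain ⟨v, hv, huv⟩ := exists_nbr (G := G) (x := u) (Y := U \ {u}) (by
    have := hc.cub.deg u hu; unfold h at this; omega)
  have hv := (mem_sdiff.1 hv).1
  have h1 : G.bt {u} {v} = 1 := by have := hc.bt1 hu hv; omega
  obtain ⟨A, Y, B, hr⟩ := ha u hu v hv h1
  obtain ⟨a1, a2, a3, a4, a5, a6, a7, a8, a9, a10, a11, a12, a13, a14⟩ := hc.ringfacts hu hv h1 hr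
  let Q : Finset V → Prop := fun T => T ⊆ U ∧ G.h U T = 4 ∧ 4 ≤ #T ∧ 4 ≤ #(U \ T)
  have hQ : ∃ k, ∃ T, Q T ∧ #T = k := ⟨_, _, ⟨union_subset a6 a1, a12, by
    rw [card_union_of_disjoint a3]; have := hr.cA; omega, by
    rw [a9, card_union_of_disjoint hr.dYB]; have := hr.cB; omega⟩, rfl⟩
  classical
  obtain ⟨S, hS, hk⟩ := Nat.find_spec hQ
  refine ⟨S, hS.1, hS.2.1, hS.2.2.1, hS.2.2.2, fun T b1 b2 b3 b4 => ?_⟩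
  rw [hk]
  exact Nat.find_min' hQ ⟨T, ⟨b1, b2, b3, b4⟩, rfl⟩

/-- case of a nonempty intersection -/
lemma mn_core (hc : G.C4 U) {S : Finset V} (hS : Mn G U S) {u v : V} (hu : u ∈ S) (hv : v ∈ S) (h1 : G.bt {u} {v} = 1)
    {A Y B : Finset V} (hr : G.Ring (U \ {u, v}) {u, v} 2 A Y B) (hn : (S ∩ A).Nonempty) :
    #S = 4 ∧ ∃ B ⊆ U \ S, G.bt B (S \ {u, v}) = 0 ∧ G.bt ((U \ S) \ B) {u, v} = 0 ∧ G.bt B ((U \ S) \ B) = 2 := by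
  obtain ⟨a1, a2, a3, a4, a5, a6, a7, a8, a9, a10, a11, a12, a13, a14⟩ := hc.ringfacts (hS.sub hu) (hS.sub hv) h1 hr
  obtain ⟨b1, -, -, -, -, -, -, -, -, -, -, b12, b13, -⟩ := hc.ringfacts (hS.sub hu) (hS.sub hv) h1 hr.symm
  have hNS : ({u, v} : Finset V) ⊆ S := by
    intro x; simp only [mem_insert, mem_singleton]; rintro (rfl | rfl) <;> assumption
  have hSU := hS.sub
  have ms : ∀ x, x ∈ S → x ∈ U := fun x hx => hSU hx
  have mA : ∀ x, x ∈ A → x ∈ U := fun x hx => a1 hx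
  have mB : ∀ x, x ∈ B → x ∈ U := fun x hx => b1 hx
  have mN : ∀ x, x ∈ ({u, v} : Finset V) → x ∈ S := fun x hx => hNS hx
  have dA := dl a3
  have dY := dl a4
  have dB := dl a5
  have dAY := dl hr.dAY
  have dAB := dl hr.dAB
  have dYB := dl hr.dYB
  have eUA : ∀ x, x ∈ U → x ∉ A → x ∈ ({u, v} : Finset V) ∨ x ∈ Y ∨ x ∈ B := by
    intro x hx hxA
    have : x ∈ U \ A := mem_sdiff.2 ⟨hx, hxA⟩
    rw [a8] at this
    simpa only [mem_union] using this
  have cS := card_inter_add_card_sdiff S A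
  have cA := card_inter_add_card_sdiff A S
  rw [inter_comm] at cA
  have sEv : #S % 2 = 0 := by have := hc.par hSU; rw [hS.h4] at this; omega
  have uEv := hc.evenU
  have cU := card_sdiff_add_card_eq_card hSU
  have cUn := card_union_of_disjoint (s := S) (t := A \ S) disjoint_sdiff
  rw [union_sdiff_self_eq_union] at cUn
  have sSA : S ∪ A ⊆ U := union_subset hSU a1
  have cD := card_sdiff_add_card_eq_card sSA
  have cNS : 2 ≤ #(S \ A) := by
    rw [← a7]; exact card_le_card fun x hx => mem_sdiff.2 ⟨mN x hx, dA x hx⟩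
  have hn1 := hn.card_pos
  have hc1 := hS.c1
  have hc2 := hS.c2
  rcases Nat.mod_two_eq_zero_or_one #(S ∩ A) with ev | od
  · have g1 : G.h U ({u, v} ∪ (S ∩ A)) + G.h U (S ∪ A) ≤ 8 := by
      have e1 : S ∩ ({u, v} ∪ A) = {u, v} ∪ (S ∩ A) := by
        ext x; simp only [mem_inter, mem_union]; have := mN x; grind only
      have e2 : S ∪ ({u, v} ∪ A) = S ∪ A := by
        ext x; simp only [mem_union]; have := mN x; grind only
      have := G.h_atoms hSU (union_subset a6 a1)
      rw [e1, e2] at this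
      have := hS.h4
      omega
    have dI : Disjoint {u, v} (S ∩ A) := disjoint_of_subset_right inter_subset_right a3
    have cI := card_union_of_disjoint dI
    have s1 : {u, v} ∪ (S ∩ A) ⊆ S := union_subset hNS inter_subset_left
    have hUS : U ≠ S := by rintro rfl; simp at hc2
    have g2 := hc.even4 (s1.trans hSU) (by omega) (card_pos.1 (by omega)) (fun h => by
      rw [h] at s1; exact hUS (Subset.antisymm s1 hSU))
    have hSAne : S ∪ A ≠ U := by
      intro hSA
      have hBS : {u, v} ∪ B ⊆ S := by
        intro x; simp only [mem_union]
        intro hx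
        have z1 := mN x; have z2 := dAB x; have z3 := mB x
        have z4 : x ∈ U → x ∈ S ∪ A := fun h => by rw [hSA]; exact h
        rw [mem_union] at z4
        grind only
      have hYS : Y ⊆ S := by
        intro x hx
        have z4 : x ∈ S ∪ A := by rw [hSA]; exact a2 hx
        rw [mem_union] at z4
        have := dAY x
        tauto
      have dd : Disjoint ({u, v} ∪ B) Y := disjoint_union_left.2 ⟨a4, hr.dYB.symm⟩
      have cc := card_union_of_disjoint dd
      have := card_le_card (union_subset hBS hYS)
      have t1 := card_union_of_disjoint a5
      have t2 := hr.cB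
      have t3 := hr.cA
      have t4 : A ∪ Y ⊆ U \ ({u, v} ∪ B) := by
        intro x; simp only [mem_union, mem_sdiff]
        have := dA x; have := dY x; have := dAB x; have := dYB x; have := mA x
        have : x ∈ Y → x ∈ U := fun h => a2 h
        grind only
      have t5 := card_le_card t4
      rw [card_union_of_disjoint hr.dAY] at t5
      have := hS.mn _ (union_subset a6 b1) b12 (by omega) (by omega)
      omega
    have g3 := hc.even4 sSA (by omega) ⟨u, by simp [hu]⟩ hSAne
    have g4 := card_le_card (sdiff_subset_sdiff (Subset.refl U) s1)
    have g5 := hS.mn _ (s1.trans hSU) (by omega) (by omega) (by omega)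
    have g6 : {u, v} ∪ (S ∩ A) = S := eq_of_subset_of_card_le s1 g5
    have sI : S ∩ A ⊆ U := inter_subset_right.trans a1
    have g7 := G.h_disj a6 sI dI
    have g8 := hc.even4 sI ev hn (by
      rintro h; exact hUS (Subset.antisymm (by rw [← h]; exact inter_subset_left) hSU))
    have g9 := bt_mono_right G {u, v} (inter_subset_right (s₁ := S) (s₂ := A))
    have g10 := hr.nA
    rw [bt_comm] at g10
    rw [g6, hS.h4] at g7
    have g11 : #(S ∩ A) = 2 := by
      by_contra hcon
      have q1 := card_le_card (sdiff_subset_sdiff (Subset.refl U) (inter_subset_left (s₁ := S) (s₂ := A)))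
      have := hS.mn _ sI (by omega) (by omega) (by omega)
      rw [g6] at cI
      omega
    refine ⟨by rw [g6] at cI; omega, B, ?_, ?_, ?_, ?_⟩
    · intro x hx
      rw [mem_sdiff]
      refine ⟨mB x hx, ?_⟩
      rw [← g6, mem_union, mem_inter]
      have := dB x; have := dAB x
      tauto
    · have := bt_mono_right G B (show S \ {u, v} ⊆ A by
        intro x; rw [← g6, mem_sdiff, mem_union, mem_inter]; tauto)
      rw [bt_comm G B A, hr.bAB] at this
      omega
    · have q1 : (U \ S) \ B ⊆ (A \ (S ∩ A)) ∪ Y := by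
        intro x; simp only [mem_sdiff, mem_union, mem_inter]
        have := eUA x; have := mN x
        grind only
      have q2 := bt_mono_left G q1 {u, v}
      have q3 := bt_split_left G {u, v} (inter_subset_right (s₁ := S) (s₂ := A))
      rw [bt_union_left G (disjoint_of_subset_left sdiff_subset hr.dAY), hr.nYN] at q2
      rw [hr.nA, bt_comm G (S ∩ A)] at q3
      omega
    · have q1 : (U \ S) \ B = (A \ (S ∩ A)) ∪ Y := by
        ext x; simp only [mem_sdiff, mem_union, mem_inter]
        have z1 : x ∈ S → x ∈ ({u, v} : Finset V) ∨ x ∈ S ∩ A := fun h => by rw [← mem_union, g6]; exact h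
        rw [mem_inter] at z1
        have := eUA x; have := mN x; have := mA x; have := dAB x; have := dYB x; have := dY x; have := dAY x
        have : x ∈ Y → x ∈ U := fun h => a2 h
        grind only
      rw [q1, bt_union_right G _ (disjoint_of_subset_left sdiff_subset hr.dAY), hr.bBY]
      have := bt_mono_right G B (sdiff_subset (s := A) (t := S ∩ A))
      rw [bt_comm G B A, hr.bAB] at this
      omega
  · exfalso
    have k := G.h_atoms hSU a1
    have hdd : #(U \ (S \ A)) + #(S \ A) = #U := card_sdiff_add_card_eq_card (sdiff_subset.trans hSU)
    have hdd' : #(U \ (A \ S)) + #(A \ S) = #U := card_sdiff_add_card_eq_card (sdiff_subset.trans a1)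
    have hdd2 : #(U \ (S ∩ A)) + #(S ∩ A) = #U := card_sdiff_add_card_eq_card (inter_subset_left.trans hSU)
    have s4 := hS.h4
    have k1 := hc.odd5 (sdiff_subset.trans hSU : S \ A ⊆ U) (by omega) (by omega) (by omega)
    have k2 : #(A \ S) = 1 := by
      by_contra hcon
      have := hc.odd5 (sdiff_subset.trans a1 : A \ S ⊆ U) (by omega) (by omega) (by omega)
      omega
    have k3 := hc.odd5 sSA (by omega) (by omega) (by omega)
    have k4 : #(S ∩ A) = 1 := by
      by_contra hcon
      have := hc.odd5 (inter_subset_left.trans hSU : S ∩ A ⊆ U) (by omega) (by omega) (by omega)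
      omega
    have k5 := hc.cub.cut3 _ (inter_subset_left.trans hSU : S ∩ A ⊆ U) hn (by intro h; rw [h] at k4; omega)
    have k6 : G.bt (S \ A) (A \ S) = 0 := by omega
    obtain ⟨x, hx⟩ := card_eq_one.1 k4
    have hxx : x ∈ S ∩ A := by rw [hx]; simp
    rw [mem_inter] at hxx
    have k7 := bt_split_left G {u, v} (inter_subset_right (s₁ := S) (s₂ := A))
    have k8 : A \ (S ∩ A) = A \ S := by ext y; simp only [mem_sdiff, mem_inter]; tauto
    have k9 := bt_mono_left G (show {u, v} ⊆ S \ A from fun x hx => mem_sdiff.2 ⟨mN x hx, dA x hx⟩) (A \ S)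
    rw [bt_comm] at k9
    rw [k8, hr.nA, hx] at k7
    have hxN : x ∉ ({u, v} : Finset V) := fun h => dA x h hxx.2
    simp only [mem_insert, mem_singleton, not_or] at hxN
    have := hc.tri (hSU hu) (hSU hv) (hSU hxx.1) (by omega) hxN.1 hxN.2
    omega

lemma mn_edge (hc : G.C4 U) (ha : AllR G U) {S : Finset V} (hS : Mn G U S) {u v : V} (hu : u ∈ S) (hv : v ∈ S)
    (h1 : G.bt {u} {v} = 1) :
    #S = 4 ∧ ∃ B ⊆ U \ S, G.bt B (S \ {u, v}) = 0 ∧ G.bt ((U \ S) \ B) {u, v} = 0 ∧ G.bt B ((U \ S) \ B) = 2 := by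
  obtain ⟨A, Y, B, hr⟩ := ha u (hS.sub hu) v (hS.sub hv) h1
  rcases (S ∩ A).eq_empty_or_nonempty with eA | hn
  · rcases (S ∩ B).eq_empty_or_nonempty with eB | hn
    · exfalso
      obtain ⟨a1, a2, a3, a4, a5, a6, a7, a8, a9, a10, a11, a12, a13, a14⟩ := hc.ringfacts (hS.sub hu) (hS.sub hv) h1 hr
      have hNS : ({u, v} : Finset V) ⊆ S := by
        intro x; simp only [mem_insert, mem_singleton]; rintro (rfl | rfl) <;> assumption
      have dI : Disjoint {u, v} (S ∩ Y) := disjoint_of_subset_right inter_subset_right a4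
      have e : S = {u, v} ∪ (S ∩ Y) := by
        refine Subset.antisymm ?_ (union_subset hNS inter_subset_left)
        intro x hx
        have z1 : x ∉ A := fun h => notMem_empty x (eA ▸ mem_inter.2 ⟨hx, h⟩)
        have z2 : x ∉ B := fun h => notMem_empty x (eB ▸ mem_inter.2 ⟨hx, h⟩)
        have z3 : x ∈ U \ A := mem_sdiff.2 ⟨hS.sub hx, z1⟩
        rw [a8] at z3
        simp only [mem_union, mem_inter] at z3 ⊢
        tauto
      have c := card_union_of_disjoint dI
      rw [← e] at c
      have k := G.h_disj a6 (inter_subset_right.trans a2 : S ∩ Y ⊆ U) dI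
      rw [← e, hS.h4] at k
      have k2 := bt_mono_left G (inter_subset_right (s₁ := S) (s₂ := Y)) {u, v}
      rw [hr.nYN, bt_comm] at k2
      have := hS.c1
      have := hc.cub.cut3 _ (inter_subset_right.trans a2 : S ∩ Y ⊆ U) (card_pos.1 (by omega)) (by
        intro h
        have : u ∈ S ∩ Y := by rw [h]; exact hS.sub hu
        exact disjoint_left.1 dI (by simp) this)
      omega
    · exact hc.mn_core hS hu hv h1 hr.symm hn
  · exact hc.mn_core hS hu hv h1 hr hn

end C4

end Gr

end Step4b

end CubicFlow

namespace CubicFlow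

section Step4c

variable {V E : Type} [Fintype V] [DecidableEq V] [DecidableEq E]

/-- edges of the cube -/
def cubeL : List (ℕ × ℕ) :=
  [(0, 1), (1, 3), (3, 2), (2, 0), (0, 4), (1, 5), (2, 6), (3, 7), (4, 5), (5, 7), (7, 6), (6, 4)]

namespace Gr

variable {G : Gr V E}

namespace C4

variable {U : Finset V}

/-- four vertices of the minimal set -/
lemma mn_leg (hc : G.C4 U) {S : Finset V} (hS : Mn G U S) (h4 : #S = 4) : ∀ x ∈ S, G.bt {x} (U \ S) = 1 := by
  have hle : ∀ x ∈ S, G.bt {x} (U \ S) ≤ 1 := by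
    intro x hx
    have hxS : ({x} : Finset V) ⊆ S := by simpa using hx
    have k1 := G.h_disj (sdiff_subset.trans hS.sub : S \ {x} ⊆ U) (hxS.trans hS.sub) sdiff_disjoint
    rw [sdiff_union_of_subset hxS, hS.h4, hc.cub.deg x (hS.sub hx), bt_comm] at k1
    have c := card_sdiff_add_card_eq_card hxS
    rw [card_singleton] at c
    have c2 := card_le_card (sdiff_subset_sdiff (Subset.refl U) (sdiff_subset (s := S) (t := {x})))
    have := hS.c2
    have k2 := hc.odd5 (sdiff_subset.trans hS.sub : S \ {x} ⊆ U) (by omega) (by omega) (by omega)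
    have k3 := hc.cub.deg x (hS.sub hx)
    unfold h at k3
    have hd : Disjoint (S \ {x}) (U \ S) := disjoint_of_subset_left sdiff_subset disjoint_sdiff
    rw [show U \ {x} = (S \ {x}) ∪ (U \ S) by
      ext y; simp only [mem_sdiff, mem_union, mem_singleton]
      have : y ∈ S → y ∈ U := fun h => hS.sub h
      have : y = x → y ∈ S := by rintro rfl; exact hx
      tauto, bt_union_right _ _ hd] at k3
    omega
  have h5 := hS.h4
  unfold h at h5
  rw [bt_sum] at h5
  intro x hx
  by_contra hcon
  have h6 : ∑ y ∈ S, G.bt {y} (U \ S) < ∑ y ∈ S, 1 :=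
    sum_lt_sum hle ⟨x, hx, by have := hle x hx; omega⟩
  simp at h6
  omega

lemma four (hc : G.C4 U) {S : Finset V} (hS : Mn G U S) (h4 : #S = 4) : ∃ u v a b,
    S = {u, v, a, b} ∧ u ≠ v ∧ u ≠ a ∧ u ≠ b ∧ v ≠ a ∧ v ≠ b ∧ a ≠ b ∧
    G.bt {u} {v} = 1 ∧ G.bt {u} {a} = 1 ∧ G.bt {v} {b} = 1 ∧ G.bt {b} {a} = 1 := by
  have hleg := hc.mn_leg hS h4
  obtain ⟨u, hu⟩ : S.Nonempty := card_pos.1 (by omega)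
  have hin : ∀ x ∈ S, G.bt {x} (S \ {x}) = 2 := by
    intro x hx
    have k3 := hc.cub.deg x (hS.sub hx)
    unfold h at k3
    have hd : Disjoint (S \ {x}) (U \ S) := disjoint_of_subset_left sdiff_subset disjoint_sdiff
    rw [show U \ {x} = (S \ {x}) ∪ (U \ S) by
      ext y; simp only [mem_sdiff, mem_union, mem_singleton]
      have : y ∈ S → y ∈ U := fun h => hS.sub h
      have : y = x → y ∈ S := by rintro rfl; exact hx
      tauto, bt_union_right _ _ hd, hleg x hx] at k3
    omega
  obtain ⟨v, hv, huv⟩ := exists_nbr (G := G) (x := u) (Y := S \ {u}) (by have := hin u hu; omega)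
  have huv1 : G.bt {u} {v} = 1 := by
    have := hc.bt1 (hS.sub hu) (hS.sub (mem_sdiff.1 hv).1); omega
  have k1 := bt_split G {u} (show {v} ⊆ S \ {u} by simpa using hv)
  rw [hin u hu, huv1] at k1
  obtain ⟨a, ha, hua⟩ := exists_nbr (G := G) (x := u) (Y := (S \ {u}) \ {v}) (by omega)
  simp only [mem_sdiff, mem_singleton] at hv ha
  obtain ⟨hvS, hvu⟩ := hv
  obtain ⟨⟨haS, hau⟩, hav⟩ := ha
  have hua1 : G.bt {u} {a} = 1 := by
    have := hc.bt1 (hS.sub hu) (hS.sub haS); omega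
  have hsub : ({u, v, a} : Finset V) ⊆ S := by
    intro x; simp only [mem_insert, mem_singleton]; rintro (rfl | rfl | rfl) <;> assumption
  have c3 : #({u, v, a} : Finset V) = 3 := card_eq_three.2 ⟨u, v, a, hvu ∘ Eq.symm, hau ∘ Eq.symm, hav ∘ Eq.symm, rfl⟩
  obtain ⟨b, hb⟩ := card_eq_one.1 (show #(S \ {u, v, a}) = 1 by
    have := card_sdiff_add_card_eq_card hsub; omega)
  have hbm : b ∈ S \ {u, v, a} := by rw [hb]; simp
  simp only [mem_sdiff, mem_insert, mem_singleton, not_or] at hbm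
  obtain ⟨hbS, hbu, hbv, hba⟩ := hbm
  have eS : S = {u, v, a, b} := by
    rw [← union_sdiff_of_subset hsub, hb]
    ext x; simp only [mem_union, mem_insert, mem_singleton]; tauto
  have k2 : G.bt {a} {v} = 0 := hc.tri' (hS.sub hu) (hS.sub hvS) (hS.sub haS) (by omega) (by rw [bt_comm]; omega)
  have three : ∀ x y z w : V, S = {x, y, z, w} → x ≠ y → x ≠ z → x ≠ w → y ≠ z → y ≠ w → z ≠ w →
      G.bt {x} {y} + G.bt {x} {z} + G.bt {x} {w} = 2 := by
    intro x y z w e h1 h2 h3 h4 h5 h6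
    have := hin x (by rw [e]; simp)
    rw [show S \ {x} = ({y} ∪ {z}) ∪ {w} by
      rw [e]; ext t; simp only [mem_sdiff, mem_insert, mem_singleton, mem_union]; grind only,
      bt_union_right _ _ (by simp; tauto), bt_union_right _ _ (by simpa using h4)] at this
    exact this
  have k3 := three v u a b (by rw [eS]; ext x; simp only [mem_insert, mem_singleton]; tauto) hvu
    (Ne.symm hav) (Ne.symm hbv) (Ne.symm hau) (Ne.symm hbu) (Ne.symm hba)
  have k4 := three a u v b (by rw [eS]; ext x; simp only [mem_insert, mem_singleton]; tauto) hau
    hav (Ne.symm hba) (Ne.symm hvu) (Ne.symm hbu) (Ne.symm hbv)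
  rw [bt_comm G {v} {u}, bt_comm G {v} {a}] at k3
  rw [bt_comm G {a} {u}, bt_comm G {a} {b}] at k4
  exact ⟨u, v, a, b, eS, Ne.symm hvu, Ne.symm hau, Ne.symm hbu, Ne.symm hav, Ne.symm hbv, Ne.symm hba, huv1, hua1,
    by omega, by omega⟩

lemma one_of_three (hc : G.C4 U) {X : Finset V} (hX : X ⊆ U) (h : G.h U X = 3) (hn : X.Nonempty) (h2 : 2 ≤ #(U \ X)) :
    ∃ x, X = {x} := by
  rw [← card_eq_one]
  by_contra hcon
  have := hc.c4 X hX (by have := hn.card_pos; omega) h2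
  omega

lemma cube_end {u v a b u' v' a' b' : V} (h8 : #U = 8) (eU : U = {u, v, a, b, u', v', a', b'})
    (h : 0 < G.bt {u} {v} ∧ 0 < G.bt {v} {b} ∧ 0 < G.bt {b} {a} ∧ 0 < G.bt {a} {u} ∧
      0 < G.bt {u} {u'} ∧ 0 < G.bt {v} {v'} ∧ 0 < G.bt {a} {a'} ∧ 0 < G.bt {b} {b'} ∧
      0 < G.bt {u'} {v'} ∧ 0 < G.bt {v'} {b'} ∧ 0 < G.bt {b'} {a'} ∧ 0 < G.bt {a'} {u'}) :
    #U = 8 ∧ ∃ f : ℕ → V, U = (range 8).image f ∧ ∀ p ∈ cubeL, 0 < G.bt {f p.1} {f p.2} := by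
  refine ⟨h8, fun n => [u, v, a, b, u', v', a', b'].getD n u, ?_, ?_⟩
  · rw [eU]
    ext x
    simp only [mem_insert, mem_singleton, mem_image, mem_range]
    constructor
    · rintro (h | h | h | h | h | h | h | h)
      exacts [⟨0, by omega, h.symm⟩, ⟨1, by omega, h.symm⟩, ⟨2, by omega, h.symm⟩, ⟨3, by omega, h.symm⟩,
        ⟨4, by omega, h.symm⟩, ⟨5, by omega, h.symm⟩, ⟨6, by omega, h.symm⟩, ⟨7, by omega, h.symm⟩]
    · rintro ⟨n, hn, rfl⟩
      interval_cases n <;> simp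
  · simp only [cubeL, List.forall_mem_cons]
    obtain ⟨h1, h2, h3, h4, h5, h6, h7, h8, h9, h10, h11, h12⟩ := h
    exact ⟨h1, h2, h3, h4, h5, h6, h7, h8, h9, h10, h11, h12, by simp⟩

lemma cube_arith1 {uu uv ua ub vu vv va vb au av aa ab bu bv ba bb : ℕ}
    (p1 : uu * 0 + (ua + va + (ub + vb)) = 0) (p2 : au + bu + (av + bv) = 0)
    (r1 : uv + av + (ub + ab) = 0) (r2 : vu + bu + (va + ba) = 0)
    (l1 : uu + vu + au + bu = 1) (l2 : uv + vv + av + bv = 1) (l3 : ua + va + aa + ba = 1)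
    (l4 : ub + vb + ab + bb = 1) :
    uu = 1 ∧ vv = 1 ∧ aa = 1 ∧ bb = 1 ∧ uu + uv + ua + ub = 1 ∧ vu + vv + va + vb = 1 ∧ au + av + aa + ab = 1 ∧
      bu + bv + ba + bb = 1 := by
  omega

lemma cube_arith2 {uv ua ub va vb ab : ℕ} (p3 : ua + ub + (va + vb) = 2) (r3 : uv + ub + (va + ab) = 2)
    (h1 : 3 ≤ 1 + uv + ua + ub) (h2 : 3 ≤ 1 + uv + va + vb) (h3 : 3 ≤ 1 + ua + va + ab) (h4 : 3 ≤ 1 + ub + vb + ab) :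
    uv = 1 ∧ ua = 1 ∧ ub = 0 ∧ va = 0 ∧ vb = 1 ∧ ab = 1 := by
  omega

set_option maxHeartbeats 1000000 in
lemma cube (hc : G.C4 U) (ha : AllR G U) :
    #U = 8 ∧ ∃ f : ℕ → V, U = (range 8).image f ∧ ∀ p ∈ cubeL, 0 < G.bt {f p.1} {f p.2} := by
  obtain ⟨S, hS⟩ := hc.exists_mn ha
  have hSU := hS.sub
  have h4 : #S = 4 := by
    have k : 0 < G.bt S S := by
      have k1 : G.bt S U = 3 * #S := by
        rw [bt_sum, Finset.sum_congr rfl (fun v hv => by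
          rw [← h_single hc.cub.nl (hSU hv), hc.cub.deg v (hSU hv)])]
        simp [mul_comm]
      have k2 := bt_split G S hSU
      have k3 := hS.h4
      have := hS.c1
      unfold h at k3
      omega
    rw [bt_sum] at k
    obtain ⟨x, hx, hxp⟩ := exists_ne_zero_of_sum_ne_zero (by omega : ∑ v ∈ S, G.bt {v} S ≠ 0)
    obtain ⟨y, hy, hxy⟩ := exists_nbr (G := G) (Nat.pos_of_ne_zero hxp)
    exact (hc.mn_edge ha hS hx hy (by have := hc.bt1 (hSU hx) (hSU hy); omega)).1
  obtain ⟨u, v, a, b, eS, uv, ua, ub, va, vb, ab, huv, hua, hvb, hba⟩ := hc.four hS h4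
  have hu : u ∈ S := by rw [eS]; simp
  have hv : v ∈ S := by rw [eS]; simp
  have haS : a ∈ S := by rw [eS]; simp
  have hb : b ∈ S := by rw [eS]; simp
  obtain ⟨-, B1, s1, p1, p2, p3⟩ := hc.mn_edge ha hS hu hv huv
  obtain ⟨-, B2, s2, r1, r2, r3⟩ := hc.mn_edge ha hS hu haS hua
  have hleg := hc.mn_leg hS h4
  set Z := U \ S with hZ
  have hZU : Z ⊆ U := sdiff_subset
  rw [show S \ {u, v} = {a} ∪ {b} by
    rw [eS]; ext x; simp only [mem_sdiff, mem_insert, mem_singleton, mem_union]; grind only,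
    bt_union_right _ _ (by simpa using ab)] at p1
  rw [show S \ {u, a} = {v} ∪ {b} by
    rw [eS]; ext x; simp only [mem_sdiff, mem_insert, mem_singleton, mem_union]; grind only,
    bt_union_right _ _ (by simpa using vb)] at r1
  rw [insert_eq, bt_union_right _ _ (by simpa using uv)] at p2
  rw [insert_eq, bt_union_right _ _ (by simpa using ua)] at r2
  obtain ⟨Qv, Qa, Qu, Qb, eQv, eQa, eQu, eQb, dva, dvu, dvb, dau, dab, dub⟩ := sep4 s1 s2
  have eB1 : B1 = Qu ∪ Qv := by rw [eQu, eQv]; ext x; simp only [mem_sdiff, mem_inter, mem_union]; tauto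
  have eB2 : B2 = Qu ∪ Qa := by rw [eQu, eQa]; ext x; simp only [mem_sdiff, mem_inter, mem_union]; tauto
  have eB1' : Z \ B1 = Qa ∪ Qb := by
    rw [eQa, eQb]; ext x; simp only [mem_sdiff, mem_inter, mem_union]
    have := @s1 x; have := @s2 x; tauto
  have eB2' : Z \ B2 = Qv ∪ Qb := by
    rw [eQv, eQb]; ext x; simp only [mem_sdiff, mem_inter, mem_union]
    have := @s1 x; have := @s2 x; tauto
  have eZ : Z = ((Qu ∪ Qv) ∪ Qa) ∪ Qb := by
    rw [union_assoc, ← eB1', ← eB1, union_sdiff_of_subset s1]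
  have legs : ∀ x ∈ S, G.bt Qu {x} + G.bt Qv {x} + G.bt Qa {x} + G.bt Qb {x} = 1 := by
    intro x hx
    have := hleg x hx
    rw [bt_comm, eZ, bt_union_left _ (by simp only [disjoint_union_left]; exact ⟨⟨dub, dvb⟩, dab⟩),
      bt_union_left _ (by simp only [disjoint_union_left]; exact ⟨dau.symm, dva⟩),
      bt_union_left _ dvu.symm] at this
    exact this
  have l1 := legs u hu
  have l2 := legs v hv
  have l3 := legs a haS
  have l4 := legs b hb
  rw [eB1', eB1, bt_union_left _ dvu.symm, bt_union_right _ _ dab, bt_union_right _ _ dab] at p3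
  rw [eB2', eB2, bt_union_left _ dau.symm, bt_union_right _ _ dvb, bt_union_right _ _ dvb] at r3
  rw [eB1', bt_union_left _ dab, bt_union_left _ dab] at p2
  rw [eB2', bt_union_left _ dvb, bt_union_left _ dvb] at r2
  rw [eB1, bt_union_left _ dvu.symm, bt_union_left _ dvu.symm] at p1
  rw [eB2, bt_union_left _ dau.symm, bt_union_left _ dau.symm] at r1
  have hSd : ∀ X : Finset V, G.bt X S = G.bt X {u} + G.bt X {v} + G.bt X {a} + G.bt X {b} := by
    intro X
    rw [eS, insert_eq, bt_union_right _ _ (by simp; tauto), insert_eq, bt_union_right _ _ (by simp; tauto), insert_eq,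
      bt_union_right _ _ (by simpa using ab)]
    omega
  have cutQ : ∀ Q1 Q2 Q3 Q4 : Finset V, Z = ((Q1 ∪ Q2) ∪ Q3) ∪ Q4 → Disjoint Q1 Q2 → Disjoint Q1 Q3 → Disjoint Q1 Q4 →
      Disjoint Q2 Q3 → Disjoint Q2 Q4 → Disjoint Q3 Q4 →
      G.h U Q1 = G.bt Q1 S + G.bt Q1 Q2 + G.bt Q1 Q3 + G.bt Q1 Q4 := by
    intro Q1 Q2 Q3 Q4 e d12 d13 d14 d23 d24 d34
    have hz : ∀ x, x ∈ Q2 ∨ x ∈ Q3 ∨ x ∈ Q4 → x ∉ S := by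
      intro x hx hxS
      have : x ∈ Z := by rw [e]; simp only [mem_union]; tauto
      exact (mem_sdiff.1 this).2 hxS
    have hz1 : ∀ x, x ∈ Q1 → x ∉ S := by
      intro x hx hxS
      have : x ∈ Z := by rw [e]; simp only [mem_union]; tauto
      exact (mem_sdiff.1 this).2 hxS
    have e2 : U \ Q1 = ((S ∪ Q2) ∪ Q3) ∪ Q4 := by
      rw [← union_sdiff_of_subset hSU, ← hZ, e]
      ext x; simp only [mem_sdiff, mem_union]
      have := hz1 x; have := dl d12 x; have := dl d13 x; have := dl d14 x
      grind only
    unfold h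
    rw [e2, bt_union_right _ _ (by
      simp only [disjoint_union_left]
      exact ⟨⟨disjoint_left.2 fun x hx hx' => hz x (by tauto) hx, d24⟩, d34⟩), bt_union_right _ _ (by
      simp only [disjoint_union_left]
      exact ⟨disjoint_left.2 fun x hx hx' => hz x (by tauto) hx, d23⟩), bt_union_right _ _
      (disjoint_left.2 fun x hx hx' => hz x (by tauto) hx)]
  have cu := cutQ Qu Qv Qa Qb eZ dvu.symm dau.symm dub dva dvb dab
  have cv := cutQ Qv Qu Qa Qb (by rw [eZ, union_comm Qu Qv]) dvu dva dvb dau.symm dub dab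
  have ca := cutQ Qa Qu Qv Qb (by rw [eZ]; ext x; simp only [mem_union]; tauto) dau dva.symm dab dvu.symm dub dvb
  have cb := cutQ Qb Qu Qv Qa (by rw [eZ]; ext x; simp only [mem_union]; tauto) dub.symm dvb.symm dab.symm
    dvu.symm dau.symm dva
  have aa := cube_arith1 (uu := G.bt Qu {u}) (by rw [mul_zero, zero_add]; exact p1) p2 r1 r2 l1 l2 l3 l4
  rw [← hSd, ← hSd, ← hSd, ← hSd] at aa
  obtain ⟨x1, x2, x3, x4, x5, x6, x7, x8⟩ := aa
  clear p1 p2 r1 r2 l1 l2 l3 l4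
  rw [x5] at cu
  rw [x6, bt_comm G Qv Qu] at cv
  rw [x7, bt_comm G Qa Qu, bt_comm G Qa Qv] at ca
  rw [x8, bt_comm G Qb Qu, bt_comm G Qb Qv, bt_comm G Qb Qa] at cb
  have nQ : ∀ (Q : Finset V) (x : V), G.bt Q {x} ≠ 0 → Q.Nonempty := by
    intro Q x hx; rw [nonempty_iff_ne_empty]; rintro rfl; simp at hx
  have nu := nQ Qu u (by rw [x1]; simp)
  have nv := nQ Qv v (by rw [x2]; simp)
  have na := nQ Qa a (by rw [x3]; simp)
  have nb := nQ Qb b (by rw [x4]; simp)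
  have sQu : Qu ⊆ Z := by rw [eZ]; intro x; simp only [mem_union]; tauto
  have sQv : Qv ⊆ Z := by rw [eZ]; intro x; simp only [mem_union]; tauto
  have sQa : Qa ⊆ Z := by rw [eZ]; intro x; simp only [mem_union]; tauto
  have sQb : Qb ⊆ Z := by rw [eZ]; intro x; simp only [mem_union]; tauto
  have com : ∀ Q : Finset V, Q ⊆ Z → 4 ≤ #(U \ Q) := by
    intro Q hQ
    rw [← h4]
    exact card_le_card fun x hx => mem_sdiff.2 ⟨hSU hx, fun h => (mem_sdiff.1 (hQ h)).2 hx⟩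
  have cut : ∀ Q : Finset V, Q ⊆ Z → Q.Nonempty → 3 ≤ G.h U Q := fun Q hQ hn =>
    hc.cub.cut3 Q (hQ.trans hZU) hn (by rintro rfl; have := com _ hQ; simp at this)
  have t1 := cut Qu sQu nu
  have t2 := cut Qv sQv nv
  have t3 := cut Qa sQa na
  have t4 := cut Qb sQb nb
  rw [cu] at t1
  rw [cv] at t2
  rw [ca] at t3
  rw [cb] at t4
  rw [bt_comm G Qa Qv] at r3
  obtain ⟨y1, y2, y3, y4, y5, y6⟩ := cube_arith2 p3 r3 t1 t2 t3 t4
  rw [y1, y2, y3] at cu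
  rw [y1, y4, y5] at cv
  rw [y2, y4, y6] at ca
  rw [y3, y5, y6] at cb
  obtain ⟨u', hu'⟩ := hc.one_of_three (sQu.trans hZU) cu nu ((by norm_num : 2 ≤ 4).trans (com _ sQu))
  obtain ⟨v', hv'⟩ := hc.one_of_three (sQv.trans hZU) cv nv ((by norm_num : 2 ≤ 4).trans (com _ sQv))
  obtain ⟨a', ha'⟩ := hc.one_of_three (sQa.trans hZU) ca na ((by norm_num : 2 ≤ 4).trans (com _ sQa))
  obtain ⟨b', hb'⟩ := hc.one_of_three (sQb.trans hZU) cb nb ((by norm_num : 2 ≤ 4).trans (com _ sQb))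
  have cZ : #Z = 4 := by
    rw [eZ, card_union_of_disjoint (by simp only [disjoint_union_left]; exact ⟨⟨dub, dvb⟩, dab⟩),
      card_union_of_disjoint (by simp only [disjoint_union_left]; exact ⟨dau.symm, dva⟩),
      card_union_of_disjoint dvu.symm, hu', hv', ha', hb']
    simp
  have eU : U = S ∪ Z := by rw [hZ, union_sdiff_of_subset hSU]
  clear_value Z
  have q1 : 0 < G.bt Qu Qv := by rw [y1]; exact one_pos
  have q2 : 0 < G.bt Qv Qb := by rw [y5]; exact one_pos
  have q3 : 0 < G.bt Qb Qa := by rw [bt_comm, y6]; exact one_pos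
  have q4 : 0 < G.bt Qa Qu := by rw [bt_comm, y2]; exact one_pos
  have w1 : 0 < G.bt Qu {u} := by rw [x1]; exact one_pos
  have w2 : 0 < G.bt Qv {v} := by rw [x2]; exact one_pos
  have w3 : 0 < G.bt Qa {a} := by rw [x3]; exact one_pos
  have w4 : 0 < G.bt Qb {b} := by rw [x4]; exact one_pos
  rw [hu', hv'] at q1
  rw [hv', hb'] at q2
  rw [hb', ha'] at q3
  rw [ha', hu'] at q4
  rw [hu', bt_comm] at w1
  rw [hv', bt_comm] at w2
  rw [ha', bt_comm] at w3
  rw [hb', bt_comm] at w4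
  rw [bt_comm] at hua
  have hU8 : #U = 8 := by
    have := card_sdiff_add_card_eq_card hSU
    rw [← hZ, cZ, h4] at this
    exact this.symm
  have eU' : U = {u, v, a, b, u', v', a', b'} := by
    rw [eU, eS, eZ, hu', hv', ha', hb']
    ext x
    simp only [mem_union, mem_insert, mem_singleton, or_assoc]
  exact cube_end hU8 eU' ⟨huv ▸ one_pos, hvb ▸ one_pos, hba ▸ one_pos, hua ▸ one_pos, w1, w2, w3, w4, q1, q2, q3, q4⟩

end C4

end Gr

end Step4c

end CubicFlow

namespace CubicFlow

section Eval

variable {V E : Type} [Fintype V] [DecidableEq V] [DecidableEq E]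

/-- value of a polynomial given by its coefficients -/
noncomputable def ev (q : ℝ) : List ℤ → ℝ
  | [] => 0
  | a :: p => a + q * ev q p

/-- difference of polynomials -/
def lsub : List ℤ → List ℤ → List ℤ
  | [], r => r.map Neg.neg
  | a :: p, [] => a :: p
  | a :: p, b :: r => (a - b) :: lsub p r

lemma ev_neg (q : ℝ) : ∀ r : List ℤ, ev q (r.map Neg.neg) = - ev q r
  | [] => by simp [ev]
  | b :: r => by simp [ev, ev_neg q r]; ring

lemma ev_lsub (q : ℝ) : ∀ p r : List ℤ, ev q (lsub p r) = ev q p - ev q r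
  | [], r => by simp [lsub, ev, ev_neg]
  | a :: p, [] => by simp [lsub, ev]
  | a :: p, b :: r => by simp [lsub, ev, ev_lsub q p r]; ring

/-- relabelling -/
def rl (i j x : ℕ) : ℕ := if x = i then j else x

/-- flow polynomial by deletion and contraction -/
def fl : ℕ → List (ℕ × ℕ) → List ℤ
  | 0, _ => [1]
  | _ + 1, [] => [1]
  | k + 1, (i, j) :: l =>
    if i = j then lsub (0 :: fl k l) (fl k l)
    else lsub (fl k (l.map fun p => (rl i j p.1, rl i j p.2))) (fl k l)

lemma rl_lt {i j x n : ℕ} (hj : j < n) (hx : x < n) : rl i j x < n := by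
  unfold rl; split_ifs <;> assumption

lemma phi_list (q : ℝ) {f : ℕ → V} {n : ℕ} (hf : ∀ i < n, ∀ j < n, f i = f j → i = j) :
    ∀ (k : ℕ) (L : List (E × ℕ × ℕ)) (s t : E → V), L.length = k → (L.map Prod.fst).Nodup →
      (∀ x ∈ L, x.2.1 < n ∧ x.2.2 < n ∧ ((s x.1 = f x.2.1 ∧ t x.1 = f x.2.2) ∨ (s x.1 = f x.2.2 ∧ t x.1 = f x.2.1))) →
      phi q s t (L.map Prod.fst).toFinset = ev q (fl k (L.map Prod.snd)) := by
  intro k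
  induction k with
  | zero =>
    intro L s t hL _ _
    rw [List.length_eq_zero_iff] at hL
    subst hL
    simp [phi_empty, fl, ev]
  | succ k ih =>
    intro L s t hL hnd hst
    match L, hL, hnd, hst with
    | (e, i, j) :: L, hL, hnd, hst =>
      simp only [List.length_cons, Nat.add_right_cancel_iff] at hL
      simp only [List.map_cons, List.nodup_cons] at hnd
      simp only [List.forall_mem_cons] at hst
      obtain ⟨⟨hi, hj, h1⟩, hst⟩ := hst
      have her : (((e, i, j) :: L).map Prod.fst).toFinset.erase e = (L.map Prod.fst).toFinset := by
        simp only [List.map_cons, List.toFinset_cons]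
        rw [erase_insert]
        simpa only [List.mem_toFinset] using hnd.1
      have hmem : e ∈ (((e, i, j) :: L).map Prod.fst).toFinset := by simp
      have hdel := ih L s t hL hnd.2 hst
      simp only [List.map_cons, fl]
      by_cases hij : i = j
      · subst hij
        rw [if_pos rfl, ev_lsub, ← List.map_cons (f := Prod.fst) (a := (e, i, i)), phi_loop q s t hmem (by
          rcases h1 with ⟨a, b⟩ | ⟨a, b⟩ <;> rw [a, b]), her, hdel]
        simp only [ev]
        push_cast
        ring
      · rw [if_neg hij, ev_lsub, ← hdel, ← List.map_cons (f := Prod.fst) (a := (e, i, j))]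
        have hne : f i ≠ f j := fun h => hij (hf i hi j hj h)
        have hdc := Gr.ph_dc (G := ⟨s, t, (((e, i, j) :: L).map Prod.fst).toFinset⟩) q hmem hne h1
        unfold Gr.ph Gr.mp at hdc
        simp only [her] at hdc
        rw [hdc]
        congr 1
        have hL' := ih (L.map fun x => (x.1, rl i j x.2.1, rl i j x.2.2)) (col {f i} (f j) ∘ s) (col {f i} (f j) ∘ t)
          (by rw [List.length_map, hL]) (by
            rw [List.map_map]
            exact hnd.2) (by
            intro x hx
            obtain ⟨y, hy, rfl⟩ := List.mem_map.1 hx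
            obtain ⟨y1, y2, y3⟩ := hst y hy
            have hcol : ∀ a < n, col {f i} (f j) (f a) = f (rl i j a) := by
              intro a ha
              by_cases hai : a = i
              · subst hai; simp [col, rl]
              · have : f a ≠ f i := fun h => hai (hf a ha i hi h)
                simp [col, rl, hai, this]
            refine ⟨rl_lt hj y1, rl_lt hj y2, ?_⟩
            simp only [Function.comp]
            rcases y3 with ⟨a, b⟩ | ⟨a, b⟩ <;> rw [a, b, hcol _ y1, hcol _ y2]
            · exact Or.inl ⟨rfl, rfl⟩
            · exact Or.inr ⟨rfl, rfl⟩)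
        rw [List.map_map, List.map_map] at hL'
        rw [List.map_map]
        exact hL'

/-- edges of the complete graph -/
def k4L : List (ℕ × ℕ) := [(0, 1), (0, 2), (0, 3), (1, 2), (1, 3), (2, 3)]

lemma fl_k4 : fl 6 k4L = [-6, 11, -6, 1] := by decide +kernel

lemma fl_cube : fl 12 cubeL = [-64, 154, -137, 58, -12, 1] := by decide +kernel

namespace Gr

variable {G : Gr V E}

lemma ph_list (q : ℝ) {f : ℕ → V} {n : ℕ} {U : Finset V} (hU : U = (range n).image f) (hn : #U = n)
    {l : List (ℕ × ℕ)} (hl0 : l ≠ []) (hl : l.Nodup) (hln : ∀ p ∈ l, p.1 < n ∧ p.2 < n) (hsw : ∀ p ∈ l, ∀ r ∈ l, p ≠ r.swap)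
    (hb : ∀ p ∈ l, 0 < G.bt {f p.1} {f p.2}) (hc : #G.F = l.length) : G.ph q = ev q (fl l.length l) := by
  have hf : ∀ i < n, ∀ j < n, f i = f j → i = j := by
    have : Set.InjOn f (range n : Finset ℕ) := by
      rw [← card_image_iff, ← hU, hn, card_range]
    intro i hi j hj h
    exact this (by simpa using hi) (by simpa using hj) h
  have hE : Nonempty E := by
    obtain ⟨p, hp⟩ := List.exists_mem_of_ne_nil l hl0
    obtain ⟨e, he⟩ := exists_jn (hb p hp)
    exact ⟨e⟩
  have hex : ∀ p : ℕ × ℕ, ∃ e : E, p ∈ l → G.Jn e (f p.1) (f p.2) := by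
    intro p
    by_cases hp : p ∈ l
    · obtain ⟨e, he⟩ := exists_jn (hb p hp)
      exact ⟨e, fun _ => he⟩
    · exact ⟨hE.some, fun h => absurd h hp⟩
  choose g hg using hex
  have hm1 : (l.map fun p => (g p, p)).map Prod.fst = l.map g := by
    rw [List.map_map]; rfl
  have hm2 : (l.map fun p => (g p, p)).map Prod.snd = l := by
    rw [List.map_map]; exact List.map_id l
  have hnd : (l.map g).Nodup := by
    refine List.Nodup.map_on ?_ hl
    intro x hx y hy hxy
    obtain ⟨-, k1⟩ := hg x hx
    obtain ⟨-, k2⟩ := hg y hy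
    obtain ⟨x1, x2⟩ := hln x hx
    obtain ⟨y1, y2⟩ := hln y hy
    rw [hxy] at k1
    have hno := hsw x hx y hy
    have key : (f x.1 = f y.1 ∧ f x.2 = f y.2) ∨ (f x.1 = f y.2 ∧ f x.2 = f y.1) := by
      rcases k1 with ⟨a, b⟩ | ⟨a, b⟩ <;> rcases k2 with ⟨c, d⟩ | ⟨c, d⟩ <;> rw [← a, ← b, c, d] <;> tauto
    rcases key with ⟨a, b⟩ | ⟨a, b⟩
    · exact Prod.ext (hf _ x1 _ y1 a) (hf _ x2 _ y2 b)
    · exact absurd (Prod.ext (hf _ x1 _ y2 a) (hf _ x2 _ y1 b)) hno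
  have key := phi_list q hf l.length (l.map fun p => (g p, p)) G.s G.t (List.length_map _) (by rw [hm1]; exact hnd) (by
    intro x hx
    obtain ⟨p, hp, rfl⟩ := List.mem_map.1 hx
    exact ⟨(hln p hp).1, (hln p hp).2, (hg p hp).2⟩)
  rw [hm1, hm2] at key
  have hF : (l.map g).toFinset = G.F := by
    refine eq_of_subset_of_card_le ?_ ?_
    · intro e he
      rw [List.mem_toFinset] at he
      obtain ⟨p, hp, rfl⟩ := List.mem_map.1 he
      exact (hg p hp).1
    · rw [List.toFinset_card_of_nodup hnd, List.length_map, hc]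
  rw [hF] at key
  exact key

lemma Cub.card_F {U : Finset V} (hC : G.Cub U) : 2 * #G.F = 3 * #U := by
  have h1 : G.bt U U = 3 * #U := by
    rw [bt_sum, Finset.sum_congr rfl (fun v hv => by rw [← h_single hC.nl hv, hC.deg v hv])]
    simp [mul_comm]
  have h2 : G.bt U U = ∑ e ∈ G.F, 2 := by
    unfold bt
    refine Finset.sum_congr rfl fun e he => ?_
    have := hC.ends e he
    simp [ec, this.1, this.2]
  rw [h2] at h1
  simp at h1
  omega

lemma Cub.pos_cube {U : Finset V} {q : ℝ} (h2 : 2 < q) (h : q ^ 3 - 9 * q ^ 2 + 29 * q - 32 < 0) (hC : G.Cub U)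
    (hc : #U = 8 ∧ ∃ f : ℕ → V, U = (range 8).image f ∧ ∀ p ∈ cubeL, 0 < G.bt {f p.1} {f p.2}) :
    G.ph q < 0 := by
  obtain ⟨h8, f, hU, hb⟩ := hc
  have hF := hC.card_F
  rw [ph_list q hU h8 (l := cubeL) (by decide) (by decide) (by decide) (by decide) hb (by
    simp only [cubeL, List.length_cons, List.length_nil]; omega)]
  rw [show cubeL.length = 12 from rfl, fl_cube]
  simp only [ev]
  push_cast
  have e : (-64 + q * (154 + q * (-137 + q * (58 + q * (-12 + q * (1 + q * (0 : ℝ)))))) : ℝ) =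
    ((q - 1) * (q - 2)) * (q ^ 3 - 9 * q ^ 2 + 29 * q - 32) := by ring
  rw [e]
  exact mul_neg_of_pos_of_neg (mul_pos (by linarith) (by linarith)) h

lemma Cub.k4 {U : Finset V} (hC : G.Cub U) (h4 : #U = 4) {x y : V} (hx : x ∈ U) (hy : y ∈ U) (hxy : x ≠ y) :
    0 < G.bt {x} {y} := by
  have hle : ∀ z ∈ U \ {x}, G.bt {z} {x} ≤ 1 := by
    intro z hz
    rw [mem_sdiff, mem_singleton] at hz
    have k1 := h_pair (G := G) hz.1 hx hz.2
    rw [hC.deg x hx, hC.deg z hz.1] at k1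
    have hs : ({z, x} : Finset V) ⊆ U := by
      intro w; simp only [mem_insert, mem_singleton]; rintro (rfl | rfl)
      exacts [hz.1, hx]
    have := hC.cut3 {z, x} hs ⟨z, by simp⟩ (by
      intro h
      have := card_pair hz.2
      rw [h] at this
      omega)
    omega
  have h3 := hC.deg x hx
  unfold h at h3
  rw [bt_comm, bt_sum] at h3
  rw [bt_comm]
  by_contra hcon
  have c : #(U \ {x}) = 3 := by
    have := card_sdiff_add_card_eq_card (show {x} ⊆ U by simpa using hx)
    rw [card_singleton] at this
    omega
  have h6 : ∑ y ∈ U \ {x}, G.bt {y} {x} < ∑ y ∈ U \ {x}, 1 :=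
    sum_lt_sum hle ⟨y, by simp [hy, hxy.symm], by omega⟩
  simp only [sum_const, smul_eq_mul, mul_one] at h6
  omega

lemma exists_enum (U : Finset V) (hn : U.Nonempty) : ∃ f : ℕ → V, U = (range #U).image f := by
  obtain ⟨x0, hx0⟩ := hn
  refine ⟨fun n => if h : n < #U then (U.equivFin.symm ⟨n, h⟩).1 else x0, ?_⟩
  ext x
  simp only [mem_image, mem_range]
  constructor
  · intro hx
    refine ⟨U.equivFin ⟨x, hx⟩, Fin.is_lt _, ?_⟩
    simp
  · rintro ⟨n, hn, rfl⟩
    rw [dif_pos hn]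
    exact (U.equivFin.symm ⟨n, hn⟩).2

lemma Cub.pos_k4 {U : Finset V} {q : ℝ} (h2 : 2 < q) (h3 : q < 3) (hC : G.Cub U) (h4 : #U = 4) :
    G.ph q < 0 := by
  obtain ⟨f, hU⟩ := exists_enum U (card_pos.1 (by omega))
  rw [h4] at hU
  have hF := hC.card_F
  have hf : Set.InjOn f (range 4 : Finset ℕ) := by
    rw [← card_image_iff, ← hU, h4, card_range]
  have hmem : ∀ i < 4, f i ∈ U := fun i hi => by
    rw [hU]; exact mem_image_of_mem f (by simpa using hi)
  have hb : ∀ i < 4, ∀ j < 4, i ≠ j → 0 < G.bt {f i} {f j} := fun i hi j hj hij =>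
    hC.k4 h4 (hmem i hi) (hmem j hj) fun h => hij (hf (by simpa using hi) (by simpa using hj) h)
  rw [ph_list q hU h4 (l := k4L) (by decide) (by decide) (by decide) (by decide) (by
    have hd : ∀ p ∈ k4L, p.1 < 4 ∧ p.2 < 4 ∧ p.1 ≠ p.2 := by decide
    intro p hp
    exact hb _ (hd p hp).1 _ (hd p hp).2.1 (hd p hp).2.2) (by
    simp only [k4L, List.length_cons, List.length_nil]; omega)]
  rw [show k4L.length = 6 from rfl, fl_k4]
  simp only [ev]
  push_cast
  have e : (-6 + q * (11 + q * (-6 + q * (1 + q * (0 : ℝ)))) : ℝ) =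
    ((q - 1) * (q - 2)) * (q - 3) := by ring
  rw [e]
  exact mul_neg_of_pos_of_neg (mul_pos (by linarith) (by linarith)) (by linarith)

end Gr

end Eval

end CubicFlow

namespace CubicFlow

section MainInd

variable {V E : Type} [Fintype V] [DecidableEq V] [DecidableEq E]

namespace Gr

variable {G : Gr V E}

lemma Near.cub {P : Finset V} {w : V} (hN : G.Near P w) (h3 : G.bt P {w} = 3) : G.Cub (insert w P) := by
  have hw := hN.wP
  have hcut : ∀ X ⊆ insert w P, X.Nonempty → X ≠ insert w P → 3 ≤ G.h (insert w P) X := by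
    intro X hX hn hne
    by_cases hwX : w ∈ X
    · rw [← h_compl G hX]
      have hs : insert w P \ X ⊆ P := by
        intro x; simp only [mem_sdiff, mem_insert]; rintro ⟨rfl | h, h'⟩
        · exact absurd hwX h'
        · exact h
      rw [h_insert hw hs]
      refine hN.cut3 _ hs ?_
      rw [sdiff_nonempty]
      exact fun h => hne (Subset.antisymm hX h)
    · have hs : X ⊆ P := by
        intro x hx
        rcases mem_insert.1 (hX hx) with rfl | h
        · exact absurd hx hwX
        · exact h
      rw [h_insert hw hs]
      exact hN.cut3 X hs hn
  refine ⟨hN.ends, hN.nl, ?_, hcut⟩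
  intro v hv
  rcases mem_insert.1 hv with rfl | hv
  · unfold h
    rw [show insert v P \ {v} = P by
      ext x; simp only [mem_sdiff, mem_insert, mem_singleton]
      have : x = v → x ∉ P := by rintro rfl; exact hw
      tauto, bt_comm, h3]
  · rw [h_insert hw (by simpa using hv)]
    exact hN.deg v hv

/-- the main result on nearly cubic graphs -/
theorem near_pos {q : ℝ} (hq : 2 < q) (hq3 : q < 3) (hp : q ^ 3 - 9 * q ^ 2 + 29 * q - 32 < 0) :
    ∀ (n : ℕ) (G : Gr V E) (P : Finset V) (w : V), #G.F = n → G.Near P w → Pos q G P := by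
  intro n
  induction n using Nat.strong_induction_on with
  | _ n ih =>
  intro G P w hn hN
  have IH : ∀ (G' : Gr V E) (P' : Finset V) (w' : V), #G'.F < #G.F → G'.Near P' w' → Pos q G' P' :=
    fun G' P' w' hlt hN' => ih _ (by omega) G' P' w' rfl hN'
  have hw := hN.wP
  rcases P.eq_empty_or_nonempty with rfl | hPn
  · have hF : G.F = ∅ := by
      rw [eq_empty_iff_forall_notMem]
      intro e he
      have := hN.ends e he
      simp only [insert_empty_eq, mem_singleton] at this
      exact hN.nl e he (this.1.trans this.2.symm)
    unfold Pos ph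
    rw [hF, phi_empty]
    simp
  have hd3 := hN.cut3 P (Subset.refl P) hPn
  rw [show G.h P P = 0 by unfold h; simp, zero_add] at hd3
  rcases Nat.lt_or_ge #P 2 with hP2 | hP2
  · obtain ⟨v, rfl⟩ := card_eq_one.1 (show #P = 1 by have := hPn.card_pos; omega)
    have h1 := hN.deg v (by simp)
    rw [show G.h {v} {v} = 0 by unfold h; simp, zero_add] at h1
    have hvw : v ≠ w := fun h => hw (by simp [h])
    have hj : ∀ e ∈ G.F, (G.s e = v ∧ G.t e = w) ∨ (G.s e = w ∧ G.t e = v) := by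
      intro e he
      have a1 := hN.ends e he
      have a2 := hN.nl e he
      simp only [mem_insert, mem_singleton] at a1
      rcases a1 with ⟨b | b, c | c⟩
      · exact absurd (b.trans c.symm) a2
      · exact Or.inr ⟨b, c⟩
      · exact Or.inl ⟨b, c⟩
      · exact absurd (b.trans c.symm) a2
    have hF : #G.F = 3 := by
      rw [← h1, bt_eq_card G (by simpa using hvw)]
      congr 1
      ext e
      rw [mem_bte]
      simp only [mem_singleton]
      exact ⟨fun he => ⟨he, hj e he⟩, fun he => he.1⟩
    unfold Pos ph
    rw [phi_bond q G.s G.t G.F v w hvw hj, hF, bond_three, card_singleton]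
    have : 0 < (q - 1) * (q - 2) := mul_pos (by linarith) (by linarith)
    norm_num
    linarith
  by_cases hs1 : ∃ S ⊆ P, 2 ≤ #S ∧ S ≠ P ∧ G.h P S + G.bt S {w} = 3
  · obtain ⟨S, hS, a1, a2, a3⟩ := hs1
    exact hN.step1 hq IH hS a1 a2 a3
  have hc4 : ∀ S ⊆ P, 2 ≤ #S → S ≠ P → 4 ≤ G.h P S + G.bt S {w} := by
    intro S hS a1 a2
    by_contra hcon
    have := hN.cut3 S hS (card_pos.1 (by omega))
    exact hs1 ⟨S, hS, a1, a2, by omega⟩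
  rcases Nat.lt_or_ge (G.bt P {w}) 4 with hd | hd
  · have hC := hN.cub (by omega)
    have hcU : #(insert w P) = #P + 1 := card_insert_of_notMem hw
    have hF := hC.card_F
    rcases Nat.lt_or_ge #(insert w P) 6 with h6 | h6
    · have := hC.pos_k4 hq hq3 (by omega)
      unfold Pos
      rw [show #G.F = 6 by omega, show #P = 3 by omega]
      norm_num
      exact this
    · have hC4 : G.C4 (insert w P) := by
        refine ⟨hC, ?_, h6⟩
        intro X hX hX2 hX2'
        have key : ∀ X ⊆ insert w P, 2 ≤ #X → 2 ≤ #(insert w P \ X) → w ∉ X → 4 ≤ G.h (insert w P) X := by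
          intro X hX hX2 hX2' hwX
          have hs : X ⊆ P := by
            intro x hx
            rcases mem_insert.1 (hX hx) with rfl | h
            · exact absurd hx hwX
            · exact h
          rw [h_insert hw hs]
          refine hc4 X hs hX2 ?_
          rintro rfl
          rw [card_sdiff_of_subset hX] at hX2'
          omega
        by_cases hwX : w ∈ X
        · rw [← h_compl G hX]
          exact key _ sdiff_subset hX2' (by rw [Finset.sdiff_sdiff_eq_self hX]; exact hX2)
            (fun h => (mem_sdiff.1 h).2 hwX)
        · exact key X hX hX2 hX2' hwX
      by_cases hall : C4.AllR G (insert w P)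
      · have hcube := hC4.cube hall
        have := hC.pos_cube hq hp hcube
        have h8 := hcube.1
        unfold Pos
        rw [show #G.F = 12 by omega, show #P = 7 by omega]
        norm_num
        exact this
      · unfold C4.AllR at hall
        push Not at hall
        obtain ⟨u, hu, v, hv, h1, hnr⟩ := hall
        have := hC4.dc hu hv h1 hnr IH
        unfold Pos at this ⊢
        rw [card_erase_of_mem hu, hcU, Nat.add_sub_cancel] at this
        exact this
  · by_cases hs2 : ∃ S ⊆ P, 2 ≤ #S ∧ 2 ≤ #(P \ S) ∧ G.h P S = 2
    · obtain ⟨S, hS, a1, a2, a3⟩ := hs2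
      have b1 := hc4 S hS a1 (by rintro rfl; simp at a2)
      have b2 := hc4 (P \ S) sdiff_subset a2 (by
        intro h
        have := card_sdiff_add_card_eq_card hS
        rw [h] at this
        omega)
      rw [h_compl G hS] at b2
      have hsep : G.Sep P w S (P \ S) :=
        ⟨hN, hN.nb hd, (union_sdiff_of_subset hS).symm, disjoint_sdiff, a1, a2, a3, by omega, by omega⟩
      exact hsep.pos hq IH
    · have hst : G.St3 P w := by
        refine ⟨hN, hd, hc4, ?_⟩
        intro A hA a1 a2
        by_contra hcon
        have := hN.sep2 A hA (card_pos.1 (by omega)) (by rintro rfl; simp at a2)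
        exact hs2 ⟨A, hA, a1, a2, by omega⟩
      exact hst.pos IH

end Gr

end MainInd

end CubicFlow

namespace CubicFlow

section Outer

variable {V E : Type} [Fintype V] [DecidableEq V] [DecidableEq E]

namespace Gr

variable {G : Gr V E}

/-- bridgeless graphs with degrees (not counting loops) zero, two or three -/
structure QC (G : Gr V E) (U : Finset V) : Prop where
  ends : ∀ e ∈ G.F, G.s e ∈ U ∧ G.t e ∈ U
  deg : ∀ v ∈ U, G.h U {v} ≤ 3
  cut : ∀ X ⊆ U, G.h U X ≠ 1

lemma QC.contract {U U' : Finset V} (hQ : G.QC U) {c : V → V} {F' : Finset E} (hg : G.Good c F')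
    (hp : pre c U' = U) (hd : ∀ v ∈ U', G.h U (pre c {v}) ≤ 3) : (G.mp c F').QC U' := by
  refine ⟨?_, ?_, ?_⟩
  · intro e he
    have := hQ.ends e (hg.1 he)
    rw [← hp, mem_pre, mem_pre] at this
    exact this
  · intro v hv
    rw [good_h hg, hp]; exact hd v hv
  · intro X hX
    rw [good_h hg, hp]
    exact hQ.cut _ (hp ▸ pre_mono hX)

lemma col_pre_insert {U S : Finset V} {s0 : V} (hS : S ⊆ U) (hs0 : s0 ∈ S) :
    pre (col S s0) (insert s0 (U \ S)) = U := by
  rw [pre_col_mem (by simp)]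
  · ext x; simp only [mem_union, mem_insert, mem_sdiff]
    have : x ∈ S → x ∈ U := fun h => hS h
    constructor
    · rintro ((rfl | h) | h)
      · exact hS hs0
      · tauto
      · tauto
    · tauto
  · intro x hx hx'; simp only [mem_insert, mem_sdiff] at hx; tauto

lemma QC.coll {U S : Finset V} {s0 : V} (hQ : G.QC U) (hS : S ⊆ U) (hs0 : s0 ∈ S)
    (h3 : G.h U S ≤ 3) {F' : Finset E} (hg : G.Good (col S s0) F') :
    (G.mp (col S s0) F').QC (insert s0 (U \ S)) := by
  refine hQ.contract hg (col_pre_insert hS hs0) ?_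
  intro v hv
  by_cases hvs : v = s0
  · subst hvs
    have : pre (col S v) {v} = S := by
      rw [pre_col_mem (by simp) (by simp)]
      simp [hs0]
    rw [this]; exact h3
  · simp only [mem_insert, mem_sdiff, hvs, false_or] at hv
    have : pre (col S s0) {v} = {v} := by
      apply pre_col_not
      · simp; exact fun h => hvs h.symm
      · simpa using hv.2
    rw [this]; exact hQ.deg v hv.1

theorem QC.ne_zero {q : ℝ} (hq : 2 < q) (hq3 : q < 3) (hp : q^3-9*q^2+29*q-32 < 0) :
    ∀ n (G : Gr V E) (U : Finset V), #G.F + #U = n → G.QC U → G.ph q ≠ 0 := by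
  intro n
  induction n using Nat.strong_induction_on with
  | _ n IH =>
  intro G U hn hQ
  -- loops
  by_cases hl : ∃ e ∈ G.F, G.s e = G.t e
  · obtain ⟨e, he, hl⟩ := hl
    have hb : ∀ X, (G.del (G.F.erase e)).h U X = G.h U X := by
      intro X
      apply del_bt (erase_subset _ _)
      intro f hf hf'
      have : f = e := by simp [hf] at hf'; exact hf'
      subst this
      rw [hl]; simp only [mem_sdiff]; tauto
    have h1 := IH (#(G.F.erase e) + #U) (by rw [card_erase_of_mem he]; have := card_pos.2 ⟨e, he⟩; omega)
      (G.del (G.F.erase e)) U rfl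
      ⟨fun f hf => hQ.ends f (mem_of_mem_erase hf), fun v hv => by rw [hb]; exact hQ.deg v hv,
        fun X hX => by rw [hb]; exact hQ.cut X hX⟩
    have h2 : G.ph q = (q - 1) * (G.del (G.F.erase e)).ph q := phi_loop q G.s G.t he hl
    rw [h2]
    exact mul_ne_zero (by linarith) h1
  have hnl : ∀ e ∈ G.F, G.s e ≠ G.t e := fun e he h => hl ⟨e, he, h⟩
  -- isolated vertices
  by_cases h0 : ∃ v ∈ U, G.h U {v} = 0
  · obtain ⟨v, hv, h0⟩ := h0
    have hz := bt_zero_iff.1 (show G.bt {v} (U \ {v}) = 0 from h0)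
    have hh : ∀ X ⊆ U.erase v, G.h (U.erase v) X = G.h U X := by
      intro X hX
      have hi := h_insert (G := G) (P := U.erase v) (w := v) (by simp) hX
      rw [insert_erase hv] at hi
      have h5 : G.bt X {v} = 0 := by
        have := G.bt_mono_right {v} (A := X) (B := U \ {v}) (by rwa [sdiff_singleton_eq_erase])
        rw [bt_comm]
        unfold h at h0
        omega
      omega
    refine IH (#G.F + #(U.erase v)) (by rw [card_erase_of_mem hv]; have := card_pos.2 ⟨v, hv⟩; omega)
      G (U.erase v) rfl ⟨fun e he => ?_, fun x hx => ?_, fun X hX => ?_⟩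
    · have a1 := hQ.ends e he
      have a2 := hz e he
      have a3 := hnl e he
      simp only [mem_singleton, mem_sdiff, mem_erase] at a2 ⊢
      grind only
    · rw [hh _ (by simpa using hx)]; exact hQ.deg x (mem_of_mem_erase hx)
    · rw [hh X hX]; exact hQ.cut X (hX.trans (erase_subset _ _))
  -- degree two
  by_cases h2 : ∃ v ∈ U, G.h U {v} = 2
  · obtain ⟨v, hv, h2⟩ := h2
    have hbte : #(G.bte {v} (U \ {v})) = 2 := by
      rw [← bt_eq_card G disjoint_sdiff]; exact h2
    obtain ⟨e1, e2, he12, hbe⟩ := card_eq_two.1 hbte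
    have hm : ∀ e, e ∈ G.bte {v} (U \ {v}) ↔ e = e1 ∨ e = e2 := by intro e; rw [hbe]; simp
    have hm1 := G.mem_bte.1 ((hm e1).2 (Or.inl rfl))
    have hm2 := G.mem_bte.1 ((hm e2).2 (Or.inr rfl))
    have hr : ∃ r ∈ U, r ≠ v ∧ ((G.s e1 = v ∧ G.t e1 = r) ∨ (G.s e1 = r ∧ G.t e1 = v)) := by
      obtain ⟨-, h⟩ := hm1
      simp only [mem_singleton, mem_sdiff] at h
      rcases h with ⟨a, b⟩ | ⟨a, b⟩
      · exact ⟨_, b.1, b.2, Or.inl ⟨a, rfl⟩⟩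
      · exact ⟨_, a.1, a.2, Or.inr ⟨rfl, b⟩⟩
    obtain ⟨r, hrU, hrv, hr⟩ := hr
    have hcr : col {v} r r = r := col_not (by simpa using hrv)
    have hcv : col {v} r v = r := col_mem (by simp)
    have hg : G.Good (col {v} r) (G.F.erase e1) := by
      refine ⟨erase_subset _ _, fun f hf hf' => ?_⟩
      have : f = e1 := by simp [hf] at hf'; exact hf'
      subst this
      rcases hr with ⟨a, b⟩ | ⟨a, b⟩ <;> rw [a, b, hcr, hcv]
    have hpr : pre (col {v} r) (U.erase v) = U := by
      rw [pre_col_mem (by simp [hrU, hrv])]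
      · ext x; simp only [mem_union, mem_erase, mem_singleton]
        by_cases hx : x = v
        · subst hx; simp [hv]
        · simp [hx]
      · intro x hx hx'; simp at hx hx'; exact absurd hx' hx.1
    rw [G.ph_suppress q (e := e1) (f := e2) (v := v) (a := r) hm1.1 hm2.1 he12 hrv hr ?_ ?_]
    · refine IH (#(G.F.erase e1) + #(U.erase v)) ?_ (G.mp (col {v} r) (G.F.erase e1)) (U.erase v) rfl
        (hQ.contract hg hpr ?_)
      · rw [card_erase_of_mem hv, card_erase_of_mem hm1.1]; have := card_pos.2 ⟨v, hv⟩; omega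
      · intro x hx
        by_cases hxr : x = r
        · subst hxr
          have : pre (col {v} x) {x} = {x} ∪ {v} := pre_col_mem (by simp) (by simp)
          rw [this]
          have a1 := G.h_disj (P := U) (A := {x}) (B := {v}) (by simpa using hrU) (by simpa using hv)
            (by simpa using hrv)
          have a2 : 0 < G.bt {x} {v} := by
            rw [bt_eq_card G (by simpa using hrv)]
            refine card_pos.2 ⟨e1, G.mem_bte.2 ⟨hm1.1, ?_⟩⟩
            simp only [mem_singleton]; tauto
          have a3 := hQ.deg x hrU
          omega
        · have : pre (col {v} r) {x} = {x} := by
            apply pre_col_not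
            · simp; exact fun h => hxr h.symm
            · simpa using (mem_erase.1 hx).1
          rw [this]; exact hQ.deg x (mem_of_mem_erase hx)
    · obtain ⟨-, h⟩ := hm2
      simp only [mem_singleton, mem_sdiff] at h
      tauto
    · intro e he n1 n2
      have a1 := hm e
      have a2 := hnl e he
      have a3 := hQ.ends e he
      rw [mem_bte] at a1
      simp only [mem_singleton, mem_sdiff] at a1
      constructor
      · intro hh; rw [hh] at a2 a3 a1; grind only
      · intro hh; rw [hh] at a2 a3 a1; grind only
  have hdeg : ∀ v ∈ U, G.h U {v} = 3 := by
    intro v hv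
    have a1 := hQ.deg v hv
    have a2 := hQ.cut {v} (by simpa using hv)
    have a3 : G.h U {v} ≠ 0 := fun h => h0 ⟨v, hv, h⟩
    have a4 : G.h U {v} ≠ 2 := fun h => h2 ⟨v, hv, h⟩
    omega
  -- small cuts
  by_cases hX : ∃ X ⊆ U, X.Nonempty ∧ X ≠ U ∧ G.h U X < 3
  · obtain ⟨X, hX, hXn, hXU, hX3⟩ := hX
    have hX1 := hQ.cut X hX
    have big : ∀ Y ⊆ U, Y.Nonempty → G.h U Y < 3 → 2 ≤ #Y := by
      intro Y hY hYn hY3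
      by_contra hc
      have : #Y = 1 := by have := card_pos.2 hYn; omega
      obtain ⟨y, rfl⟩ := card_eq_one.1 this
      have := hdeg y (by simpa using hY)
      omega
    have hTn : (U \ X).Nonempty := by
      rw [sdiff_nonempty]; intro h; exact hXU (Subset.antisymm hX h)
    have hT3 : G.h U (U \ X) = G.h U X := G.h_compl hX
    have b1 := big X hX hXn hX3
    have b2 := big (U \ X) sdiff_subset hTn (by omega)
    obtain ⟨x0, hx0⟩ := hXn
    obtain ⟨t0, ht0⟩ := hTn
    have hcut := G.ph_cut q (S := X) (T := U \ X) disjoint_sdiff hx0 ht0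
      (by rw [union_sdiff_of_subset hX]; exact hQ.ends) (by unfold h at hX3; omega)
    have hcX := card_sdiff_of_subset hX
    have hle := card_le_card hX
    have p1 : (G.mp (col X x0) (G.keep X)).ph q ≠ 0 := by
      refine IH _ ?_ _ _ rfl (hQ.coll hX hx0 hX3.le (good_keep X x0))
      have k1 : #(G.keep X) ≤ #G.F := card_le_card (filter_subset _ _)
      have k2 : #(insert x0 (U \ X)) ≤ #(U \ X) + 1 := card_insert_le _ _
      show #(G.keep X) + #(insert x0 (U \ X)) < n
      omega
    have p2 : (G.mp (col (U \ X) t0) (G.keep (U \ X))).ph q ≠ 0 := by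
      refine IH _ ?_ _ _ rfl (hQ.coll sdiff_subset ht0 (by omega) (good_keep (U \ X) t0))
      have k1 : #(G.keep (U \ X)) ≤ #G.F := card_le_card (filter_subset _ _)
      have k2 : #(insert t0 (U \ (U \ X))) ≤ #(U \ (U \ X)) + 1 := card_insert_le _ _
      rw [Finset.sdiff_sdiff_eq_self hX] at k2 ⊢
      show #(G.keep (U \ X)) + #(insert t0 X) < n
      omega
    intro hz
    rw [hz, zero_mul] at hcut
    exact mul_ne_zero p2 p1 hcut.symm
  have hC : G.Cub U := by
    refine ⟨hQ.ends, hnl, hdeg, fun X h1 h2 h3 => ?_⟩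
    by_contra h
    exact hX ⟨X, h1, h2, h3, by omega⟩
  rcases U.eq_empty_or_nonempty with rfl | ⟨w, hw⟩
  · have hF : G.F = ∅ := by
      rw [eq_empty_iff_forall_notMem]; intro e he
      have := (hQ.ends e he).1
      simp at this
    unfold ph
    rw [hF, phi_empty]; exact one_ne_zero
  · have := near_pos hq hq3 hp _ G (U.erase w) w rfl (hC.near hw)
    unfold Pos at this
    intro hz
    rw [hz, mul_zero] at this
    exact lt_irrefl _ this

end Gr

lemma bridge_of_cut {V E : Type} [Fintype V] (G : Multigraph V E) (X : Set V) (e : E)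
    (he : ¬ (G.fst e ∈ X ↔ G.snd e ∈ X)) (hu : ∀ f, f ≠ e → (G.fst f ∈ X ↔ G.snd f ∈ X)) :
    G.IsBridge e := by
  have hinv : ∀ a b, Relation.EqvGen (G.edgeRelOn {f | f ≠ e}) a b → (a ∈ X ↔ b ∈ X) := by
    intro a b h
    induction h with
    | rel a b h =>
      obtain ⟨f, hf, ⟨rfl, rfl⟩ | ⟨rfl, rfl⟩⟩ := h
      · exact hu f hf
      · exact (hu f hf).symm
    | refl => exact Iff.rfl
    | symm _ _ _ ih => exact ih.symm
    | trans _ _ _ _ _ i1 i2 => exact i1.trans i2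
  have hmono : ∀ a b, Relation.EqvGen (G.edgeRelOn {f | f ≠ e}) a b →
      Relation.EqvGen (G.edgeRelOn Set.univ) a b := by
    intro a b h
    induction h with
    | rel a b h =>
      obtain ⟨f, hf, h⟩ := h
      exact Relation.EqvGen.rel _ _ ⟨f, Set.mem_univ _, h⟩
    | refl => exact Relation.EqvGen.refl _
    | symm _ _ _ ih => exact Relation.EqvGen.symm _ _ ih
    | trans _ _ _ _ _ i1 i2 => exact Relation.EqvGen.trans _ _ _ i1 i2
  let g : Quotient (G.reachSetoid {f | f ≠ e}) → Quotient (G.reachSetoid Set.univ) :=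
    Quotient.map' id hmono
  have hsurj : Function.Surjective g := by
    intro x
    induction x using Quotient.inductionOn with
    | _ a => exact ⟨Quotient.mk _ a, rfl⟩
  unfold Multigraph.IsBridge Multigraph.numComponents Multigraph.ncomp
  have hle := Nat.card_le_card_of_surjective g hsurj
  refine lt_of_le_of_ne hle fun heq => he ?_
  have hbij := (Nat.bijective_iff_surjective_and_card g).2 ⟨hsurj, heq.symm⟩
  have h1 : g (Quotient.mk _ (G.fst e)) = g (Quotient.mk _ (G.snd e)) := by
    apply Quotient.sound
    exact Relation.EqvGen.rel _ _ ⟨e, Set.mem_univ _, Or.inl ⟨rfl, rfl⟩⟩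
  exact hinv _ _ (Quotient.exact (hbij.1 h1))

lemma main_thm {V E : Type} [Fintype V] [Fintype E]
    (G : Multigraph V E) (hbl : G.Bridgeless) (hcubic : ∀ v, G.degree v = 3)
    (α : ℝ) (hα : α ^ 3 - 9 * α ^ 2 + 29 * α - 32 = 0) (hα2 : 2 < α) (hα3 : α < 3)
    (q : ℝ) (hq : 2 < q) (hqa : q < α) : G.flowPoly.eval q ≠ 0 := by
  classical
  rw [flowPoly_eval]
  let H : Gr V E := ⟨G.fst, G.snd, univ⟩
  have hneg : q ^ 3 - 9 * q ^ 2 + 29 * q - 32 < 0 := by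
    have e1 : q ^ 3 - 9 * q ^ 2 + 29 * q - 32 =
        (q - α) * (q ^ 2 + q * α + α ^ 2 - 9 * (q + α) + 29) := by linear_combination hα
    rw [e1]
    refine mul_neg_of_neg_of_pos (by linarith) ?_
    nlinarith [sq_nonneg (q - α), sq_nonneg (q + α - 6)]
  have hcut : ∀ X ⊆ (univ : Finset V), H.h univ X ≠ 1 := by
    intro X _ h1
    have h2 : #(H.bte X (univ \ X)) = 1 := by
      rw [← Gr.bt_eq_card H disjoint_sdiff]; exact h1
    obtain ⟨e, he⟩ := card_eq_one.1 h2
    have hm : ∀ f, f ∈ H.bte X (univ \ X) ↔ f = e := by intro f; rw [he]; simp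
    refine hbl e (bridge_of_cut G (X : Set V) e ?_ ?_)
    · have := (hm e).2 rfl
      rw [Gr.mem_bte] at this
      simp only [H, mem_sdiff, mem_univ, true_and] at this
      simp only [mem_coe]
      tauto
    · intro f hf
      have := (hm f).not.2 hf
      rw [Gr.mem_bte] at this
      simp only [H, mem_sdiff, mem_univ, true_and] at this
      simp only [mem_coe]
      tauto
  refine Gr.QC.ne_zero hq (by linarith) hneg _ H univ rfl ⟨?_, ?_, hcut⟩
  · intro e _; simp
  · intro v _
    have h3 := hcubic v
    unfold Multigraph.degree at h3
    have h4 : H.bt {v} univ = 3 := by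
      rw [← h3]
      unfold Gr.bt ec
      simp only [H, mem_singleton, mem_univ, and_true, true_and]
      rw [sum_add_distrib, ← card_filter, ← card_filter, Nat.card_eq_fintype_card,
        Nat.card_eq_fintype_card]
      congr 1 <;> rw [← Fintype.card_subtype] <;> rfl
    have h5 := H.bt_mono_right {v} (A := univ \ {v}) (B := univ) (subset_univ _)
    unfold Gr.h
    omega

end Outer

end CubicFlow

end Development

open Multigraph in
/-- Jackson. Let `α₁ ≈ 2.546602` be the unique real root in `(2,3)`
of `q³ − 9q² + 29q − 32`. Then every bridgeless cubic finite multigraph `G` has no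
flow root in `(2, α₁)`. -/
theorem flowPoly_ne_zero_cubic {V E : Type} [Fintype V] [Fintype E]
    (G : Multigraph V E) (hbl : G.Bridgeless) (hcubic : ∀ v, G.degree v = 3)
    (α : ℝ) (hα : α ^ 3 - 9 * α ^ 2 + 29 * α - 32 = 0) (hα2 : 2 < α) (hα3 : α < 3) :
    ∀ q : ℝ, 2 < q → q < α → G.flowPoly.eval q ≠ 0 := by
  intro q hq hqa
  exact CubicFlow.main_thm G hbl hcubic α hα hα2 hα3 q hq hqa
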